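/- Let K be a large field and F|K an algebraic function field which admits a K-rational place. Then every finite system of polynomial equations fᵢ(x₁,x₂,x₃) = 0 and inequations gⱼ(x₁,x₂,x₃) ≠ 0 in at most three variables with coefficients in K that has a solution in F³ has a solution in K³; that is, K is existentially closed in F with respect to all existential sentences with at most three existential quantifiers. -/

import Mathlib

noncomputable section
universe u v

section Place
variable (k : Type u) (F : Type v) [Field k] [Field F] [Algebra k F]

/-- A `k`-rational place of `F`: a valuation ring `O` of `F` containing `k` such that the
residue map restricts to an isomorphism of `k` onto the residue field of `O`. -/
def IsKRationalPlace (O : ValuationSubring F) : Prop :=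
  ∃ h : ∀ x : k, algebraMap k F x ∈ O,
    Function.Bijective (fun x : k => IsLocalRing.residue O ⟨algebraMap k F x, h x⟩)

/-- `F|k` is a function field: a finitely generated field extension of transcendence
degree at least `1`. -/
def IsFunctionField : Prop :=
  (∃ s : Finset F, IntermediateField.adjoin k (↑s : Set F) = ⊤) ∧ ¬ Algebra.IsAlgebraic k F

end Place

section LU

/-- A Noetherian local ring is regular if its maximal ideal can be generated by
(Krull dimension)-many elements. -/
def IsRegularLocalRingP (R : Type*) [CommRing R] [IsLocalRing R] : Prop :=
  IsNoetherianRing R ∧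
    ∃ s : Finset R, Ideal.span (↑s : Set R) = IsLocalRing.maximalIdeal R ∧
      (s.card : WithBot (WithTop ℕ)) = ringKrullDim R

variable {k : Type u} {F : Type v} [Field k] [Field F] [Algebra k F]

/-- The inclusion of a subalgebra contained in a valuation subring. -/
def subalgebraToValuationSubring (A : Subalgebra k F) (O : ValuationSubring F)
    (h : ∀ a : A, (a : F) ∈ O) : A →+* O where
  toFun a := ⟨(a : F), h a⟩
  map_one' := by ext; simp
  map_mul' x y := by ext; simp
  map_zero' := by ext; simp
  map_add' x y := by ext; simp

/-- The place given by the valuation ring `O` of `F` admits local uniformization: there is a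
finitely generated `k`-subalgebra `A ⊆ O` with fraction field `F` such that the localization
of `A` at the center `A ∩ m_O` is a regular local ring. -/
def AdmitsLocalUniformization (k : Type u) (F : Type v) [Field k] [Field F] [Algebra k F]
    (O : ValuationSubring F) : Prop :=
  ∃ (A : Subalgebra k F) (h : ∀ a : A, (a : F) ∈ O), A.FG ∧
    (∀ x : F, ∃ a b : A, (b : F) ≠ 0 ∧ x = a / b) ∧
    IsRegularLocalRingP (Localization.AtPrime
      (Ideal.comap (subalgebraToValuationSubring A O h) (IsLocalRing.maximalIdeal O)))

end LU
end


section EC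
universe u₁ u₂
variable (K : Type u₁) [Field K]

/-- `K` is existentially closed in the extension field `L`: every finite system of polynomial
equations and inequations over `K` having a solution in `L` has a solution in `K`. -/
def ExistentiallyClosedIn (L : Type u₂) [Field L] [Algebra K L] : Prop :=
  ∀ (n : ℕ) (E N : Finset (MvPolynomial (Fin n) K)),
    (∃ x : Fin n → L, (∀ f ∈ E, MvPolynomial.aeval x f = 0) ∧
      (∀ g ∈ N, MvPolynomial.aeval x g ≠ 0)) →
    ∃ x : Fin n → K, (∀ f ∈ E, MvPolynomial.eval x f = 0) ∧
      (∀ g ∈ N, MvPolynomial.eval x g ≠ 0)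

/-- A field `K` is large if it is existentially closed in the Laurent series field `K((t))`. -/
def IsLargeField : Prop := ExistentiallyClosedIn K (LaurentSeries K)

end EC

set_option linter.unusedSectionVars false

noncomputable section

namespace RationalPlace

section

open MvPolynomial

section Weights

variable {σ τ R M : Type*} [CommRing R] [AddCommMonoid M]

/-- Every monomial of `f` has weight at least `ρ`. -/
def WGE [LE M] (w : σ → M) (ρ : M) (f : MvPolynomial σ R) : Prop :=
  ∀ m, coeff m f ≠ 0 → ρ ≤ Finsupp.weight w m

/-- Every monomial of `f` has weight greater than `ρ`. -/
def WGT [LT M] (w : σ → M) (ρ : M) (f : MvPolynomial σ R) : Prop :=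
  ∀ m, coeff m f ≠ 0 → ρ < Finsupp.weight w m

lemma weight_eq_fin_three (w : Fin 3 → M) (m : Fin 3 →₀ ℕ) :
    Finsupp.weight w m = m 0 • w 0 + m 1 • w 1 + m 2 • w 2 := by
  rw [Finsupp.weight_apply, Finsupp.sum_fintype _ _ (by simp), Fin.sum_univ_three]

lemma exists_add_of_coeff_mul_ne_zero {f g : MvPolynomial σ R} {m : σ →₀ ℕ}
    (h : coeff m (f * g) ≠ 0) : ∃ a b, coeff a f ≠ 0 ∧ coeff b g ≠ 0 ∧ a + b = m := by
  classical
  rw [coeff_mul] at h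
  obtain ⟨x, hx, hne⟩ := Finset.exists_ne_zero_of_sum_ne_zero h
  exact ⟨x.1, x.2, left_ne_zero_of_mul hne, right_ne_zero_of_mul hne,
    Finset.HasAntidiagonal.mem_antidiagonal.1 hx⟩

variable [LinearOrder M] [IsOrderedCancelAddMonoid M] {w : σ → M} {w' : τ → M} {ρ ρ' : M}
  {f g : MvPolynomial σ R}

lemma WGE.add (hf : WGE w ρ f) (hg : WGE w ρ g) : WGE w ρ (f + g) := by
  intro m hm
  rw [coeff_add] at hm
  by_cases h : coeff m f = 0
  · exact hg m (by rintro h'; simp [h, h'] at hm)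
  · exact hf m h

lemma WGT.add (hf : WGT w ρ f) (hg : WGT w ρ g) : WGT w ρ (f + g) := by
  intro m hm
  rw [coeff_add] at hm
  by_cases h : coeff m f = 0
  · exact hg m (by rintro h'; simp [h, h'] at hm)
  · exact hf m h

lemma WGT.wge (hf : WGT w ρ f) : WGE w ρ f := fun m hm => (hf m hm).le

lemma WGE.mul (hf : WGE w ρ f) (hg : WGE w ρ' g) : WGE w (ρ + ρ') (f * g) := by
  intro m hm
  obtain ⟨a, b, ha, hb, rfl⟩ := exists_add_of_coeff_mul_ne_zero hm
  rw [map_add]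
  exact add_le_add (hf a ha) (hg b hb)

lemma WGE.mul_wgt (hf : WGE w ρ f) (hg : WGT w ρ' g) : WGT w (ρ + ρ') (f * g) := by
  intro m hm
  obtain ⟨a, b, ha, hb, rfl⟩ := exists_add_of_coeff_mul_ne_zero hm
  rw [map_add]
  exact add_lt_add_of_le_of_lt (hf a ha) (hg b hb)

lemma _root_.MvPolynomial.IsWeightedHomogeneous.wge
    (h : IsWeightedHomogeneous w f ρ) : WGE w ρ f := fun _ hm => (h hm).ge

lemma _root_.MvPolynomial.IsWeightedHomogeneous.wgt
    (h : IsWeightedHomogeneous w f ρ) (hρ : ρ' < ρ) : WGT w ρ' f :=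
  fun _ hm => (h hm).symm ▸ hρ

lemma WGE.finset_sum {ι : Type*} (s : Finset ι) {F : ι → MvPolynomial σ R}
    (h : ∀ i ∈ s, WGE w ρ (F i)) : WGE w ρ (∑ i ∈ s, F i) := by
  classical
  induction s using Finset.induction_on with
  | empty => intro m hm; simp at hm
  | insert a s ha ih =>
    rw [Finset.sum_insert ha]
    exact (h a (by simp)).add (ih fun i hi => h i (by simp [hi]))

lemma WGT.finset_sum {ι : Type*} (s : Finset ι) {F : ι → MvPolynomial σ R}
    (h : ∀ i ∈ s, WGT w ρ (F i)) : WGT w ρ (∑ i ∈ s, F i) := by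
  classical
  induction s using Finset.induction_on with
  | empty => intro m hm; simp at hm
  | insert a s ha ih =>
    rw [Finset.sum_insert ha]
    exact (h a (by simp)).add (ih fun i hi => h i (by simp [hi]))

lemma exponent_induction {motive : (σ →₀ ℕ) → Prop} (zero : motive 0)
    (step : ∀ m i, motive m → motive (m + Finsupp.single i 1)) (m : σ →₀ ℕ) : motive m := by
  suffices H : ∀ n, motive n → motive (n + m) by simpa using H 0 zero
  induction m using Finsupp.induction_linear with
  | zero => simp
  | add f g hf hg => intro n hn; rw [← add_assoc]; exact hg _ (hf _ hn)
  | single i b =>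
    induction b with
    | zero => simp
    | succ b ih => intro n hn; rw [Finsupp.single_add, ← add_assoc]; exact step _ _ (ih _ hn)

lemma aeval_monomial_add_single (θ : σ → MvPolynomial τ R) (m : σ →₀ ℕ) (i : σ) (a : R) :
    aeval θ (monomial (m + Finsupp.single i 1) a) = aeval θ (monomial m a) * θ i := by
  rw [monomial_add_single, map_mul, pow_one, aeval_X]

lemma aeval_eq_sum_monomial (θ : σ → MvPolynomial τ R) (f : MvPolynomial σ R) :
    aeval θ f = ∑ m ∈ f.support, aeval θ (monomial m (coeff m f)) := by
  conv_lhs => rw [f.as_sum, map_sum]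

lemma weight_add_single_one (w : σ → M) (m : σ →₀ ℕ) (i : σ) :
    Finsupp.weight w (m + Finsupp.single i 1) = Finsupp.weight w m + w i := by
  rw [map_add, Finsupp.weight_single, one_smul]

lemma wge_aeval_monomial {θ : σ → MvPolynomial τ R} (hθ : ∀ i, WGE w' (w i) (θ i))
    (m : σ →₀ ℕ) (a : R) : WGE w' (Finsupp.weight w m) (aeval θ (monomial m a)) := by
  induction m using exponent_induction with
  | zero =>
    rw [map_zero, ← C_apply, aeval_C, algebraMap_eq]
    exact (isWeightedHomogeneous_C w' a).wge
  | step m i ih =>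
    rw [aeval_monomial_add_single, weight_add_single_one]
    exact ih.mul (hθ i)

lemma WGE.mono (h : WGE w ρ f) (hρ : ρ' ≤ ρ) : WGE w ρ' f := fun m hm => hρ.trans (h m hm)

/-- Substituting polynomials of at least the prescribed weights preserves weight bounds. -/
lemma WGE.aeval {θ : σ → MvPolynomial τ R} (hθ : ∀ i, WGE w' (w i) (θ i)) (hf : WGE w ρ f) :
    WGE w' ρ (aeval θ f) := by
  rw [aeval_eq_sum_monomial]
  exact WGE.finset_sum _ fun m hm =>
    (wge_aeval_monomial hθ m _).mono (hf m (mem_support_iff.1 hm))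

lemma wgt_aeval_monomial_sub {θ : σ → MvPolynomial σ R} (hθ : ∀ i, WGT w (w i) (θ i - X i))
    (m : σ →₀ ℕ) (a : R) :
    WGT w (Finsupp.weight w m) (aeval θ (monomial m a) - monomial m a) := by
  have hθ' : ∀ i, WGE w (w i) (θ i) := fun i => by
    have := (hθ i).wge.add (isWeightedHomogeneous_X R w i).wge
    simpa using this
  induction m using exponent_induction with
  | zero =>
    rw [map_zero, ← C_apply, aeval_C, algebraMap_eq, sub_self]
    intro m hm
    simp at hm
  | step m i ih =>
    rw [aeval_monomial_add_single, weight_add_single_one, monomial_add_single, pow_one]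
    have h1 := (wge_aeval_monomial hθ' m a).mul_wgt (hθ i)
    have h2 := (isWeightedHomogeneous_X R w i).wge.mul_wgt ih
    rw [add_comm (w i)] at h2
    convert h1.add h2 using 1
    ring

/-- A substitution changing each variable by terms of higher weight changes a polynomial by
terms of higher weight. -/
lemma WGE.wgt_aeval_sub {θ : σ → MvPolynomial σ R} (hθ : ∀ i, WGT w (w i) (θ i - X i))
    (hf : WGE w ρ f) : WGT w ρ (MvPolynomial.aeval θ f - f) := by
  rw [aeval_eq_sum_monomial]
  conv => arg 3; arg 2; rw [f.as_sum]
  rw [← Finset.sum_sub_distrib]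
  exact WGT.finset_sum _ fun m hm n hn =>
    (hf m (mem_support_iff.1 hm)).trans_lt (wgt_aeval_monomial_sub hθ m _ n hn)

lemma isWeightedHomogeneous_aeval_monomial {θ : σ → MvPolynomial τ R}
    (hθ : ∀ i, IsWeightedHomogeneous w' (θ i) (w i)) (m : σ →₀ ℕ) (a : R) :
    IsWeightedHomogeneous w' (aeval θ (monomial m a)) (Finsupp.weight w m) := by
  induction m using exponent_induction with
  | zero =>
    rw [map_zero, ← C_apply, aeval_C, algebraMap_eq]
    exact isWeightedHomogeneous_C w' a
  | step m i ih =>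
    rw [aeval_monomial_add_single, weight_add_single_one]
    exact ih.mul (hθ i)

/-- Weighted homogeneous substitutions commute with taking homogeneous components. -/
lemma weightedHomogeneousComponent_aeval {θ : σ → MvPolynomial τ R}
    (hθ : ∀ i, IsWeightedHomogeneous w' (θ i) (w i)) (ρ : M) (f : MvPolynomial σ R) :
    weightedHomogeneousComponent w' ρ (MvPolynomial.aeval θ f) =
      MvPolynomial.aeval θ (weightedHomogeneousComponent w ρ f) := by
  classical
  induction f using MvPolynomial.induction_on' with
  | add p q hp hq => simp only [map_add, hp, hq]
  | monomial m a =>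
    rw [weightedHomogeneousComponent_of_mem (isWeightedHomogeneous_aeval_monomial hθ m a),
      weightedHomogeneousComponent_of_mem (isWeightedHomogeneous_monomial w m a rfl)]
    split_ifs <;> simp

lemma weightedHomogeneousComponent_mul_of_left {n : M}
    (hg : IsWeightedHomogeneous w g n) (ρ : M) (f : MvPolynomial σ R) :
    weightedHomogeneousComponent w (n + ρ) (g * f) =
      g * weightedHomogeneousComponent w ρ f := by
  classical
  induction f using MvPolynomial.induction_on' with
  | add p q hp hq => simp only [map_add, mul_add, hp, hq]
  | monomial m a =>
    rw [weightedHomogeneousComponent_of_mem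
        (hg.mul (isWeightedHomogeneous_monomial w m a rfl)),
      weightedHomogeneousComponent_of_mem (isWeightedHomogeneous_monomial w m a rfl)]
    simp only [add_right_inj]
    split_ifs <;> simp

lemma WGE.weightedHomogeneousComponent_aeval_eq {θ : σ → MvPolynomial σ R}
    (hθ : ∀ i, WGT w (w i) (θ i - X i)) (hf : WGE w ρ f) :
    weightedHomogeneousComponent w ρ (MvPolynomial.aeval θ f) =
      weightedHomogeneousComponent w ρ f := by
  classical
  rw [← sub_eq_zero, ← map_sub]
  ext m
  rw [coeff_weightedHomogeneousComponent, coeff_zero]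
  split_ifs with h
  · by_contra hne
    exact absurd h (hf.wgt_aeval_sub hθ m hne).ne'
  · rfl

lemma WGE.aeval_of_wgt_sub {θ : σ → MvPolynomial σ R}
    (hθ : ∀ i, WGT w (w i) (θ i - X i)) (hf : WGE w ρ f) :
    WGE w ρ (MvPolynomial.aeval θ f) :=
  hf.aeval fun i => by
    have := (hθ i).wge.add (isWeightedHomogeneous_X R w i).wge
    simpa using this

lemma coeff_weightedHomogeneousComponent_self (w : σ → M) (m : σ →₀ ℕ)
    (f : MvPolynomial σ R) :
    coeff m (weightedHomogeneousComponent w (Finsupp.weight w m) f) = coeff m f := by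
  classical
  rw [coeff_weightedHomogeneousComponent, if_pos rfl]

end Weights

section ChainRule

variable {σ τ R : Type*} [CommRing R]

lemma pderiv_aeval_of_pderiv_eq_zero (i : σ) (j : τ) (θ : σ → MvPolynomial τ R)
    (h : ∀ k, k ≠ i → pderiv j (θ k) = 0) (f : MvPolynomial σ R) :
    pderiv j (aeval θ f) = aeval θ (pderiv i f) * pderiv j (θ i) := by
  classical
  induction f using MvPolynomial.induction_on with
  | C a => simp
  | add p q hp hq => simp only [map_add, hp, hq, add_mul]
  | mul_X p k hp =>
    rw [map_mul, Derivation.leibniz, Derivation.leibniz, aeval_X, hp]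
    simp only [smul_eq_mul, map_add, map_mul, aeval_X, pderiv_X]
    rcases eq_or_ne k i with rfl | hk
    · simp; ring
    · rw [h k hk]
      simp [Pi.single_eq_of_ne hk]
      ring

end ChainRule

section Places

variable {K F Γ : Type*} [Field K] [Field F] [Algebra K F] [LinearOrderedCommGroupWithZero Γ]

/-- The valuation `v` is trivial on `K` and has residue field `K`. -/
structure IsRationalVal (K : Type*) [Field K] [Algebra K F] (v : Valuation F Γ) : Prop where
  map_algebraMap : ∀ c : K, c ≠ 0 → v (algebraMap K F c) = 1
  exists_sub_lt : ∀ x, v x ≤ 1 → ∃ c : K, v (x - algebraMap K F c) < 1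

lemma IsRationalVal.map_algebraMap_le {v : Valuation F Γ} (hv : IsRationalVal K v) (c : K) :
    v (algebraMap K F c) ≤ 1 := by
  rcases eq_or_ne c 0 with rfl | hc
  · simp
  · exact (hv.map_algebraMap c hc).le

/-- The value of the monomial with exponent `m` at `P`. -/
def monVal (v : Valuation F Γ) (P : Fin 3 → F) (m : Fin 3 →₀ ℕ) : Γ :=
  v (P 0) ^ m 0 * v (P 1) ^ m 1 * v (P 2) ^ m 2

variable {v : Valuation F Γ} {P : Fin 3 → F} {f g : MvPolynomial (Fin 3) K}

lemma aeval_monomial_fin_three {A : Type*} [CommRing A] [Algebra K A] (P : Fin 3 → A)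
    (m : Fin 3 →₀ ℕ) (c : K) :
    aeval P (monomial m c) = algebraMap K A c * (P 0 ^ m 0 * P 1 ^ m 1 * P 2 ^ m 2) := by
  rw [aeval_monomial, Finsupp.prod_fintype _ _ (by simp), Fin.prod_univ_three]

lemma val_aeval_monomial_le (hv : IsRationalVal K v) (P : Fin 3 → F) (m : Fin 3 →₀ ℕ) (c : K) :
    v (aeval P (monomial m c)) ≤ monVal v P m := by
  rw [aeval_monomial_fin_three]
  simp only [map_mul, map_pow]
  exact mul_le_of_le_one_left' (hv.map_algebraMap_le c)

lemma val_aeval_lt (hv : IsRationalVal K v) {γ : Γ} (hγ : γ ≠ 0)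
    (h : ∀ m, coeff m f ≠ 0 → monVal v P m < γ) : v (aeval P f) < γ := by
  rw [f.as_sum, map_sum]
  exact Valuation.map_sum_lt _ hγ fun m hm =>
    (val_aeval_monomial_le hv P m _).trans_lt (h m (mem_support_iff.1 hm))

lemma val_aeval_pderiv_le (hv : IsRationalVal K v) {γ : Γ}
    (h : ∀ m, coeff m f ≠ 0 → 0 < m 0 →
      v (P 0) ^ (m 0 - 1) * v (P 1) ^ m 1 * v (P 2) ^ m 2 ≤ γ) :
    v (aeval P (pderiv 0 f)) ≤ γ := by
  rw [f.as_sum, map_sum, map_sum]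
  refine Valuation.map_sum_le _ fun m hm => ?_
  rw [pderiv_monomial]
  rcases Nat.eq_zero_or_pos (m 0) with h0 | h0
  · simp [h0]
  · refine (val_aeval_monomial_le hv P _ _).trans ?_
    simpa [monVal] using h m (mem_support_iff.1 hm) h0

lemma eq_single_zero_iff (m : Fin 3 →₀ ℕ) (r : ℕ) :
    m = Finsupp.single 0 r ↔ m 0 = r ∧ m 1 = 0 ∧ m 2 = 0 := by
  rw [Finsupp.ext_iff, Fin.forall_fin_succ, Fin.forall_fin_succ, Fin.forall_fin_succ]
  simp

/-- A pure power of the first variable cannot dominate all other monomials at a zero. -/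
lemma not_dominant (hv : IsRationalVal K v) {r : ℕ} (hf : aeval P f = 0)
    (hr : coeff (Finsupp.single 0 r) f ≠ 0) (hz : P 0 ≠ 0)
    (h : ∀ m, coeff m f ≠ 0 → m ≠ Finsupp.single 0 r → monVal v P m < v (P 0) ^ r) : False := by
  have hz' : v (P 0) ≠ 0 := by simpa using hz
  set q := f - monomial (Finsupp.single 0 r) (coeff (Finsupp.single 0 r) f) with hq
  have h1 : v (aeval P q) < v (P 0) ^ r := by
    refine val_aeval_lt hv (pow_ne_zero _ hz') fun m hm => ?_
    have hne : m ≠ Finsupp.single 0 r := by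
      rintro rfl
      simp [hq] at hm
    refine h m ?_ hne
    rwa [hq, coeff_sub, coeff_monomial, if_neg hne.symm, sub_zero] at hm
  rw [hq, map_sub, hf, zero_sub, Valuation.map_neg, aeval_monomial_fin_three] at h1
  simp [hv.map_algebraMap _ hr] at h1

/-- The point `P` is centred at the origin of `K³`, it is a zero of `f` at which the derivative
with respect to the first variable does not vanish, and `g` does not vanish at `P`. -/
structure IsGoodPoint (v : Valuation F Γ) (f g : MvPolynomial (Fin 3) K) (P : Fin 3 → F) :
    Prop where
  lt : ∀ i, v (P i) < 1
  zero : aeval P f = 0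
  der : aeval P (pderiv 0 f) ≠ 0
  ne : aeval P g ≠ 0

/-- The system `f = 0`, `g ≠ 0` is solvable over `K`. -/
def Solvable (f g : MvPolynomial (Fin 3) K) : Prop :=
  ∃ Q : Fin 3 → K, eval Q f = 0 ∧ eval Q g ≠ 0

lemma Solvable.of_aeval {θ : Fin 3 → MvPolynomial (Fin 3) K} {f g f₁ q : MvPolynomial (Fin 3) K}
    (hf : aeval θ f = q * f₁) (h : Solvable f₁ (aeval θ g)) : Solvable f g := by
  obtain ⟨Q, h1, h2⟩ := h
  have key : ∀ p : MvPolynomial (Fin 3) K,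
      eval (fun i => eval Q (θ i)) p = eval Q (aeval θ p) := by
    intro p
    have := comp_aeval_apply (R := K) θ (aeval Q) p
    simpa [coe_aeval_eq_eval] using this.symm
  refine ⟨fun i => eval Q (θ i), ?_, ?_⟩
  · rw [key, hf, map_mul, h1, mul_zero]
  · rwa [key]

lemma aeval_aeval (P : Fin 3 → F) (θ : Fin 3 → MvPolynomial (Fin 3) K)
    (p : MvPolynomial (Fin 3) K) :
    aeval P (aeval θ p) = aeval (fun i => aeval P (θ i)) p :=
  comp_aeval_apply θ (aeval P) p

lemma IsGoodPoint.aeval_pderiv {θ : Fin 3 → MvPolynomial (Fin 3) K}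
    {f f₁ q : MvPolynomial (Fin 3) K} {P₁ : Fin 3 → F}
    (hθ : ∀ k, k ≠ 0 → pderiv 0 (θ k) = 0) (hf : aeval θ f = q * f₁) (hq : pderiv 0 q = 0)
    (hP : ∀ i, aeval P₁ (θ i) = P i) :
    aeval P (pderiv 0 f) * aeval P₁ (pderiv 0 (θ 0)) =
      aeval P₁ q * aeval P₁ (pderiv 0 f₁) := by
  have := congrArg (aeval P₁) (pderiv_aeval_of_pderiv_eq_zero 0 0 θ hθ f)
  rw [hf, Derivation.leibniz, hq, smul_zero, add_zero, smul_eq_mul, map_mul, map_mul,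
    aeval_aeval, funext hP] at this
  exact this.symm

lemma IsGoodPoint.subst (h : IsGoodPoint v f g P) {θ : Fin 3 → MvPolynomial (Fin 3) K}
    {f₁ q : MvPolynomial (Fin 3) K} {P₁ : Fin 3 → F}
    (hθ : ∀ k, k ≠ 0 → pderiv 0 (θ k) = 0) (hθ0 : aeval P₁ (pderiv 0 (θ 0)) ≠ 0)
    (hf : aeval θ f = q * f₁) (hq : pderiv 0 q = 0) (hq0 : aeval P₁ q ≠ 0)
    (hP : ∀ i, aeval P₁ (θ i) = P i) (hlt : ∀ i, v (P₁ i) < 1) :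
    IsGoodPoint v f₁ (aeval θ g) P₁ := by
  have hd := aeval_pderiv hθ hf hq hP
  refine ⟨hlt, ?_, ?_, ?_⟩
  · have := congrArg (aeval P₁) hf
    rw [aeval_aeval, funext hP, h.zero, map_mul] at this
    simpa [hq0] using this.symm
  · intro h0
    rw [h0, mul_zero] at hd
    exact mul_ne_zero h.der hθ0 hd
  · rw [aeval_aeval, funext hP]
    exact h.ne

/-- Monomials of degree less than `r` in `f`. -/
def HasLowMonomial (r : ℕ) (f : MvPolynomial (Fin 3) K) : Prop :=
  ∃ m, coeff m f ≠ 0 ∧ m 0 + m 1 + m 2 < r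

lemma degree_ge_of_not_hasLowMonomial {r : ℕ} (h : ¬ HasLowMonomial r f) {m : Fin 3 →₀ ℕ}
    (hm : coeff m f ≠ 0) : r ≤ m 0 + m 1 + m 2 := by
  by_contra hlt
  exact h ⟨m, hm, not_le.1 hlt⟩

lemma monVal_lt_pow_of_le {r : ℕ} (hlt : ∀ i, v (P i) < 1) (hz : P 0 ≠ 0) {m : Fin 3 →₀ ℕ}
    (h0 : r ≤ m 0) (hne : m ≠ Finsupp.single 0 r) : monVal v P m < v (P 0) ^ r := by
  have hz0 : 0 < v (P 0) := by simpa [zero_lt_iff] using hz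
  rw [Ne, eq_single_zero_iff] at hne
  have e1 : v (P 0) ^ m 0 ≤ v (P 0) ^ r := pow_le_pow_right_of_le_one' (hlt 0).le h0
  have e2 : v (P 1) ^ m 1 ≤ 1 := pow_le_one' (hlt 1).le _
  have e3 : v (P 2) ^ m 2 ≤ 1 := pow_le_one' (hlt 2).le _
  have hpos : 0 < v (P 0) ^ r := pow_pos hz0 r
  by_cases c1 : m 1 = 0
  · by_cases c2 : m 2 = 0
    · have : r < m 0 := by grind
      simp only [monVal, c1, c2, pow_zero, mul_one]
      exact pow_lt_pow_right_of_lt_one₀ hz0 (hlt 0) this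
    · have e3' : v (P 2) ^ m 2 < 1 := pow_lt_one₀ zero_le (hlt 2) c2
      calc monVal v P m ≤ v (P 0) ^ r * 1 * v (P 2) ^ m 2 := by unfold monVal; gcongr
        _ < v (P 0) ^ r := by simpa using mul_lt_of_lt_one_right hpos e3'
  · have e2' : v (P 1) ^ m 1 < 1 := pow_lt_one₀ zero_le (hlt 1) c1
    calc monVal v P m ≤ v (P 0) ^ r * v (P 1) ^ m 1 * 1 := by unfold monVal; gcongr
      _ < v (P 0) ^ r := by simpa using mul_lt_of_lt_one_right hpos e2'

lemma IsGoodPoint.exists_lt (hv : IsRationalVal K v) (h : IsGoodPoint v f g P) {r : ℕ}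
    (hr2 : 2 ≤ r) (hr : coeff (Finsupp.single 0 r) f ≠ 0) : ∃ m, coeff m f ≠ 0 ∧ m 0 < r := by
  by_contra! hcon
  have hz : P 0 = 0 := by
    by_contra hz
    exact not_dominant hv h.zero hr hz fun m hm hne =>
      monVal_lt_pow_of_le h.lt hz (hcon m hm) hne
  apply h.der
  have : v (aeval P (pderiv 0 f)) ≤ 0 := by
    refine val_aeval_pderiv_le hv fun m hm h0 => ?_
    have := hcon m hm
    rw [hz, map_zero, zero_pow (by omega)]
    simp
  simpa using this

/-- If `f` has order `r` at the origin and contains the `r`-th power of the first variable,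
then at a zero the first coordinate is dominated by the others. -/
lemma IsGoodPoint.val_le_of_not_hasLowMonomial (hv : IsRationalVal K v)
    (h : IsGoodPoint v f g P) {r : ℕ} (hlow : ¬ HasLowMonomial r f)
    (hr : coeff (Finsupp.single 0 r) f ≠ 0) {γ : Γ} (h1 : v (P 1) ≤ γ) (h2 : v (P 2) ≤ γ) :
    v (P 0) ≤ γ := by
  by_contra! hγ
  have hz0 : 0 < v (P 0) := zero_le.trans_lt hγ
  have hz : P 0 ≠ 0 := by simpa [zero_lt_iff] using hz0
  refine not_dominant hv h.zero hr hz fun m hm hne => ?_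
  have hd := degree_ge_of_not_hasLowMonomial hlow hm
  rcases Nat.eq_zero_or_pos (m 1 + m 2) with h12 | h12
  · exact monVal_lt_pow_of_le h.lt hz (by omega) hne
  · calc monVal v P m ≤ v (P 0) ^ m 0 * γ ^ m 1 * γ ^ m 2 := by unfold monVal; gcongr
      _ = v (P 0) ^ m 0 * γ ^ (m 1 + m 2) := by rw [mul_assoc, pow_add]
      _ < v (P 0) ^ m 0 * v (P 0) ^ (m 1 + m 2) := by
        have : γ ^ (m 1 + m 2) < v (P 0) ^ (m 1 + m 2) :=
          pow_lt_pow_left₀ hγ zero_le (by omega)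
        exact mul_lt_mul_of_pos_left this (pow_pos hz0 _)
      _ = v (P 0) ^ (m 0 + m 1 + m 2) := by rw [← pow_add]; congr 1; omega
      _ ≤ v (P 0) ^ r := pow_le_pow_right_of_le_one' (h.lt 0).le hd

/-- A bound on the slope of the Newton polygon in the direction of the second variable. -/
lemma IsGoodPoint.val_le_pow (hv : IsRationalVal K v)
    (h : IsGoodPoint v f g P) {r : ℕ} (hr : coeff (Finsupp.single 0 r) f ≠ 0) {a : ℕ}
    (ha : ∀ m, coeff m f ≠ 0 → m 0 < r → (r - m 0) * a ≤ m 1) :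
    v (P 0) ≤ v (P 1) ^ a := by
  by_contra! hγ
  have hz0 : 0 < v (P 0) := zero_le.trans_lt hγ
  have hz : P 0 ≠ 0 := by simpa [zero_lt_iff] using hz0
  refine not_dominant hv h.zero hr hz fun m hm hne => ?_
  rcases le_or_gt r (m 0) with h0 | h0
  · exact monVal_lt_pow_of_le h.lt hz h0 hne
  · have e2 : v (P 1) ^ m 1 ≤ (v (P 1) ^ a) ^ (r - m 0) := by
      rw [← pow_mul]
      exact pow_le_pow_right_of_le_one' (h.lt 1).le (by rw [mul_comm]; exact ha m hm h0)
    calc monVal v P m ≤ v (P 0) ^ m 0 * (v (P 1) ^ a) ^ (r - m 0) * 1 := by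
          unfold monVal
          gcongr
          exact pow_le_one' (h.lt 2).le _
      _ < v (P 0) ^ m 0 * v (P 0) ^ (r - m 0) := by
        rw [mul_one]
        exact mul_lt_mul_of_pos_left (pow_lt_pow_left₀ hγ zero_le (by omega)) (pow_pos hz0 _)
      _ = v (P 0) ^ r := by rw [← pow_add]; congr 1; omega

lemma IsGoodPoint.val_pderiv_le_pow (hv : IsRationalVal K v)
    (h : IsGoodPoint v f g P) {r : ℕ} (hr2 : 2 ≤ r) (hr : coeff (Finsupp.single 0 r) f ≠ 0)
    {a : ℕ} (ha : ∀ m, coeff m f ≠ 0 → m 0 < r → (r - m 0) * a ≤ m 1) :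
    v (aeval P (pderiv 0 f)) ≤ v (P 1) ^ a := by
  have hz := h.val_le_pow hv hr ha
  refine val_aeval_pderiv_le hv fun m hm h0 => ?_
  have e3 : v (P 2) ^ m 2 ≤ 1 := pow_le_one' (h.lt 2).le _
  rcases le_or_gt (m 0) 1 with h1 | h1
  · have e2 : v (P 1) ^ m 1 ≤ v (P 1) ^ a := by
      refine pow_le_pow_right_of_le_one' (h.lt 1).le ((Nat.le_mul_of_pos_left a ?_).trans
        (ha m hm (by omega)))
      omega
    have e1 : v (P 0) ^ (m 0 - 1) ≤ 1 := pow_le_one' (h.lt 0).le _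
    calc _ ≤ 1 * v (P 1) ^ a * 1 := by gcongr
      _ = _ := by simp
  · have e1 : v (P 0) ^ (m 0 - 1) ≤ v (P 1) ^ a :=
      (pow_le_of_le_one zero_le (h.lt 0).le (by omega)).trans hz
    have e2 : v (P 1) ^ m 1 ≤ 1 := pow_le_one' (h.lt 1).le _
    calc _ ≤ v (P 1) ^ a * 1 * 1 := by gcongr
      _ = _ := by simp

end Places

section Minimal

variable {K M : Type*} [Field K] [AddCommMonoid M] [LinearOrder M] [IsOrderedCancelAddMonoid M]

/-- The weights `w`, `r! • ex`, `r! • ey` of the three variables. -/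
def wts (r : ℕ) (ex ey w : M) : Fin 3 → M := ![w, r.factorial • ex, r.factorial • ey]

/-- `w` is the largest weight of the first variable for which all monomials of `f` have weight
at least `r • w`. -/
structure IsMin (r : ℕ) (ex ey w : M) (f : MvPolynomial (Fin 3) K) : Prop where
  wge : WGE (wts r ex ey w) (r • w) f
  exists_eq : ∃ m, coeff m f ≠ 0 ∧ m 0 < r ∧ Finsupp.weight (wts r ex ey w) m = r • w

/-- The initial form of `f` is not the `r`-th power of a linear form in the first variable. -/
def Prepared (r : ℕ) (W : Fin 3 → M) (f : MvPolynomial (Fin 3) K) : Prop :=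
  ∀ (e c : K) (a b : ℕ), (c = 0 ∨ W 0 = a • W 1 + b • W 2) →
    weightedHomogeneousComponent W (r • W 0) f ≠ C e * (X 0 - C c * (X 1 ^ a * X 2 ^ b)) ^ r

variable {r : ℕ} {ex ey w : M} {f : MvPolynomial (Fin 3) K}

lemma weight_wts (m : Fin 3 →₀ ℕ) : Finsupp.weight (wts r ex ey w) m =
    m 0 • w + r.factorial • (m 1 • ex + m 2 • ey) := by
  rw [weight_eq_fin_three, smul_add, add_assoc, smul_smul, smul_smul, mul_comm _ (m 1),
    mul_comm _ (m 2), mul_smul, mul_smul]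
  rfl

lemma weight_wts_eq_iff {m : Fin 3 →₀ ℕ} (hm : m 0 < r) :
    Finsupp.weight (wts r ex ey w) m = r • w ↔
      r.factorial • (m 1 • ex + m 2 • ey) = (r - m 0) • w := by
  rw [weight_wts]
  conv_lhs => rhs; rw [show r = m 0 + (r - m 0) by omega, add_smul]
  exact add_right_inj _

lemma le_weight_wts_iff {m : Fin 3 →₀ ℕ} (hm : m 0 < r) :
    r • w ≤ Finsupp.weight (wts r ex ey w) m ↔
      (r - m 0) • w ≤ r.factorial • (m 1 • ex + m 2 • ey) := by
  rw [weight_wts]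
  conv_lhs => lhs; rw [show r = m 0 + (r - m 0) by omega, add_smul]
  exact add_le_add_iff_left _

lemma lt_weight_wts_iff {m : Fin 3 →₀ ℕ} (hm : m 0 < r) :
    r • w < Finsupp.weight (wts r ex ey w) m ↔
      (r - m 0) • w < r.factorial • (m 1 • ex + m 2 • ey) := by
  rw [weight_wts]
  conv_lhs => lhs; rw [show r = m 0 + (r - m 0) by omega, add_smul]
  exact add_lt_add_iff_left _

lemma exists_isMin (hex : 0 ≤ ex) (hey : 0 ≤ ey) (h : ∃ m, coeff m f ≠ 0 ∧ m 0 < r) :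
    ∃ w, 0 ≤ w ∧ IsMin r ex ey w f := by
  classical
  let q : (Fin 3 →₀ ℕ) → M := fun m => (r.factorial / (r - m 0)) • (m 1 • ex + m 2 • ey)
  have hpos : ∀ m : Fin 3 →₀ ℕ, 0 ≤ m 1 • ex + m 2 • ey := fun m =>
    add_nonneg (nsmul_nonneg hex _) (nsmul_nonneg hey _)
  have hq : ∀ m : Fin 3 →₀ ℕ, m 0 < r →
      (r - m 0) • q m = r.factorial • (m 1 • ex + m 2 • ey) := by
    intro m hm
    rw [smul_smul, Nat.mul_div_cancel']
    exact Nat.dvd_factorial (by omega) (by omega)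
  obtain ⟨m₀, hm₀, hmin⟩ := Finset.exists_min_image (f.support.filter fun m => m 0 < r) q
    (by obtain ⟨m, hm, hlt⟩ := h; exact ⟨m, by simp [hm, hlt]⟩)
  simp only [Finset.mem_filter, mem_support_iff] at hm₀ hmin
  have h0 : 0 ≤ q m₀ := nsmul_nonneg (hpos _) _
  refine ⟨q m₀, h0, fun m hm => ?_, m₀, hm₀.1, hm₀.2, ?_⟩
  · rcases lt_or_ge (m 0) r with hlt | hge
    · rw [le_weight_wts_iff hlt, ← hq m hlt]
      exact nsmul_le_nsmul_right (hmin m ⟨hm, hlt⟩) _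
    · rw [weight_wts]
      exact (nsmul_le_nsmul_left h0 hge).trans (le_add_of_nonneg_right (nsmul_nonneg (hpos _) _))
  · rw [weight_wts_eq_iff hm₀.2, hq _ hm₀.2]

/-- The substitution `X₀ ↦ X₀ + h`. -/
def shift (h : MvPolynomial (Fin 3) K) : Fin 3 → MvPolynomial (Fin 3) K := ![X 0 + h, X 1, X 2]

lemma wgt_shift_sub {W : Fin 3 → M} {h : MvPolynomial (Fin 3) K} (hh : WGT W (W 0) h)
    (i : Fin 3) : WGT W (W i) (shift h i - X i) := by
  fin_cases i
  · simpa [shift] using hh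
  · intro m hm; simp [shift] at hm
  · intro m hm; simp [shift] at hm

lemma isWeightedHomogeneous_shift {W : Fin 3 → M} {h : MvPolynomial (Fin 3) K}
    (hh : IsWeightedHomogeneous W h (W 0)) (i : Fin 3) :
    IsWeightedHomogeneous W (shift h i) (W i) := by
  fin_cases i
  · exact (isWeightedHomogeneous_X K W 0).add hh
  · exact isWeightedHomogeneous_X K W 1
  · exact isWeightedHomogeneous_X K W 2

lemma isWeightedHomogeneous_C_mul {W : Fin 3 → M} (c : K) (a b : ℕ) :
    IsWeightedHomogeneous W (C c * (X 1 ^ a * X 2 ^ b)) (a • W 1 + b • W 2) := by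
  have := (isWeightedHomogeneous_C W c).mul
    (((isWeightedHomogeneous_X K W 1).pow a).mul ((isWeightedHomogeneous_X K W 2).pow b))
  rwa [zero_add] at this

lemma coeff_weightedHomogeneousComponent_of_eq {W : Fin 3 → M} {ρ : M} {m : Fin 3 →₀ ℕ}
    (h : Finsupp.weight W m = ρ) (f : MvPolynomial (Fin 3) K) :
    coeff m (weightedHomogeneousComponent W ρ f) = coeff m f := by
  rw [← h, coeff_weightedHomogeneousComponent_self]

lemma coeff_single_eq {W : Fin 3 → M} (f : MvPolynomial (Fin 3) K) :
    coeff (Finsupp.single 0 r) (weightedHomogeneousComponent W (r • W 0) f) =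
      coeff (Finsupp.single 0 r) f :=
  coeff_weightedHomogeneousComponent_of_eq (by rw [Finsupp.weight_single]) f

/-- Replacing the first variable increases the minimal weight, unless `f` is prepared. -/
lemma IsMin.exists_shift (h : IsMin r ex ey w f) (hr : coeff (Finsupp.single 0 r) f ≠ 0)
    (hp : ¬ Prepared r (wts r ex ey w) f) :
    ∃ (c : K) (a b : ℕ), c ≠ 0 ∧ w = r.factorial • (a • ex + b • ey) ∧
      WGE (wts r ex ey w) (r • w) (aeval (shift (C c * (X 1 ^ a * X 2 ^ b))) f) ∧
      coeff (Finsupp.single 0 r) (aeval (shift (C c * (X 1 ^ a * X 2 ^ b))) f) ≠ 0 ∧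
      ∀ w', IsMin r ex ey w' (aeval (shift (C c * (X 1 ^ a * X 2 ^ b))) f) → w < w' := by
  simp only [Prepared, not_forall, not_not] at hp
  obtain ⟨e, c, a, b, hc, he⟩ := hp
  have hw0 : wts r ex ey w 0 = w := rfl
  have hc0 : c ≠ 0 := by
    rintro rfl
    obtain ⟨m, hm, hmr, hw⟩ := h.exists_eq
    have := coeff_weightedHomogeneousComponent_of_eq hw f
    rw [hw0] at he
    rw [he, map_zero, zero_mul, sub_zero, coeff_C_mul, coeff_X_pow, if_neg, mul_zero] at this
    · exact hm this.symm
    · rintro rfl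
      simp at hmr
  replace hc := hc.resolve_left hc0
  have hc' : w = r.factorial • (a • ex + b • ey) := by
    rw [smul_add, smul_smul, smul_smul, mul_comm, mul_comm _ b, mul_smul, mul_smul]
    exact hc
  set p : MvPolynomial (Fin 3) K := C c * (X 1 ^ a * X 2 ^ b) with hpdef
  have hph : IsWeightedHomogeneous (wts r ex ey w) p (wts r ex ey w 0) := by
    rw [hc]; exact isWeightedHomogeneous_C_mul c a b
  have hsh := isWeightedHomogeneous_shift hph
  have hge : WGE (wts r ex ey w) (r • w) (aeval (shift p) f) :=
    h.wge.aeval fun i => (hsh i).wge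
  have hcomp : weightedHomogeneousComponent (wts r ex ey w) (r • w) (aeval (shift p) f) =
      C e * X 0 ^ r := by
    rw [weightedHomogeneousComponent_aeval hsh]
    rw [hw0] at he
    rw [he]
    simp [shift, hpdef, map_mul, map_pow, map_sub, bind₁_X_right]
  refine ⟨c, a, b, hc0, hc', hge, ?_, fun w' hw' => ?_⟩
  · have h1 := coeff_single_eq (r := r) (W := wts r ex ey w) (aeval (shift p) f)
    have h2 := coeff_single_eq (r := r) (W := wts r ex ey w) f
    rw [hw0] at h1 h2 he
    rw [hcomp, coeff_C_mul, coeff_X_pow, if_pos rfl, mul_one] at h1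
    rw [← h1]
    rintro rfl
    rw [he, map_zero, zero_mul, coeff_zero] at h2
    exact hr h2.symm
  · obtain ⟨m, hm, hmr, hmw⟩ := hw'.exists_eq
    have hlt : r • w < Finsupp.weight (wts r ex ey w) m := by
      refine lt_of_le_of_ne (hge m hm) fun heq => ?_
      have := coeff_weightedHomogeneousComponent_of_eq heq.symm (aeval (shift p) f)
      rw [hcomp, coeff_C_mul, coeff_X_pow, if_neg, mul_zero] at this
      · exact hm this.symm
      · rintro rfl
        simp at hmr
    rw [lt_weight_wts_iff hmr, (weight_wts_eq_iff hmr).1 hmw] at hlt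
    exact lt_of_nsmul_lt_nsmul_right _ hlt

lemma IsMin.aeval_of_wgt {θ : Fin 3 → MvPolynomial (Fin 3) K} (h : IsMin r ex ey w f)
    (hθ : ∀ i, WGT (wts r ex ey w) (wts r ex ey w i) (θ i - X i)) :
    IsMin r ex ey w (aeval θ f) := by
  refine ⟨h.wge.aeval_of_wgt_sub hθ, ?_⟩
  obtain ⟨m, hm, hmr, hmw⟩ := h.exists_eq
  refine ⟨m, ?_, hmr, hmw⟩
  rw [← coeff_weightedHomogeneousComponent_of_eq hmw,
    h.wge.weightedHomogeneousComponent_aeval_eq hθ, coeff_weightedHomogeneousComponent_of_eq hmw]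
  exact hm

lemma IsMin.prepared_aeval {θ : Fin 3 → MvPolynomial (Fin 3) K} (h : IsMin r ex ey w f)
    (hθ : ∀ i, WGT (wts r ex ey w) (wts r ex ey w i) (θ i - X i))
    (hp : Prepared r (wts r ex ey w) f) : Prepared r (wts r ex ey w) (aeval θ f) := by
  intro e c a b hc
  have := h.wge.weightedHomogeneousComponent_aeval_eq hθ
  rw [show r • wts r ex ey w 0 = r • w from rfl, this]
  exact hp e c a b hc

lemma IsMin.coeff_aeval_ne_zero {θ : Fin 3 → MvPolynomial (Fin 3) K} (h : IsMin r ex ey w f)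
    (hθ : ∀ i, WGT (wts r ex ey w) (wts r ex ey w i) (θ i - X i))
    (hr : coeff (Finsupp.single 0 r) f ≠ 0) : coeff (Finsupp.single 0 r) (aeval θ f) ≠ 0 := by
  rw [← coeff_single_eq (W := wts r ex ey w)] at hr ⊢
  have := h.wge.weightedHomogeneousComponent_aeval_eq hθ
  rw [show r • wts r ex ey w 0 = r • w from rfl] at hr ⊢
  rwa [this]

end Minimal

section BlowUp

variable {K M : Type*} [Field K] [AddCommMonoid M] [LinearOrder M] [IsOrderedCancelAddMonoid M]
  {r : ℕ} {f : MvPolynomial (Fin 3) K} {s : Fin 3} {d : Fin 3 → ℕ}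

lemma exists_eq_X_pow_mul {p : MvPolynomial (Fin 3) K}
    (h : ∀ m, coeff m p ≠ 0 → r ≤ m s) : ∃ q, p = X s ^ r * q := by
  change X s ^ r ∣ p
  rw [p.as_sum]
  refine Finset.dvd_sum fun m hm => ?_
  rw [X_pow_eq_monomial]
  have := h m (mem_support_iff.1 hm)
  refine ⟨monomial (m - Finsupp.single s r) (coeff m p), ?_⟩
  rw [monomial_mul, one_mul, add_tsub_cancel_of_le]
  simpa using this

/-- The substitution `X i ↦ X i * X s ^ d i`. -/
def blow (s : Fin 3) (d : Fin 3 → ℕ) (i : Fin 3) : MvPolynomial (Fin 3) K := X i * X s ^ d i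

lemma aeval_blow_monomial (m : Fin 3 →₀ ℕ) (a : K) :
    aeval (blow s d) (monomial m a) =
      monomial (m + Finsupp.single s (Finsupp.weight d m)) a := by
  induction m using exponent_induction with
  | zero => simp [← C_apply]
  | step m i ih =>
    rw [aeval_monomial_add_single, ih, weight_add_single_one, Finsupp.single_add,
      show m + Finsupp.single i 1 + (Finsupp.single s (Finsupp.weight d m) +
        Finsupp.single s (d i)) = m + Finsupp.single s (Finsupp.weight d m) +
        Finsupp.single i 1 + Finsupp.single s (d i) by abel, monomial_add_single,
      blow]
    simp only [monomial_add_single, pow_one]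
    ring

lemma blowExp_injective (hd : d s = 0) : Function.Injective
    fun m : Fin 3 →₀ ℕ => m + Finsupp.single s (Finsupp.weight d m) := by
  intro m n h
  have key : ∀ i, i ≠ s → m i = n i := by
    intro i hi
    have := DFunLike.congr_fun h i
    simpa [Finsupp.single_eq_of_ne hi] using this
  have hw : Finsupp.weight d m = Finsupp.weight d n := by
    rw [weight_eq_fin_three, weight_eq_fin_three]
    have : ∀ i, m i • d i = n i • d i := by
      intro i
      rcases eq_or_ne i s with rfl | hi
      · simp [hd]
      · rw [key i hi]
    rw [this, this, this]
  ext i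
  rcases eq_or_ne i s with rfl | hi
  · have := DFunLike.congr_fun h i
    simpa [hw] using this
  · exact key i hi

lemma coeff_aeval_blow (hd : d s = 0) (m : Fin 3 →₀ ℕ) :
    coeff (m + Finsupp.single s (Finsupp.weight d m)) (aeval (blow (K := K) s d) f) = coeff m f := by
  classical
  induction f using MvPolynomial.induction_on' with
  | add p q hp hq => rw [map_add, coeff_add, coeff_add, hp, hq]
  | monomial n a =>
    rw [aeval_blow_monomial, coeff_monomial, coeff_monomial]
    exact if_congr (blowExp_injective hd).eq_iff rfl rfl

lemma exists_of_coeff_aeval_blow_ne_zero {n : Fin 3 →₀ ℕ}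
    (h : coeff n (aeval (blow (K := K) s d) f) ≠ 0) :
    ∃ m, coeff m f ≠ 0 ∧ m + Finsupp.single s (Finsupp.weight d m) = n := by
  classical
  rw [aeval_eq_sum_monomial, coeff_sum] at h
  obtain ⟨m, hm, hne⟩ := Finset.exists_ne_zero_of_sum_ne_zero h
  rw [aeval_blow_monomial, coeff_monomial] at hne
  exact ⟨m, mem_support_iff.1 hm, by simpa using (ite_ne_right_iff.1 hne).1⟩

lemma aeval_blow_injective (hd : d s = 0) :
    Function.Injective (aeval (R := K) (blow (K := K) s d)) := by
  intro p q h
  ext m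
  rw [← coeff_aeval_blow hd m, ← coeff_aeval_blow hd m, h]

lemma exists_blow (hd : d s = 0) (hr : ∀ m, coeff m f ≠ 0 → r ≤ m s + Finsupp.weight d m) :
    ∃ f₁, aeval (blow s d) f = X s ^ r * f₁ ∧
      (∀ n, coeff n f₁ ≠ 0 → ∃ m, coeff m f ≠ 0 ∧
        m + Finsupp.single s (Finsupp.weight d m) = n + Finsupp.single s r) ∧
      (∀ m n, m + Finsupp.single s (Finsupp.weight d m) = n + Finsupp.single s r →
        coeff n f₁ = coeff m f) := by
  obtain ⟨f₁, hf₁⟩ := exists_eq_X_pow_mul (r := r) (s := s) (p := aeval (blow s d) f) (by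
    intro n hn
    obtain ⟨m, hm, rfl⟩ := exists_of_coeff_aeval_blow_ne_zero hn
    simpa using hr m hm)
  have hco : ∀ n, coeff n f₁ = coeff (n + Finsupp.single s r) (aeval (blow s d) f) := by
    intro n
    rw [hf₁, X_pow_eq_monomial, add_comm, coeff_monomial_mul, one_mul]
  refine ⟨f₁, hf₁, fun n hn => ?_, fun m n h => ?_⟩
  · rw [hco] at hn
    exact exists_of_coeff_aeval_blow_ne_zero hn
  · rw [hco, ← h, coeff_aeval_blow hd]

variable {ex ey w ex₁ ey₁ w₁ : M}

lemma weight_blow {W W₁ : Fin 3 → M} (hW : ∀ i, W i = W₁ i + d i • W₁ s) (m : Fin 3 →₀ ℕ) :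
    Finsupp.weight W m = Finsupp.weight W₁ (m + Finsupp.single s (Finsupp.weight d m)) := by
  rw [map_add, Finsupp.weight_single, weight_eq_fin_three, weight_eq_fin_three,
    weight_eq_fin_three, hW, hW, hW]
  simp only [smul_add, add_smul, smul_smul, smul_eq_mul]
  abel

lemma IsMin.blow {f₁ : MvPolynomial (Fin 3) K} (h : IsMin r ex ey w f) (hs : s ≠ 0)
    (hd0 : d 0 = 1) (hr : ∀ m, coeff m f ≠ 0 → r ≤ m s + Finsupp.weight d m)
    (h₁ : ∀ n, coeff n f₁ ≠ 0 → ∃ m, coeff m f ≠ 0 ∧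
        m + Finsupp.single s (Finsupp.weight d m) = n + Finsupp.single s r)
    (h₂ : ∀ m n, m + Finsupp.single s (Finsupp.weight d m) = n + Finsupp.single s r →
        coeff n f₁ = coeff m f)
    (hW : ∀ i, wts r ex ey w i = wts r ex₁ ey₁ w₁ i + d i • wts r ex₁ ey₁ w₁ s) :
    IsMin r ex₁ ey₁ w₁ f₁ := by
  have hw : w = w₁ + wts r ex₁ ey₁ w₁ s := by
    have := hW 0
    rwa [hd0, one_smul] at this
  have key : ∀ m n, m + Finsupp.single s (Finsupp.weight d m) = n + Finsupp.single s r →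
      Finsupp.weight (wts r ex ey w) m =
        Finsupp.weight (wts r ex₁ ey₁ w₁) n + r • wts r ex₁ ey₁ w₁ s := by
    intro m n hmn
    rw [weight_blow hW, hmn, map_add, Finsupp.weight_single]
  refine ⟨fun n hn => ?_, ?_⟩
  · obtain ⟨m, hm, hmn⟩ := h₁ n hn
    have := h.wge m hm
    rw [key m n hmn, hw, smul_add] at this
    exact le_of_add_le_add_right this
  · obtain ⟨m, hm, hmr, hmw⟩ := h.exists_eq
    obtain ⟨n, hn⟩ : ∃ n, m + Finsupp.single s (Finsupp.weight d m) = n + Finsupp.single s r :=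
      ⟨m + Finsupp.single s (Finsupp.weight d m) - Finsupp.single s r, by
        rw [tsub_add_cancel_of_le]
        simpa using hr m hm⟩
    refine ⟨n, by rwa [h₂ m n hn], ?_, ?_⟩
    · have := DFunLike.congr_fun hn 0
      simp only [Finsupp.add_apply, Finsupp.single_eq_of_ne hs.symm, add_zero] at this
      omega
    · rw [key m n hn, hw, smul_add] at hmw
      exact add_right_cancel hmw

lemma Prepared.blow {W W₁ : Fin 3 → M} {f₁ : MvPolynomial (Fin 3) K} (hp : Prepared r W f)
    (hd : d s = 0) (hd0 : d 0 = 1)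
    (hf : aeval (blow s d) f = X s ^ r * f₁)
    (hW : ∀ i, W i = W₁ i + d i • W₁ s)
    (hlift : ∀ a b : ℕ, W₁ 0 = a • W₁ 1 + b • W₁ 2 → ∃ a' b' : ℕ, W 0 = a' • W 1 + b' • W 2 ∧
      a' + d 1 * a' * (if s = 1 then 1 else 0) + d 2 * b' * (if s = 1 then 1 else 0) =
        a + (if s = 1 then 1 else 0) ∧
      b' + d 1 * a' * (if s = 2 then 1 else 0) + d 2 * b' * (if s = 2 then 1 else 0) =
        b + (if s = 2 then 1 else 0)) (hs : s ≠ 0) :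
    Prepared r W₁ f₁ := by
  intro e c a b hc he
  have hhom : ∀ i, IsWeightedHomogeneous W₁ (RationalPlace.blow (K := K) s d i) (W i) := by
    intro i
    rw [hW]
    exact (isWeightedHomogeneous_X K W₁ i).mul ((isWeightedHomogeneous_X K W₁ s).pow _)
  have h0 : W 0 = W₁ s + W₁ 0 := by rw [hW, hd0, one_smul, add_comm]
  have h1 : aeval (RationalPlace.blow s d) (weightedHomogeneousComponent W (r • W 0) f) =
      X s ^ r * (C e * (X 0 - C c * (X 1 ^ a * X 2 ^ b)) ^ r) := by
    rw [← weightedHomogeneousComponent_aeval hhom, hf, h0, smul_add,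
      weightedHomogeneousComponent_mul_of_left ((isWeightedHomogeneous_X K W₁ s).pow r), he]
  obtain ⟨a', b', hc', hab⟩ : ∃ a' b' : ℕ, (c = 0 ∨ W 0 = a' • W 1 + b' • W 2) ∧
      aeval (RationalPlace.blow s d) (C c * (X 1 ^ a' * X 2 ^ b') : MvPolynomial (Fin 3) K) =
        X s * (C c * (X 1 ^ a * X 2 ^ b)) := by
    rcases hc with rfl | hc
    · exact ⟨0, 0, Or.inl rfl, by simp⟩
    · obtain ⟨a', b', h1, h2, h3⟩ := hlift a b hc
      refine ⟨a', b', Or.inr h1, ?_⟩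
      simp only [map_mul, map_pow, aeval_X, RationalPlace.blow, aeval_C, algebraMap_eq]
      have : s = 1 ∨ s = 2 := by fin_cases s <;> simp_all
      rcases this with rfl | rfl
      · simp only [if_true, Fin.reduceEq, if_false, mul_one, mul_zero, add_zero] at h2 h3
        subst h3
        refine Eq.trans (b := C c * (X 1 ^ (a' + d 1 * a' + d 2 * b') * X 2 ^ b')) (by ring) ?_
        rw [h2]
        ring
      · simp only [if_true, Fin.reduceEq, if_false, mul_one, mul_zero, add_zero] at h2 h3
        subst h2
        refine Eq.trans (b := C c * (X 1 ^ a' * X 2 ^ (b' + d 1 * a' + d 2 * b'))) (by ring) ?_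
        rw [h3]
        ring
  refine hp e c a' b' hc' (aeval_blow_injective hd ?_)
  rw [h1, map_mul, map_pow, map_sub, hab, aeval_C, aeval_X, RationalPlace.blow, hd0,
    algebraMap_eq, pow_one, mul_comm (X 0) (X s), ← mul_sub, mul_pow]
  ring

/-- Transport along an additive map of the weights. -/
lemma IsMin.map {M' : Type*} [AddCommMonoid M'] [LinearOrder M'] [IsOrderedCancelAddMonoid M']
    (h : IsMin r ex ey w f) (L : M →+ M') (hL : Monotone L) :
    IsMin r (L ex) (L ey) (L w) f := by
  have key : ∀ m : Fin 3 →₀ ℕ, Finsupp.weight (wts r (L ex) (L ey) (L w)) m =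
      L (Finsupp.weight (wts r ex ey w) m) := by
    intro m; rw [weight_wts, weight_wts]; simp only [map_add, map_nsmul]
  refine ⟨fun m hm => ?_, ?_⟩
  · rw [key, ← map_nsmul]; exact hL (h.wge m hm)
  · obtain ⟨m, hm, hmr, hmw⟩ := h.exists_eq
    exact ⟨m, hm, hmr, by rw [key, hmw, map_nsmul]⟩

lemma Prepared.map {M' : Type*} [AddCommMonoid M'] [LinearOrder M'] [IsOrderedCancelAddMonoid M']
    (h : Prepared r (wts r ex ey w) f) (L : M →+ M') (hL : Function.Injective L) :
    Prepared r (wts r (L ex) (L ey) (L w)) f := by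
  classical
  have key : ∀ m : Fin 3 →₀ ℕ, Finsupp.weight (wts r (L ex) (L ey) (L w)) m =
      L (Finsupp.weight (wts r ex ey w) m) := by
    intro m; rw [weight_wts, weight_wts]; simp only [map_add, map_nsmul]
  intro e c a b hc
  convert! h e c a b (hc.imp_right fun hc => hL ?_) using 1
  · ext m
    rw [coeff_weightedHomogeneousComponent, coeff_weightedHomogeneousComponent, key]
    refine if_congr ?_ rfl rfl
    rw [show r • wts r (L ex) (L ey) (L w) 0 = L (r • wts r ex ey w 0) from
      (map_nsmul L r w).symm, hL.eq_iff]
  · simpa [wts] using hc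

/-- If a translation of the first variable produces no monomials of low degree, then it is
trivial. -/
lemma Prepared.eq_zero_of_not_hasLowMonomial (hmin : IsMin r ex ey w f)
    (hp : Prepared r (wts r ex ey w) f) (hex : 0 < ex) (hey : 0 < ey) (hw : 0 ≤ w)
    (hr0 : 0 < r)
    (hr : coeff (Finsupp.single 0 r) f ≠ 0)
    (hz : ∀ m, coeff m f ≠ 0 → m 1 = 0 → m 2 = 0 → m 0 ≤ r) {ζ : K}
    (hlow : ¬ HasLowMonomial r (aeval (shift (C ζ)) f)) : ζ = 0 := by
  classical
  by_contra hζ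
  let U : Fin 3 → ℕ := ![0, 1, 1]
  have hU : ∀ m, Finsupp.weight U m = m 1 + m 2 := by
    intro m; rw [weight_eq_fin_three]; simp [U]
  have hsh : ∀ c : K, ∀ i, IsWeightedHomogeneous U (shift (C c) i) (U i) := fun c =>
    isWeightedHomogeneous_shift (isWeightedHomogeneous_C U c)
  set φ := weightedHomogeneousComponent U 0 f with hφ
  have hφ2 : weightedHomogeneousComponent U 0 (aeval (shift (C ζ)) f) =
      aeval (shift (C ζ)) φ := weightedHomogeneousComponent_aeval (hsh ζ) 0 f
  -- the part of the translated polynomial in the first variable is a pure power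
  have hV : WGE (![-1, 0, 0] : Fin 3 → ℤ) (-(r : ℤ)) (aeval (shift (C ζ)) φ) := by
    refine WGE.aeval (w := (![-1, 0, 0] : Fin 3 → ℤ)) (fun i => ?_) fun m hm => ?_
    · fin_cases i
      · refine (isWeightedHomogeneous_X K _ 0).wge.add ?_
        exact (isWeightedHomogeneous_C _ ζ).wge.mono (by simp)
      · exact (isWeightedHomogeneous_X K _ 1).wge
      · exact (isWeightedHomogeneous_X K _ 2).wge
    · rw [hφ, coeff_weightedHomogeneousComponent] at hm
      obtain ⟨h1, h2⟩ := ite_ne_right_iff.1 hm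
      rw [hU] at h1
      have := hz m h2 (by omega) (by omega)
      rw [weight_eq_fin_three]
      simp
      exact_mod_cast this
  have hpure : ∃ e : K, aeval (shift (C ζ)) φ = C e * X 0 ^ r := by
    refine ⟨coeff (Finsupp.single 0 r) (aeval (shift (C ζ)) φ), ?_⟩
    ext m
    rw [coeff_C_mul, coeff_X_pow]
    split_ifs with hm
    · rw [← hm, mul_one]
    · rw [mul_zero]
      by_contra hne
      have h1 := hV m hne
      rw [weight_eq_fin_three] at h1
      simp at h1
      rw [← hφ2, coeff_weightedHomogeneousComponent] at hne
      obtain ⟨h2, h3⟩ := ite_ne_right_iff.1 hne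
      rw [hU] at h2
      have := degree_ge_of_not_hasLowMonomial hlow h3
      apply hm
      symm
      rw [eq_single_zero_iff]
      omega
  obtain ⟨e, he⟩ := hpure
  have hφe : φ = C e * (X 0 - C ζ) ^ r := by
    have h1 : aeval (shift (C (-ζ))) (aeval (shift (C ζ)) φ) = φ := by
      have := comp_aeval_apply (R := K) (shift (C ζ)) (aeval (shift (C (-ζ)))) φ
      rw [this]
      have h2 : (fun i => aeval (shift (C (-ζ))) (shift (C ζ) i)) =
          (X : Fin 3 → MvPolynomial (Fin 3) K) := by
        funext i
        fin_cases i <;> simp [shift]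
      rw [h2, aeval_X_left_apply]
    rw [← h1, he]
    simp [shift, sub_eq_add_neg]
  have hc0 : coeff 0 φ = e * (-ζ) ^ r := by
    rw [hφe, ← constantCoeff_eq]
    simp
  have he0 : e ≠ 0 := by
    rintro rfl
    apply hr
    rw [← coeff_weightedHomogeneousComponent_of_eq (W := U) (ρ := 0) (by rw [hU]; simp) f, ← hφ,
      hφe]
    simp
  have hf0 : coeff 0 f ≠ 0 := by
    rw [← coeff_weightedHomogeneousComponent_of_eq (W := U) (ρ := 0) (by rw [hU]; simp) f, ← hφ,
      hc0]
    exact mul_ne_zero he0 (pow_ne_zero _ (neg_ne_zero.2 hζ))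
  have hw0 : w = 0 := by
    have := hmin.wge 0 hf0
    rw [map_zero] at this
    by_contra hne
    exact absurd this (not_le.2 (nsmul_pos (lt_of_le_of_ne hw (Ne.symm hne)) hr0.ne'))
  subst hw0
  refine hp e ζ 0 0 (Or.inr (by simp [wts])) ?_
  rw [show r • wts r ex ey (0 : M) 0 = 0 from smul_zero r]
  have : weightedHomogeneousComponent (wts r ex ey 0) 0 f = φ := by
    ext m
    rw [hφ, coeff_weightedHomogeneousComponent, coeff_weightedHomogeneousComponent]
    refine if_congr ?_ rfl rfl
    rw [hU, weight_wts, smul_zero, zero_add]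
    constructor
    · intro h
      by_contra hne
      have : 0 < m 1 • ex + m 2 • ey := by
        rcases Nat.eq_zero_or_pos (m 1) with h1 | h1
        · have h2 : m 2 ≠ 0 := by omega
          rw [h1, zero_smul, zero_add]
          exact nsmul_pos hey h2
        · exact add_pos_of_pos_of_nonneg (nsmul_pos hex h1.ne') (nsmul_nonneg hey.le _)
      exact absurd h (nsmul_pos this (Nat.factorial_ne_zero r)).ne'
    · intro h
      rw [show m 1 = 0 by omega, show m 2 = 0 by omega]
      simp
  rw [this, hφe]
  simp

end BlowUp

section Steps

variable {K F Γ : Type*} [Field K] [Field F] [Algebra K F] [LinearOrderedCommGroupWithZero Γ]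
  {v : Valuation F Γ} {P : Fin 3 → F} {f g : MvPolynomial (Fin 3) K} {r : ℕ}

lemma Solvable.of_aeval_one {θ : Fin 3 → MvPolynomial (Fin 3) K}
    (h : Solvable (aeval θ f) (aeval θ g)) : Solvable f g :=
  Solvable.of_aeval (q := 1) (one_mul _).symm h

lemma IsGoodPoint.translate (h : IsGoodPoint v f g P) {θ : Fin 3 → MvPolynomial (Fin 3) K}
    {P₁ : Fin 3 → F} (hθ : ∀ k, k ≠ 0 → pderiv 0 (θ k) = 0) (hθ0 : pderiv 0 (θ 0) = 1)
    (hP : ∀ i, aeval P₁ (θ i) = P i) (hlt : ∀ i, v (P₁ i) < 1) :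
    IsGoodPoint v (aeval θ f) (aeval θ g) P₁ ∧
      aeval P₁ (pderiv 0 (aeval θ f)) = aeval P (pderiv 0 f) := by
  refine ⟨h.subst hθ (by simp [hθ0]) (q := 1) (one_mul _).symm (by simp) (by simp) hP hlt, ?_⟩
  have := IsGoodPoint.aeval_pderiv (P := P) (q := 1) (f₁ := aeval θ f) hθ (one_mul _).symm
    (by simp) hP
  simpa [hθ0] using this.symm

lemma aeval_aeval_poly (σ θ : Fin 3 → MvPolynomial (Fin 3) K) (p : MvPolynomial (Fin 3) K) :
    aeval σ (aeval θ p) = aeval (fun i => aeval σ (θ i)) p :=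
  comp_aeval_apply θ (aeval σ) p

lemma pderiv_zero_shift (p : MvPolynomial (Fin 3) K) (k : Fin 3) (hk : k ≠ 0) :
    pderiv 0 (shift p k) = 0 := by
  fin_cases k
  · exact absurd rfl hk
  · simp [shift, pderiv_X]
  · simp [shift, pderiv_X]

lemma pderiv_zero_shift_zero {p : MvPolynomial (Fin 3) K} (hp : pderiv 0 p = 0) :
    pderiv 0 (shift p 0) = 1 := by
  simp [shift, hp]

lemma aeval_shift_sub {p : MvPolynomial (Fin 3) K} {a : F} (hp : ∀ z, aeval ![z, P 1, P 2] p = a)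
    (i : Fin 3) : aeval ![P 0 - a, P 1, P 2] (shift p i) = P i := by
  fin_cases i
  · simp [shift, hp]
  · simp [shift]
  · simp [shift]

lemma IsGoodPoint.shift (h : IsGoodPoint v f g P) {p : MvPolynomial (Fin 3) K} {a : F}
    (hp : pderiv 0 p = 0) (ha : ∀ z, aeval ![z, P 1, P 2] p = a) (hlt : v (P 0 - a) < 1) :
    IsGoodPoint v (aeval (shift p) f) (aeval (RationalPlace.shift p) g) ![P 0 - a, P 1, P 2] ∧
      aeval ![P 0 - a, P 1, P 2] (pderiv 0 (aeval (RationalPlace.shift p) f)) =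
        aeval P (pderiv 0 f) := by
  refine h.translate (pderiv_zero_shift p) (pderiv_zero_shift_zero hp) (aeval_shift_sub ha)
    fun i => ?_
  fin_cases i
  · exact hlt
  · exact h.lt 1
  · exact h.lt 2

lemma pderiv_zero_blow {s : Fin 3} (hs : s ≠ 0) (d : Fin 3 → ℕ) (k : Fin 3) (hk : k ≠ 0) :
    pderiv 0 (blow (K := K) s d k) = 0 := by
  simp [blow, pderiv_X_of_ne hs, pderiv_X_of_ne hk]

lemma pderiv_zero_blow_zero {s : Fin 3} (hs : s ≠ 0) {d : Fin 3 → ℕ} (hd : d 0 = 1) :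
    pderiv 0 (blow (K := K) s d 0) = X s := by
  simp [blow, pderiv_X_of_ne hs, hd]

lemma solvable_of_blow (hv : IsRationalVal K v)
    (H : ∀ f g P, IsGoodPoint v f g P → HasLowMonomial (K := K) r f → Solvable f g)
    {s : Fin 3} {d : Fin 3 → ℕ} (hs : s ≠ 0) (hd : d 0 = 1)
    (h : IsGoodPoint v f g P) {P₁ : Fin 3 → F} (hP : ∀ i, P₁ i * P₁ s ^ d i = P i)
    (hs0 : P₁ s ≠ 0) (h0 : v (P₁ 0) ≤ 1) (h1 : v (P₁ 1) < 1) (h2 : v (P₁ 2) < 1)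
    {f₁ : MvPolynomial (Fin 3) K} (hf : aeval (blow s d) f = X s ^ r * f₁)
    (hζ : ∀ ζ : K, ¬ HasLowMonomial r (aeval (shift (C ζ)) f₁) → ζ = 0)
    (hnew : IsGoodPoint v f₁ (aeval (blow s d) g) P₁ →
      aeval P (pderiv 0 f) * P₁ s = P₁ s ^ r * aeval P₁ (pderiv 0 f₁) →
      Solvable f₁ (aeval (blow s d) g)) : Solvable f g := by
  have hblow : ∀ i, aeval P₁ (blow (K := K) s d i) = P i := fun i => by simpa [blow] using hP i
  have hq : pderiv 0 (X s ^ r : MvPolynomial (Fin 3) K) = 0 := by simp [pderiv_X_of_ne hs]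
  refine Solvable.of_aeval hf ?_
  obtain ⟨ζ, hζ1⟩ := hv.exists_sub_lt _ h0
  by_cases hζ0 : ζ = 0
  · have hlt : ∀ i, v (P₁ i) < 1 := by
      intro i
      fin_cases i
      · simpa [hζ0] using hζ1
      · exact h1
      · exact h2
    refine hnew (h.subst (pderiv_zero_blow hs d) ?_ hf hq (by simp [hs0]) hblow hlt) ?_
    · simp [pderiv_zero_blow_zero hs hd, hs0]
    · have := IsGoodPoint.aeval_pderiv (P := P) (pderiv_zero_blow hs d) hf hq hblow
      simpa [pderiv_zero_blow_zero hs hd] using this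
  · refine Solvable.of_aeval_one (θ := shift (C ζ))
      (H _ _ ![P₁ 0 - algebraMap K F ζ, P₁ 1, P₁ 2] ?_ (by_contra fun hl => hζ0 (hζ ζ hl)))
    have hsh : ∀ i, aeval ![P₁ 0 - algebraMap K F ζ, P₁ 1, P₁ 2] (shift (C ζ) i) = P₁ i :=
      aeval_shift_sub (by simp)
    have key := pderiv_aeval_of_pderiv_eq_zero 0 0 (shift (C ζ))
      (pderiv_zero_shift (K := K) (C ζ))
    rw [aeval_aeval_poly]
    refine h.subst (θ := fun i => aeval (shift (C ζ)) (blow s d i)) (q := X s ^ r) ?_ ?_ ?_ hq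
      ?_ ?_ ?_
    · intro k hk
      rw [key, pderiv_zero_blow hs d k hk, map_zero, zero_mul]
    · rw [key, pderiv_zero_blow_zero hs hd, pderiv_zero_shift_zero (by simp), mul_one, aeval_aeval,
        funext hsh]
      simpa using hs0
    · rw [← aeval_aeval_poly, hf, map_mul, map_pow, aeval_X]
      congr 2
      fin_cases s
      · exact absurd rfl hs
      · rfl
      · rfl
    · fin_cases s
      · exact absurd rfl hs
      · exact (by rw [map_pow, aeval_X]; exact pow_ne_zero _ hs0)
      · exact (by rw [map_pow, aeval_X]; exact pow_ne_zero _ hs0)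
    · intro i
      rw [aeval_aeval, funext hsh, hblow]
    · intro i
      fin_cases i
      · exact hζ1
      · exact h1
      · exact h2

end Steps

section MainPhase

variable {K F Γ : Type*} [Field K] [Field F] [Algebra K F] [LinearOrderedCommGroupWithZero Γ]
  {v : Valuation F Γ} {P : Fin 3 → F} {f g : MvPolynomial (Fin 3) K} {r : ℕ}

lemma IsGoodPoint.val_pderiv_le_one (hv : IsRationalVal K v) (h : IsGoodPoint v f g P) :
    v (aeval P (pderiv 0 f)) ≤ 1 := by
  refine val_aeval_pderiv_le hv fun m _ _ => ?_
  have e0 : v (P 0) ^ (m 0 - 1) ≤ 1 := pow_le_one' (h.lt 0).le _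
  have e1 : v (P 1) ^ m 1 ≤ 1 := pow_le_one' (h.lt 1).le _
  have e2 : v (P 2) ^ m 2 ≤ 1 := pow_le_one' (h.lt 2).le _
  calc _ ≤ (1 : Γ) * 1 * 1 := by gcongr
    _ = 1 := by simp

lemma pow_pred_lt_of_mul_eq {x d d' : F} (hx : v x < 1) (hx0 : x ≠ 0) (hd : v d ≤ 1)
    (hr : 2 ≤ r) {n : ℕ} (hn : v x ^ n < v d) (h : d * x = x ^ r * d') :
    1 ≤ n ∧ v x ^ (n - 1) < v d' := by
  have hn1 : 1 ≤ n := by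
    by_contra h0
    obtain rfl : n = 0 := by omega
    rw [pow_zero] at hn
    exact absurd hd (not_le.2 hn)
  refine ⟨hn1, ?_⟩
  have hvx : 0 < v x := by simpa [zero_lt_iff] using hx0
  have h1 : d = x ^ (r - 1) * d' := by
    apply mul_right_cancel₀ hx0
    rw [h, mul_right_comm, ← pow_succ]
    congr 2; omega
  rw [h1, map_mul, map_pow] at hn
  have h2 : v x ^ (r - 1) * v d' ≤ v x * v d' := by
    gcongr
    exact pow_le_of_le_one zero_le hx.le (by omega)
  have h3 := hn.trans_le h2
  rw [show n = n - 1 + 1 by omega, pow_succ'] at h3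
  exact lt_of_mul_lt_mul_left' h3

/-- The weight `(a, b)`, ordered lexicographically. -/
abbrev lexPair (a b : ℕ) : ℕ ×ₗ ℕ := toLex (a, b)

lemma lexPair_le {a b c d : ℕ} : lexPair a b ≤ lexPair c d ↔ a < c ∨ a = c ∧ b ≤ d :=
  Prod.Lex.toLex_le_toLex

lemma lexPair_lt {a b c d : ℕ} : lexPair a b < lexPair c d ↔ a < c ∨ a = c ∧ b < d :=
  Prod.Lex.toLex_lt_toLex

lemma lexPair_add {a b c d : ℕ} : lexPair a b + lexPair c d = lexPair (a + c) (b + d) := rfl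

lemma smul_lexPair {n a b : ℕ} : n • lexPair a b = lexPair (n * a) (n * b) := by
  induction n with
  | zero => simp; rfl
  | succ n ih => rw [succ_nsmul, ih, lexPair_add, add_mul, add_mul, one_mul, one_mul]

lemma lexPair_inj {a b c d : ℕ} : lexPair a b = lexPair c d ↔ a = c ∧ b = d := by
  rw [toLex_inj, Prod.mk.injEq]

lemma exists_lexPair (w : ℕ ×ₗ ℕ) : ∃ a b, w = lexPair a b := ⟨(ofLex w).1, (ofLex w).2, rfl⟩

lemma lexPair_zero : (0 : ℕ ×ₗ ℕ) = lexPair 0 0 := rfl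

/-- A good point together with a prepared equation of weight `(A, B)`. -/
structure IsPreparedPoint (v : Valuation F Γ) (r A B : ℕ) (f g : MvPolynomial (Fin 3) K)
    (P : Fin 3 → F) : Prop where
  good : IsGoodPoint v f g P
  coeff_ne : coeff (Finsupp.single 0 r) f ≠ 0
  isMin : IsMin r (lexPair 1 0) (lexPair 0 1) (lexPair A B) f
  prepared : Prepared r (wts r (lexPair 1 0) (lexPair 0 1) (lexPair A B)) f
  ne_zero : P 1 ≠ 0

lemma solvable_of_blow_of_prepared (hv : IsRationalVal K v) (hr2 : 2 ≤ r)
    (H : ∀ f g P, IsGoodPoint v f g P → HasLowMonomial (K := K) r f → Solvable f g)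
    (h : IsGoodPoint v f g P) (hrc : coeff (Finsupp.single 0 r) f ≠ 0)
    {ex ey w : ℕ ×ₗ ℕ} (hmin : IsMin r ex ey w f) (hp : Prepared r (wts r ex ey w) f)
    {s : Fin 3} {d : Fin 3 → ℕ} (hs : s ≠ 0) (hd : d s = 0) (hd0 : d 0 = 1)
    (hr : ∀ m, coeff m f ≠ 0 → r ≤ m s + Finsupp.weight d m)
    {A B : ℕ}
    (hW : ∀ i, wts r ex ey w i = wts r (lexPair 1 0) (lexPair 0 1) (lexPair A B) i +
      d i • wts r (lexPair 1 0) (lexPair 0 1) (lexPair A B) s)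
    (hlift : ∀ a b : ℕ, A = r.factorial * a → B = r.factorial * b →
      ∃ a' b' : ℕ, w = a' • r.factorial • ex + b' • r.factorial • ey ∧
      a' + d 1 * a' * (if s = 1 then 1 else 0) + d 2 * b' * (if s = 1 then 1 else 0) =
        a + (if s = 1 then 1 else 0) ∧
      b' + d 1 * a' * (if s = 2 then 1 else 0) + d 2 * b' * (if s = 2 then 1 else 0) =
        b + (if s = 2 then 1 else 0))
    (hz : ∀ m n : Fin 3 →₀ ℕ, m + Finsupp.single s (Finsupp.weight d m) = n + Finsupp.single s r →
      n 1 = 0 → n 2 = 0 → n 0 ≤ r)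
    {P₁ : Fin 3 → F} (hP : ∀ i, P₁ i * P₁ s ^ d i = P i)
    (hs0 : P₁ s ≠ 0) (h0 : v (P₁ 0) ≤ 1) (h1 : v (P₁ 1) < 1) (h2 : v (P₁ 2) < 1)
    (hne : P₁ 1 ≠ 0)
    (hnew : ∀ f₁ g₁ : MvPolynomial (Fin 3) K, IsPreparedPoint v r A B f₁ g₁ P₁ →
      aeval P (pderiv 0 f) * P₁ s = P₁ s ^ r * aeval P₁ (pderiv 0 f₁) → Solvable f₁ g₁) :
    Solvable f g := by
  obtain ⟨f₁, hf₁, hc1, hc2⟩ := exists_blow hd hr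
  have hmin₁ := hmin.blow hs hd0 hr hc1 hc2 hW
  have hp₁ := hp.blow hd hd0 hf₁ hW (by
    intro a b hab
    have : A = r.factorial * a ∧ B = r.factorial * b := by
      have : lexPair A B = a • r.factorial • lexPair 1 0 + b • r.factorial • lexPair 0 1 := hab
      simp only [smul_lexPair, lexPair_add, lexPair_inj] at this
      constructor
      · rw [this.1]; ring
      · rw [this.2]; ring
    exact hlift a b this.1 this.2) hs
  have hrc₁ : coeff (Finsupp.single 0 r) f₁ ≠ 0 := by
    rwa [hc2 (Finsupp.single 0 r) (Finsupp.single 0 r)]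
    rw [Finsupp.weight_single, hd0, smul_eq_mul, mul_one]
  refine solvable_of_blow hv H hs hd0 h hP hs0 h0 h1 h2 hf₁ (fun ζ hζ => ?_) fun hg hd => ?_
  · refine hp₁.eq_zero_of_not_hasLowMonomial hmin₁ ?_ ?_ ?_ (by omega) hrc₁ (fun n hn => ?_) hζ
    · rw [lexPair_zero, lexPair_lt]; omega
    · rw [lexPair_zero, lexPair_lt]; omega
    · rw [lexPair_zero, lexPair_le]; omega
    · obtain ⟨m, -, hmn⟩ := hc1 n hn
      exact hz m n hmn
  · exact hnew _ _ ⟨hg, hrc₁, hmin₁, hp₁, hne⟩ hd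

lemma add_single_eq {s : Fin 3} {d : Fin 3 → ℕ} {m n : Fin 3 →₀ ℕ}
    (h : m + Finsupp.single s (Finsupp.weight d m) = n + Finsupp.single s r) (i : Fin 3) :
    m i + (if s = i then m 0 * d 0 + m 1 * d 1 + m 2 * d 2 else 0) =
      n i + (if s = i then r else 0) := by
  have := DFunLike.congr_fun h i
  by_cases hi : s = i
  · simpa [weight_eq_fin_three, hi] using this
  · simpa [Finsupp.single_apply, hi] using this

/-- Blowing up the ideal of the first two variables. -/
lemma IsPreparedPoint.solvable_of_factorial_le (hv : IsRationalVal K v) (hr2 : 2 ≤ r)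
    (H : ∀ f g P, IsGoodPoint v f g P → HasLowMonomial (K := K) r f → Solvable f g)
    {A B n : ℕ} (h : IsPreparedPoint v r A B f g P) (hA : r.factorial ≤ A)
    (hn : v (P 1) ^ n < v (aeval P (pderiv 0 f)))
    (hnew : ∀ f₁ g₁ P₁ n₁, n₁ < n → IsPreparedPoint v r (A - r.factorial) B f₁ g₁ P₁ →
      v (P₁ 1) ^ n₁ < v (aeval P₁ (pderiv 0 f₁)) → Solvable (K := K) f₁ g₁) : Solvable f g := by
  have hx := h.ne_zero
  have hr : ∀ m : Fin 3 →₀ ℕ, coeff m f ≠ 0 → m 0 < r → (r - m 0) * 1 ≤ m 1 := by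
    intro m hm hlt
    have := (le_weight_wts_iff hlt).1 (h.isMin.wge m hm)
    simp only [smul_lexPair, lexPair_add, lexPair_le] at this
    have h1 : (r - m 0) * r.factorial ≤ r.factorial * m 1 := by
      refine (Nat.mul_le_mul_left _ hA).trans ?_
      simp only [mul_one, mul_zero, add_zero] at this
      omega
    rw [mul_comm] at h1
    have := Nat.le_of_mul_le_mul_left h1 r.factorial_pos
    omega
  have hvz := h.good.val_le_pow hv h.coeff_ne hr
  have hvx : 0 < v (P 1) := by simpa [zero_lt_iff] using hx
  refine solvable_of_blow_of_prepared hv hr2 H h.good h.coeff_ne h.isMin h.prepared (s := 1)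
    (d := ![1, 0, 0]) (by simp) (by simp) (by simp) ?_ (A := A - r.factorial) (B := B) ?_ ?_ ?_
    (P₁ := ![P 0 / P 1, P 1, P 2]) ?_ hx ?_ (h.good.lt 1) (h.good.lt 2) hx ?_
  · intro m hm
    rw [weight_eq_fin_three]
    simp
    by_cases hlt : m 0 < r
    · have := hr m hm hlt
      omega
    · omega
  · intro i
    fin_cases i
    · change lexPair A B = lexPair (A - r.factorial) B + 1 • r.factorial • lexPair 1 0
      simp only [smul_lexPair, lexPair_add, lexPair_inj]
      omega
    · simp [wts]
    · simp [wts]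
  · intro a b ha hb
    refine ⟨a + 1, b, ?_, by simp, by simp⟩
    simp only [smul_lexPair, lexPair_add, lexPair_inj]
    constructor
    · have : A = r.factorial * a + r.factorial := by omega
      rw [this]; ring
    · rw [hb]; ring
  · intro m n hmn hn1 hn2
    have h0 := add_single_eq hmn 0
    have h1 := add_single_eq hmn 1
    simp at h0 h1
    omega
  · intro i
    fin_cases i
    · simp [div_mul_cancel₀ _ hx]
    · simp
    · simp
  · simp only [Matrix.cons_val_zero, map_div₀]
    exact div_le_one_of_le₀ (by simpa using hvz) zero_le
  · intro f₁ g₁ hg hd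
    obtain ⟨h1, h2⟩ := pow_pred_lt_of_mul_eq (h.good.lt 1) hx (h.good.val_pderiv_le_one hv) hr2 hn
      hd
    exact hnew _ _ _ (n - 1) (by omega) hg h2

/-- Blowing up the origin, when the third coordinate has the smallest order. -/
lemma IsPreparedPoint.solvable_of_val_lt (hv : IsRationalVal K v) (hr2 : 2 ≤ r)
    (H : ∀ f g P, IsGoodPoint v f g P → HasLowMonomial (K := K) r f → Solvable f g)
    {A B : ℕ} (h : IsPreparedPoint v r A B f g P) (hlow : ¬ HasLowMonomial r f)
    (hA : A < r.factorial) (hAB : r.factorial ≤ A + B) (hlt : v (P 1) < v (P 2))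
    (hnew : ∀ f₁ g₁ P₁, IsPreparedPoint v r A (A + B - r.factorial) f₁ g₁ P₁ →
      Solvable (K := K) f₁ g₁) : Solvable f g := by
  have hvy : 0 < v (P 2) := zero_le.trans_lt hlt
  have hy : P 2 ≠ 0 := by simpa [zero_lt_iff] using hvy
  have hvz := h.good.val_le_of_not_hasLowMonomial hv hlow h.coeff_ne hlt.le le_rfl
  let L : ℕ ×ₗ ℕ →+ ℕ ×ₗ ℕ :=
    { toFun := fun w => lexPair (ofLex w).1 ((ofLex w).1 + (ofLex w).2)
      map_zero' := rfl
      map_add' := fun a b => by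
        obtain ⟨a, a', rfl⟩ := exists_lexPair a
        obtain ⟨b, b', rfl⟩ := exists_lexPair b
        refine lexPair_inj.2 ⟨rfl, ?_⟩
        change a + b + (a' + b') = a + a' + (b + b')
        omega }
  have hL : ∀ a b, L (lexPair a b) = lexPair a (a + b) := fun _ _ => rfl
  have hmin := h.isMin.map L (by
    intro a b hab
    obtain ⟨a, a', rfl⟩ := exists_lexPair a
    obtain ⟨b, b', rfl⟩ := exists_lexPair b
    rw [hL, hL]
    rw [lexPair_le] at hab ⊢
    omega)
  have hp := h.prepared.map L (by
    intro a b hab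
    obtain ⟨a, a', rfl⟩ := exists_lexPair a
    obtain ⟨b, b', rfl⟩ := exists_lexPair b
    rw [hL, hL] at hab
    rw [lexPair_inj] at hab ⊢
    omega)
  simp only [hL] at hmin hp
  refine solvable_of_blow_of_prepared hv hr2 H h.good h.coeff_ne hmin hp (s := 2)
    (d := ![1, 1, 0]) (by simp) (by simp) (by simp) ?_ (A := A) (B := A + B - r.factorial) ?_ ?_ ?_
    (P₁ := ![P 0 / P 2, P 1 / P 2, P 2]) ?_ hy ?_ ?_ (h.good.lt 2)
    (div_ne_zero h.ne_zero hy) fun f₁ g₁ hg _ => hnew f₁ g₁ _ hg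
  · intro m hm
    have := degree_ge_of_not_hasLowMonomial hlow hm
    rw [weight_eq_fin_three]
    simp
    omega
  · intro i
    fin_cases i
    · change lexPair A (A + B) = lexPair A (A + B - r.factorial) +
        1 • r.factorial • lexPair 0 1
      simp only [smul_lexPair, lexPair_add, lexPair_inj]
      omega
    · change r.factorial • lexPair 1 1 = r.factorial • lexPair 1 0 + 1 • r.factorial • lexPair 0 1
      simp only [smul_lexPair, lexPair_add, lexPair_inj]
      omega
    · simp [wts]
  · intro a b ha hb
    have ha0 : a = 0 := by
      by_contra hne
      have : r.factorial * 1 ≤ r.factorial * a := Nat.mul_le_mul_left _ (by omega)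
      omega
    subst ha0
    refine ⟨0, b + 1, ?_, by simp, by simp⟩
    simp only [smul_lexPair, lexPair_add, lexPair_inj]
    constructor
    · simpa using ha
    · have : A + B = r.factorial * b + r.factorial := by omega
      rw [this]; ring
  · intro m n hmn hn1 hn2
    have h0 := add_single_eq hmn 0
    have h2 := add_single_eq hmn 2
    simp at h0 h2
    omega
  · intro i
    fin_cases i
    · simp [div_mul_cancel₀ _ hy]
    · simp [div_mul_cancel₀ _ hy]
    · simp
  · simp only [Matrix.cons_val_zero, map_div₀]
    exact div_le_one_of_le₀ hvz zero_le
  · simp only [Matrix.cons_val_one, Matrix.cons_val_zero, map_div₀]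
    exact (div_lt_one₀ hvy).2 hlt

end MainPhase

section MainPhase

variable {K F Γ : Type*} [Field K] [Field F] [Algebra K F] [LinearOrderedCommGroupWithZero Γ]
  {v : Valuation F Γ} {P : Fin 3 → F} {f g : MvPolynomial (Fin 3) K} {r : ℕ}

lemma IsGoodPoint.val_monomial_lt (hv : IsRationalVal K v) (h : IsGoodPoint v f g P) (c : K)
    {a b : ℕ} (hab : a + b ≠ 0) : v (algebraMap K F c * (P 1 ^ a * P 2 ^ b)) < 1 := by
  rw [map_mul, map_mul, map_pow, map_pow]
  refine (mul_le_of_le_one_left' (hv.map_algebraMap_le c)).trans_lt ?_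
  have e1 : v (P 1) ^ a ≤ 1 := pow_le_one' (h.lt 1).le _
  rcases Nat.eq_zero_or_pos a with rfl | ha
  · rw [pow_zero, one_mul]
    exact pow_lt_one₀ zero_le (h.lt 2) (by omega)
  · exact mul_lt_one_of_nonneg_of_lt_one_left zero_le
      (pow_lt_one₀ zero_le (h.lt 1) (by omega)) (pow_le_one' (h.lt 2).le _)

/-- Blowing up the origin, when the second coordinate has the smallest order. -/
lemma IsGoodPoint.solvable_of_val_lt (hv : IsRationalVal K v) (hr2 : 2 ≤ r)
    (H : ∀ f g P, IsGoodPoint v f g P → HasLowMonomial (K := K) r f → Solvable f g)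
    (h : IsGoodPoint v f g P) (hrc : coeff (Finsupp.single 0 r) f ≠ 0)
    {C D : ℕ} (hmin : IsMin r (lexPair 1 0) (lexPair 1 1) (lexPair C D) f)
    (hp : Prepared r (wts r (lexPair 1 0) (lexPair 1 1) (lexPair C D)) f)
    (hlow : ¬ HasLowMonomial r f)
    (hC : r.factorial ≤ C) (hDC : D ≤ C) (hlt : v (P 2) < v (P 1)) {n : ℕ}
    (hn : v (P 1) ^ n < v (aeval P (pderiv 0 f)))
    (hnew : ∀ f₁ g₁ P₁ n₁, n₁ < n → IsPreparedPoint v r (C - r.factorial) D f₁ g₁ P₁ →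
      v (P₁ 1) ^ n₁ < v (aeval P₁ (pderiv 0 f₁)) → Solvable (K := K) f₁ g₁) : Solvable f g := by
  have hvx : 0 < v (P 1) := zero_le.trans_lt hlt
  have hx : P 1 ≠ 0 := by simpa [zero_lt_iff] using hvx
  have hvz := h.val_le_of_not_hasLowMonomial hv hlow hrc le_rfl hlt.le
  refine solvable_of_blow_of_prepared hv hr2 H h hrc hmin hp (s := 1)
    (d := ![1, 0, 1]) (by simp) (by simp) (by simp) ?_ (A := C - r.factorial) (B := D) ?_ ?_ ?_
    (P₁ := ![P 0 / P 1, P 1, P 2 / P 1]) ?_ hx ?_ (h.lt 1) ?_ hx ?_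
  · intro m hm
    have := degree_ge_of_not_hasLowMonomial hlow hm
    rw [weight_eq_fin_three]
    simp
    omega
  · intro i
    fin_cases i
    · change lexPair C D = lexPair (C - r.factorial) D + 1 • r.factorial • lexPair 1 0
      simp only [smul_lexPair, lexPair_add, lexPair_inj]
      omega
    · simp [wts]
    · change r.factorial • lexPair 1 1 = r.factorial • lexPair 0 1 + 1 • r.factorial • lexPair 1 0
      simp only [smul_lexPair, lexPair_add, lexPair_inj]
      omega
  · intro a b ha hb
    have hba : b ≤ a + 1 := by
      have : r.factorial * b ≤ r.factorial * (a + 1) := by rw [mul_add]; omega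
      exact Nat.le_of_mul_le_mul_left this r.factorial_pos
    refine ⟨a + 1 - b, b, ?_, by simp; omega, by simp⟩
    simp only [smul_lexPair, lexPair_add, lexPair_inj]
    constructor
    · have : C = r.factorial * a + r.factorial := by omega
      obtain ⟨c, hc⟩ := Nat.exists_eq_add_of_le hba
      rw [this, show a + 1 - b = c by omega, ← Nat.mul_succ, Nat.succ_eq_add_one, hc]; ring
    · rw [hb]; ring
  · intro m n hmn hn1 hn2
    have h0 := add_single_eq hmn 0
    have h1 := add_single_eq hmn 1
    simp at h0 h1
    omega
  · intro i
    fin_cases i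
    · simp [div_mul_cancel₀ _ hx]
    · simp
    · simp [div_mul_cancel₀ _ hx]
  · simp only [Matrix.cons_val_zero, map_div₀]
    exact div_le_one_of_le₀ hvz zero_le
  · simp only [Matrix.cons_val, map_div₀]
    exact (div_lt_one₀ hvx).2 hlt
  · intro f₁ g₁ hg hd
    obtain ⟨h1, h2⟩ := pow_pred_lt_of_mul_eq (h.lt 1) hx (h.val_pderiv_le_one hv) hr2 hn hd
    exact hnew _ _ _ (n - 1) (by omega) hg h2

/-- The map `(a, b) ↦ (a + b, b)`. -/
def skew : ℕ ×ₗ ℕ →+ ℕ ×ₗ ℕ where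
  toFun w := lexPair ((ofLex w).1 + (ofLex w).2) (ofLex w).2
  map_zero' := rfl
  map_add' a b := by
    obtain ⟨a, a', rfl⟩ := exists_lexPair a
    obtain ⟨b, b', rfl⟩ := exists_lexPair b
    refine lexPair_inj.2 ⟨?_, rfl⟩
    change a + b + (a' + b') = a + a' + (b + b')
    omega

lemma skew_lexPair (a b : ℕ) : skew (lexPair a b) = lexPair (a + b) b := rfl

lemma skew_injective : Function.Injective skew := by
  intro a b hab
  obtain ⟨a, a', rfl⟩ := exists_lexPair a
  obtain ⟨b, b', rfl⟩ := exists_lexPair b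
  rw [skew_lexPair, skew_lexPair] at hab
  rw [lexPair_inj] at hab ⊢
  omega

lemma IsMin.bounds {A B C D : ℕ} (h : IsMin r (lexPair 1 0) (lexPair 0 1) (lexPair A B) f)
    (h' : IsMin r (lexPair 1 0) (lexPair 1 1) (lexPair C D) f) :
    D ≤ C ∧ lexPair C D ≤ lexPair (A + B) B ∧ lexPair A B ≤ lexPair (C - D) D := by
  obtain ⟨m, hm, hmr, hw⟩ := h'.exists_eq
  obtain ⟨m', hm', hmr', hw'⟩ := h.exists_eq
  rw [weight_wts_eq_iff hmr] at hw
  rw [weight_wts_eq_iff hmr'] at hw'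
  have h1 := (le_weight_wts_iff hmr).1 (h.wge m hm)
  have h2 := (le_weight_wts_iff hmr').1 (h'.wge m' hm')
  have hpos : 0 < r - m 0 := by omega
  have hpos' : 0 < r - m' 0 := by omega
  simp only [smul_lexPair, lexPair_add, lexPair_inj, mul_one, mul_zero, add_zero, zero_add]
    at hw hw'
  have hDC : D ≤ C := by
    refine (Nat.mul_le_mul_left_iff hpos).1 ?_
    rw [← hw.1, ← hw.2]
    exact Nat.mul_le_mul_left _ (by omega)
  refine ⟨hDC, ?_, ?_⟩
  · refine le_of_nsmul_le_nsmul_right hpos'.ne' (h2.trans_eq ?_)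
    simp only [smul_lexPair, lexPair_add, lexPair_inj, mul_one, mul_zero, zero_add]
    rw [mul_add, mul_add, hw'.1, hw'.2]
    exact ⟨rfl, rfl⟩
  · refine le_of_nsmul_le_nsmul_right hpos.ne' (h1.trans_eq ?_)
    simp only [smul_lexPair, lexPair_add, lexPair_inj, mul_one, mul_zero, add_zero, zero_add]
    rw [Nat.mul_sub, ← hw.1, ← hw.2, ← Nat.mul_sub, add_tsub_cancel_right]
    exact ⟨rfl, rfl⟩

/-- Preparation of the equation with respect to the weights `(1, 0)` and `(1, 1)`, followed by
a blow-up. -/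
lemma IsPreparedPoint.solvable_aux (hv : IsRationalVal K v) (hr2 : 2 ≤ r)
    (H : ∀ f g P, IsGoodPoint v f g P → HasLowMonomial (K := K) r f → Solvable f g)
    {A B n : ℕ} (hnew : ∀ C D, C - r.factorial ≤ A + B → D ≤ B →
      ∀ f₁ g₁ P₁ n₁, n₁ < n → IsPreparedPoint v r (C - r.factorial) D f₁ g₁ P₁ →
      v (P₁ 1) ^ n₁ < v (aeval P₁ (pderiv 0 f₁)) → Solvable (K := K) f₁ g₁)
    (N : ℕ) : ∀ (f g : MvPolynomial (Fin 3) K) (P : Fin 3 → F) (C D : ℕ),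
      (A + B - C) * (A + B + 1) + (A + B - D) = N → IsPreparedPoint v r A B f g P →
      IsMin r (lexPair 1 0) (lexPair 1 1) (lexPair C D) f → v (P 2) < v (P 1) →
      v (P 1) ^ n < v (aeval P (pderiv 0 f)) → Solvable f g := by
  induction N using Nat.strong_induction_on with
  | _ N ih =>
  intro f g P C D hN h hmin hlt hn
  by_cases hlow : HasLowMonomial r f
  · exact H _ _ _ h.good hlow
  obtain ⟨hDC, hle, hle'⟩ := h.isMin.bounds hmin
  rw [lexPair_le] at hle hle'
  have hC : r.factorial ≤ C := by
    obtain ⟨m, hm, hmr, hw⟩ := hmin.exists_eq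
    have := degree_ge_of_not_hasLowMonomial hlow hm
    rw [weight_wts_eq_iff hmr] at hw
    simp only [smul_lexPair, lexPair_add, lexPair_inj, mul_one, mul_zero, zero_add]
      at hw
    refine (Nat.mul_le_mul_left_iff (show 0 < r - m 0 by omega)).1 ?_
    rw [← hw.1, mul_comm]
    exact Nat.mul_le_mul_left _ (by omega)
  by_cases hp : Prepared r (wts r (lexPair 1 0) (lexPair 1 1) (lexPair C D)) f
  · exact h.good.solvable_of_val_lt hv hr2 H h.coeff_ne hmin hp hlow hC hDC hlt hn
      (hnew C D (by omega) (by omega))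
  · obtain ⟨c, a, b, -, hw, -, hc, hinc⟩ := hmin.exists_shift h.coeff_ne hp
    simp only [smul_lexPair, lexPair_add, lexPair_inj, mul_one, mul_zero, zero_add] at hw
    set p : MvPolynomial (Fin 3) K := MvPolynomial.C c * (X 1 ^ a * X 2 ^ b) with hpdef
    have hne : lexPair A B ≠ lexPair (C - D) D := by
      intro heq
      rw [lexPair_inj] at heq
      have := h.prepared.map skew skew_injective
      simp only [skew_lexPair] at this
      apply hp
      rwa [show C = A + B by omega, show D = B by omega]
    have hgt : lexPair A B < lexPair (C - D) D := lt_of_le_of_ne (lexPair_le.2 hle') hne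
    have hwp : WGT (wts r (lexPair 1 0) (lexPair 0 1) (lexPair A B))
        (wts r (lexPair 1 0) (lexPair 0 1) (lexPair A B) 0) p := by
      refine (isWeightedHomogeneous_C_mul c a b).wgt (hgt.trans_eq ?_)
      change lexPair (C - D) D = a • r.factorial • lexPair 1 0 + b • r.factorial • lexPair 0 1
      simp only [smul_lexPair, lexPair_add, lexPair_inj, mul_one, mul_zero, add_zero, zero_add]
      rw [hw.1, hw.2, ← Nat.mul_sub, add_tsub_cancel_right]
      constructor <;> ring
    have hθ := wgt_shift_sub hwp
    have hab : a + b ≠ 0 := by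
      intro h0
      rw [hw.1, h0, mul_zero] at hC
      exact absurd hC (not_le.2 r.factorial_pos)
    have hpval := h.good.val_monomial_lt hv c hab
    obtain ⟨hg, hd⟩ := h.good.shift (p := p) (a := algebraMap K F c * (P 1 ^ a * P 2 ^ b))
      (by simp [hpdef, pderiv_X]) (by simp [hpdef])
      ((v.map_sub _ _).trans_lt (max_lt (h.good.lt 0) hpval))
    have hmin' := h.isMin.aeval_of_wgt hθ
    obtain ⟨w', -, hw'⟩ := exists_isMin (f := aeval (shift p) f) (r := r)
      (ex := lexPair 1 0) (ey := lexPair 1 1) (by rw [lexPair_zero, lexPair_le]; omega)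
      (by rw [lexPair_zero, lexPair_le]; omega)
      (by obtain ⟨m, hm, hmr, -⟩ := hmin'.exists_eq; exact ⟨m, hm, hmr⟩)
    obtain ⟨C', D', rfl⟩ := exists_lexPair w'
    have hinc := hinc _ hw'
    rw [lexPair_lt] at hinc
    obtain ⟨hDC', hle2, -⟩ := hmin'.bounds hw'
    rw [lexPair_le] at hle2
    refine Solvable.of_aeval_one (θ := shift p) (ih _ ?_ _ _ _ C' D' rfl
      ⟨hg, hc, hmin', h.isMin.prepared_aeval hθ h.prepared, h.ne_zero⟩ hw' hlt ?_)
    · rw [← hN]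
      rcases hinc with hinc | ⟨rfl, hinc⟩
      · obtain ⟨k, hk⟩ := Nat.exists_eq_add_of_le (show A + B - C' + 1 ≤ A + B - C by omega)
        rw [hk]
        have : A + B - D' ≤ A + B := by omega
        nlinarith [Nat.zero_le (k * (A + B + 1)), Nat.zero_le (A + B - D)]
      · omega
    · rw [hd]
      exact hn

/-- Translation of the third coordinate, so that its order becomes larger than the order of the
second coordinate. -/
lemma IsPreparedPoint.solvable_of_val_le (hv : IsRationalVal K v) (hr2 : 2 ≤ r)
    (H : ∀ f g P, IsGoodPoint v f g P → HasLowMonomial (K := K) r f → Solvable f g)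
    {A B n : ℕ} (h : IsPreparedPoint v r A B f g P) (hle : v (P 2) ≤ v (P 1))
    (hn : v (P 1) ^ n < v (aeval P (pderiv 0 f)))
    (hnew : ∀ C D, C - r.factorial ≤ A + B → D ≤ B →
      ∀ f₁ g₁ P₁ n₁, n₁ < n → IsPreparedPoint v r (C - r.factorial) D f₁ g₁ P₁ →
      v (P₁ 1) ^ n₁ < v (aeval P₁ (pderiv 0 f₁)) → Solvable (K := K) f₁ g₁) : Solvable f g := by
  have hx := h.ne_zero
  have hvx : 0 < v (P 1) := by simpa [zero_lt_iff] using hx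
  obtain ⟨η, hη⟩ := hv.exists_sub_lt (P 2 / P 1) (by
    rw [map_div₀]; exact div_le_one_of_le₀ hle zero_le)
  have hlt : v (P 2 - algebraMap K F η * P 1) < v (P 1) := by
    have : P 2 - algebraMap K F η * P 1 = (P 2 / P 1 - algebraMap K F η) * P 1 := by
      field_simp
    rw [this, map_mul]
    exact mul_lt_of_lt_one_left hvx hη
  let θ : Fin 3 → MvPolynomial (Fin 3) K := ![X 0, X 1, X 2 + C η * X 1]
  have hθ : ∀ i, WGT (wts r (lexPair 1 0) (lexPair 0 1) (lexPair A B))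
      (wts r (lexPair 1 0) (lexPair 0 1) (lexPair A B) i) (θ i - X i) := by
    intro i
    fin_cases i
    · intro m hm; simp [θ] at hm
    · intro m hm; simp [θ] at hm
    · have := isWeightedHomogeneous_C_mul (W := wts r (lexPair 1 0) (lexPair 0 1) (lexPair A B))
        η 1 0
      have e : θ 2 - X 2 = C η * (X 1 ^ 1 * X 2 ^ 0) := by simp [θ]
      change WGT _ _ (θ 2 - X 2)
      rw [e]
      refine this.wgt ?_
      change r.factorial • lexPair 0 1 < 1 • r.factorial • lexPair 1 0 + 0 • _
      rw [zero_smul, add_zero]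
      simp only [smul_lexPair, lexPair_lt]
      have := r.factorial_pos
      omega
  obtain ⟨hg, hd⟩ := h.good.translate (θ := θ)
    (P₁ := ![P 0, P 1, P 2 - algebraMap K F η * P 1]) (by
      intro k hk
      fin_cases k
      · exact absurd rfl hk
      · simp [θ, pderiv_X]
      · simp [θ, pderiv_X]) (by simp [θ]) (by
      intro i
      fin_cases i <;> simp [θ]) (by
      intro i
      fin_cases i
      · exact h.good.lt 0
      · exact h.good.lt 1
      · exact hlt.trans (h.good.lt 1))
  have hmin' := h.isMin.aeval_of_wgt hθ
  obtain ⟨w', -, hw'⟩ := exists_isMin (f := aeval θ f) (r := r)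
    (ex := lexPair 1 0) (ey := lexPair 1 1) (by rw [lexPair_zero, lexPair_le]; omega)
    (by rw [lexPair_zero, lexPair_le]; omega)
    (by obtain ⟨m, hm, hmr, -⟩ := hmin'.exists_eq; exact ⟨m, hm, hmr⟩)
  obtain ⟨C', D', rfl⟩ := exists_lexPair w'
  refine Solvable.of_aeval_one (θ := θ) (IsPreparedPoint.solvable_aux hv hr2 H hnew _ _ _ _ C' D'
    rfl ⟨hg, h.isMin.coeff_aeval_ne_zero hθ h.coeff_ne, hmin',
      h.isMin.prepared_aeval hθ h.prepared, h.ne_zero⟩ hw' hlt ?_)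
  rw [hd]
  exact hn

lemma IsPreparedPoint.solvable (hv : IsRationalVal K v) (hr2 : 2 ≤ r)
    (harch : ∀ a b : F, v a < 1 → b ≠ 0 → ∃ n : ℕ, v a ^ n < v b)
    (H : ∀ f g P, IsGoodPoint v f g P → HasLowMonomial (K := K) r f → Solvable f g) (B : ℕ) :
    ∀ (A : ℕ) (f g : MvPolynomial (Fin 3) K) (P : Fin 3 → F), IsPreparedPoint v r A B f g P →
      Solvable f g := by
  induction B using Nat.strong_induction_on with
  | _ B ihB =>
  suffices hs : ∀ n A (f g : MvPolynomial (Fin 3) K) (P : Fin 3 → F),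
      IsPreparedPoint v r A B f g P → v (P 1) ^ n < v (aeval P (pderiv 0 f)) → Solvable f g by
    intro A f g P h
    obtain ⟨n, hn⟩ := harch _ _ (h.good.lt 1) h.good.der
    exact hs n A f g P h hn
  intro n
  induction n using Nat.strong_induction_on with
  | _ n ihn =>
  intro A f g P h hn
  by_cases hlow : HasLowMonomial r f
  · exact H _ _ _ h.good hlow
  rcases le_or_gt r.factorial A with hA | hA
  · exact h.solvable_of_factorial_le hv hr2 H hA hn fun f₁ g₁ P₁ n₁ hlt h₁ hn₁ =>
      ihn n₁ hlt _ f₁ g₁ P₁ h₁ hn₁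
  rcases lt_or_ge (v (P 1)) (v (P 2)) with hxy | hxy
  · refine h.solvable_of_val_lt hv hr2 H hlow hA ?_ hxy fun f₁ g₁ P₁ h₁ =>
      ihB _ ?_ _ _ _ _ h₁
    all_goals
      obtain ⟨m, hm, hmr, hw⟩ := h.isMin.exists_eq
      have hdeg := degree_ge_of_not_hasLowMonomial hlow hm
      rw [weight_wts_eq_iff hmr] at hw
      simp only [smul_lexPair, lexPair_add, lexPair_inj, mul_one, mul_zero, add_zero, zero_add]
        at hw
      have hAB : r.factorial ≤ A + B := by
        refine (Nat.mul_le_mul_left_iff (show 0 < r - m 0 by omega)).1 ?_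
        rw [mul_add, ← hw.1, ← hw.2, ← mul_add, mul_comm]
        exact Nat.mul_le_mul_left _ (by omega)
      omega
  · refine h.solvable_of_val_le hv hr2 H hxy hn fun C D _ hD f₁ g₁ P₁ n₁ hlt h₁ hn₁ => ?_
    rcases hD.lt_or_eq with hD | rfl
    · exact ihB D hD _ _ _ _ h₁
    · exact ihn n₁ hlt _ _ _ _ h₁ hn₁

end MainPhase

section InitialPhase

variable {K F Γ : Type*} [Field K] [Field F] [Algebra K F] [LinearOrderedCommGroupWithZero Γ]
  {v : Valuation F Γ} {P : Fin 3 → F} {f g : MvPolynomial (Fin 3) K} {r : ℕ}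

/-- Preparation of the equation with respect to the weights `(1, 0)` and `(0, 1)`; the process
stops because the order of the derivative at `P` and the slope of the Newton polyhedron are
bounded. -/
lemma IsGoodPoint.solvable_of_bound_aux (hv : IsRationalVal K v) (hr2 : 2 ≤ r)
    (harch : ∀ a b : F, v a < 1 → b ≠ 0 → ∃ n : ℕ, v a ^ n < v b)
    (H : ∀ f g P, IsGoodPoint v f g P → HasLowMonomial (K := K) r f → Solvable f g)
    {M D n a₀ b₀ : ℕ} (ha₀ : a₀ = n * r.factorial) (hb₀ : b₀ = D * r.factorial + M * a₀)
    (N : ℕ) : ∀ (f g : MvPolynomial (Fin 3) K) (P : Fin 3 → F) (A B : ℕ),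
      (a₀ - A) * (b₀ + 1) + (b₀ - B) = N → IsGoodPoint v f g P →
      coeff (Finsupp.single 0 r) f ≠ 0 → P 1 ≠ 0 → v (P 1) ^ n < v (aeval P (pderiv 0 f)) →
      WGE ![-(D : ℤ), M, -1] (-(D * r : ℤ)) f →
      IsMin r (lexPair 1 0) (lexPair 0 1) (lexPair A B) f → Solvable f g := by
  induction N using Nat.strong_induction_on with
  | _ N ih =>
  intro f g P A B hN h hrc hx hn hw hmin
  by_cases hp : Prepared r (wts r (lexPair 1 0) (lexPair 0 1) (lexPair A B)) f
  · exact IsPreparedPoint.solvable hv hr2 harch H B A f g P ⟨h, hrc, hmin, hp, hx⟩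
  by_cases hlow : HasLowMonomial r f
  · exact H _ _ _ h hlow
  have bound : ∀ {f g : MvPolynomial (Fin 3) K} {P : Fin 3 → F} {A B : ℕ},
      IsGoodPoint v f g P → coeff (Finsupp.single 0 r) f ≠ 0 →
      v (P 1) ^ n < v (aeval P (pderiv 0 f)) → WGE ![-(D : ℤ), M, -1] (-(D * r : ℤ)) f →
      IsMin r (lexPair 1 0) (lexPair 0 1) (lexPair A B) f → A < a₀ ∧ B ≤ b₀ := by
    intro f g P A B h hrc hn hw hmin
    have hA : A < a₀ := by
      have := h.val_pderiv_le_pow hv hr2 hrc (a := A / r.factorial) fun m hm hmr => by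
        have h1 := (le_weight_wts_iff hmr).1 (hmin.wge m hm)
        simp only [smul_lexPair, lexPair_add, lexPair_le, mul_one, mul_zero, add_zero] at h1
        refine (Nat.mul_le_mul_left_iff r.factorial_pos).1 ?_
        have h2 := Nat.mul_le_mul_left (r - m 0) (Nat.mul_div_le A r.factorial)
        calc _ = (r - m 0) * (r.factorial * (A / r.factorial)) := by ring
          _ ≤ _ := h2
          _ ≤ _ := by omega
      by_contra! hcon
      rw [ha₀] at hcon
      have h3 : n ≤ A / r.factorial := (Nat.le_div_iff_mul_le r.factorial_pos).2 hcon
      exact absurd (this.trans (pow_le_pow_right_of_le_one' (h.lt 1).le h3)) (not_le.2 hn)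
    refine ⟨hA, ?_⟩
    obtain ⟨m, hm, hmr, hmw⟩ := hmin.exists_eq
    have hCB := hw m hm
    rw [weight_eq_fin_three] at hCB
    simp at hCB
    rw [weight_wts_eq_iff hmr] at hmw
    simp only [smul_lexPair, lexPair_add, lexPair_inj, mul_one, mul_zero, add_zero, zero_add]
      at hmw
    have hCB' : m 2 ≤ D * (r - m 0) + M * m 1 := by
      zify [hmr.le]
      linarith
    refine (Nat.mul_le_mul_left_iff (show 0 < r - m 0 by omega)).1 ?_
    rw [← hmw.2, hb₀]
    calc _ ≤ r.factorial * (D * (r - m 0) + M * m 1) := Nat.mul_le_mul_left _ hCB'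
      _ = (r - m 0) * (D * r.factorial) + M * (r.factorial * m 1) := by ring
      _ = (r - m 0) * (D * r.factorial + M * A) := by rw [hmw.1]; ring
      _ ≤ _ := by gcongr
  obtain ⟨hA, hB⟩ := bound h hrc hn hw hmin
  obtain ⟨c, a, b, -, hab, -, hc, hinc⟩ := hmin.exists_shift hrc hp
  simp only [smul_lexPair, lexPair_add, lexPair_inj, mul_one, mul_zero, add_zero, zero_add] at hab
  obtain ⟨m, hm, hmr, hmw⟩ := hmin.exists_eq
  rw [weight_wts_eq_iff hmr] at hmw
  simp only [smul_lexPair, lexPair_add, lexPair_inj, mul_one, mul_zero, add_zero, zero_add]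
    at hmw
  have e1 : m 1 = (r - m 0) * a := by
    refine Nat.eq_of_mul_eq_mul_left r.factorial_pos ?_
    rw [hmw.1, hab.1]; ring
  have e2 : m 2 = (r - m 0) * b := by
    refine Nat.eq_of_mul_eq_mul_left r.factorial_pos ?_
    rw [hmw.2, hab.2]; ring
  have hne : a + b ≠ 0 := by
    intro h0
    have := degree_ge_of_not_hasLowMonomial hlow hm
    rw [show a = 0 by omega, mul_zero] at e1
    rw [show b = 0 by omega, mul_zero] at e2
    omega
  have hbd : b ≤ D + M * a := by
    have hCB := hw m hm
    rw [weight_eq_fin_three] at hCB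
    simp at hCB
    have hCB' : m 2 ≤ D * (r - m 0) + M * m 1 := by
      zify [hmr.le]
      linarith
    refine (Nat.mul_le_mul_left_iff (show 0 < r - m 0 by omega)).1 ?_
    rw [← e2]
    refine hCB'.trans_eq ?_
    rw [e1]; ring
  set p : MvPolynomial (Fin 3) K := C c * (X 1 ^ a * X 2 ^ b) with hpdef
  have hW : ∀ i, WGE ![-(D : ℤ), M, -1] (![-(D : ℤ), M, -1] i) (RationalPlace.shift p i) := by
    intro i
    fin_cases i
    · refine (isWeightedHomogeneous_X K _ 0).wge.add
        ((isWeightedHomogeneous_C_mul c a b).wge.mono ?_)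
      simp
      have : (b : ℤ) ≤ D + M * a := by exact_mod_cast hbd
      linarith
    · exact (isWeightedHomogeneous_X K _ 1).wge
    · exact (isWeightedHomogeneous_X K _ 2).wge
  obtain ⟨hg, hd⟩ := h.shift (p := p) (a := algebraMap K F c * (P 1 ^ a * P 2 ^ b))
    (by simp [hpdef, pderiv_X]) (by simp [hpdef])
    ((v.map_sub _ _).trans_lt (max_lt (h.lt 0) (h.val_monomial_lt hv c hne)))
  obtain ⟨w', -, hw'⟩ := exists_isMin (r := r) (ex := lexPair 1 0) (ey := lexPair 0 1)
    (by rw [lexPair_zero, lexPair_le]; omega) (by rw [lexPair_zero, lexPair_le]; omega)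
    (hg.exists_lt hv hr2 hc)
  obtain ⟨A', B', rfl⟩ := exists_lexPair w'
  have hinc := hinc _ hw'
  rw [lexPair_lt] at hinc
  rw [← hd] at hn
  obtain ⟨hA', hB'⟩ := bound hg hc hn (hw.aeval hW) hw'
  refine Solvable.of_aeval_one (θ := RationalPlace.shift p) (ih _ ?_ _ _ _ A' B' rfl hg hc hx hn
    (hw.aeval hW) hw')
  rw [← hN]
  rcases hinc with hinc | ⟨rfl, hinc⟩
  · obtain ⟨k, hk⟩ := Nat.exists_eq_add_of_le (show a₀ - A' + 1 ≤ a₀ - A by omega)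
    rw [hk]
    have : b₀ - B' ≤ b₀ := by omega
    nlinarith [Nat.zero_le (k * (b₀ + 1)), Nat.zero_le (b₀ - B)]
  · omega

lemma IsGoodPoint.solvable_of_bound (hv : IsRationalVal K v) (hr2 : 2 ≤ r)
    (harch : ∀ a b : F, v a < 1 → b ≠ 0 → ∃ n : ℕ, v a ^ n < v b)
    (H : ∀ f g P, IsGoodPoint v f g P → HasLowMonomial (K := K) r f → Solvable f g)
    {M D : ℕ} (h : IsGoodPoint v f g P) (hrc : coeff (Finsupp.single 0 r) f ≠ 0) (hx : P 1 ≠ 0)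
    (hw : WGE ![-(D : ℤ), M, -1] (-(D * r : ℤ)) f) : Solvable f g := by
  obtain ⟨n, hn⟩ := harch _ _ (h.lt 1) h.der
  obtain ⟨w', -, hw'⟩ := exists_isMin (r := r) (ex := lexPair 1 0) (ey := lexPair 0 1)
    (by rw [lexPair_zero, lexPair_le]; omega) (by rw [lexPair_zero, lexPair_le]; omega)
    (h.exists_lt hv hr2 hrc)
  obtain ⟨A, B, rfl⟩ := exists_lexPair w'
  exact IsGoodPoint.solvable_of_bound_aux hv hr2 harch H rfl rfl _ f g P A B rfl h hrc hx hn hw hw'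

end InitialPhase

section InitialBlowUp

variable {K F Γ : Type*} [Field K] [Field F] [Algebra K F] [LinearOrderedCommGroupWithZero Γ]
  {v : Valuation F Γ} {P : Fin 3 → F} {f g : MvPolynomial (Fin 3) K} {r : ℕ}

lemma IsGoodPoint.solvable_of_coeff_ne (hv : IsRationalVal K v) (hr2 : 2 ≤ r)
    (harch : ∀ a b : F, v a < 1 → b ≠ 0 → ∃ n : ℕ, v a ^ n < v b)
    (H : ∀ f g P, IsGoodPoint v f g P → HasLowMonomial (K := K) r f → Solvable f g)
    (h : IsGoodPoint v f g P) (hrc : coeff (Finsupp.single 0 r) f ≠ 0) (hx : P 1 ≠ 0)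
    (hle : v (P 2) ≤ v (P 1)) : Solvable f g := by
  by_cases hlow : HasLowMonomial r f
  · exact H _ _ _ h hlow
  have hvx : 0 < v (P 1) := by simpa [zero_lt_iff] using hx
  have approx : ∀ t : F, v t ≤ v (P 1) → ∃ η : K, v (t - algebraMap K F η * P 1) < v (P 1) := by
    intro t ht
    obtain ⟨η, hη⟩ := hv.exists_sub_lt (t / P 1) (by
      rw [map_div₀]; exact div_le_one_of_le₀ ht zero_le)
    refine ⟨η, ?_⟩
    have : t - algebraMap K F η * P 1 = (t / P 1 - algebraMap K F η) * P 1 := by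
      field_simp
    rw [this, map_mul]
    exact mul_lt_of_lt_one_left hvx hη
  obtain ⟨η, hη⟩ := approx (P 2) hle
  obtain ⟨ζ, hζ⟩ := approx (P 0) (h.val_le_of_not_hasLowMonomial hv hlow hrc le_rfl hle)
  let θ : Fin 3 → MvPolynomial (Fin 3) K := ![X 0 + C ζ * X 1, X 1, X 2 + C η * X 1]
  obtain ⟨hg, -⟩ := h.translate (θ := θ)
    (P₁ := ![P 0 - algebraMap K F ζ * P 1, P 1, P 2 - algebraMap K F η * P 1]) (by
      intro k hk
      fin_cases k
      · exact absurd rfl hk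
      · simp [θ, pderiv_X]
      · simp [θ, pderiv_X]) (by simp [θ, pderiv_X]) (by
      intro i
      fin_cases i <;> simp [θ]) (by
      intro i
      fin_cases i
      · exact hζ.trans (h.lt 1)
      · exact h.lt 1
      · exact hη.trans (h.lt 1))
  have hc : coeff (Finsupp.single 0 r) (aeval θ f) ≠ 0 := by
    rw [← coeff_single_eq (W := (![0, 1, 0] : Fin 3 → ℕ))] at hrc ⊢
    rwa [WGE.weightedHomogeneousComponent_aeval_eq]
    · intro i
      fin_cases i
      · have := isWeightedHomogeneous_C_mul (W := (![0, 1, 0] : Fin 3 → ℕ)) ζ 1 0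
        refine (show IsWeightedHomogeneous _ (θ 0 - X 0) _ from ?_).wgt zero_lt_one
        simpa [θ] using this
      · intro m hm; simp [θ] at hm
      · have := isWeightedHomogeneous_C_mul (W := (![0, 1, 0] : Fin 3 → ℕ)) η 1 0
        refine (show IsWeightedHomogeneous _ (θ 2 - X 2) _ from ?_).wgt zero_lt_one
        simpa [θ] using this
    · intro m hm
      simp
  refine Solvable.of_aeval_one (θ := θ) ?_
  generalize aeval θ f = f at hg hc
  generalize aeval θ g = g at hg
  by_cases hlow : HasLowMonomial r f
  · exact H _ _ _ hg hlow
  obtain ⟨f₁, hf₁, hc1, hc2⟩ := exists_blow (f := f) (r := r) (s := 1) (d := ![1, 0, 1]) rfl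
    fun m hm => by
      have := degree_ge_of_not_hasLowMonomial hlow hm
      rw [weight_eq_fin_three]
      simp
      omega
  have hg₁ := hg.subst (θ := blow 1 ![1, 0, 1]) (q := X 1 ^ r) (f₁ := f₁)
    (P₁ := ![(P 0 - algebraMap K F ζ * P 1) / P 1, P 1, (P 2 - algebraMap K F η * P 1) / P 1])
    (pderiv_zero_blow one_ne_zero _) (by
      rw [pderiv_zero_blow_zero one_ne_zero rfl]; simpa using hx) hf₁
    (by simp [pderiv_X]) (by simpa using pow_ne_zero _ hx) (by
      intro i
      fin_cases i
      · simp [blow, div_mul_cancel₀ _ hx]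
      · simp [blow]
      · simp [blow, div_mul_cancel₀ _ hx]) (by
      intro i
      fin_cases i
      · simp only [Fin.zero_eta, Matrix.cons_val_zero, map_div₀]
        exact (div_lt_one₀ hvx).2 hζ
      · exact h.lt 1
      · change v (_ / P 1) < 1
        rw [map_div₀]
        exact (div_lt_one₀ hvx).2 hη)
  refine Solvable.of_aeval hf₁ (hg₁.solvable_of_bound hv hr2 harch H (M := 1) (D := 1) ?_ hx ?_)
  · rwa [hc2 (Finsupp.single 0 r) (Finsupp.single 0 r)]
    rw [Finsupp.weight_single]
    simp
  · intro n hn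
    obtain ⟨m, -, hmn⟩ := hc1 n hn
    have h0 := add_single_eq hmn 0
    have h1 := add_single_eq hmn 1
    have h2 := add_single_eq hmn 2
    simp at h0 h1 h2
    rw [weight_eq_fin_three]
    simp
    omega

end InitialBlowUp

section PowerSeriesRoot

open PowerSeries (X_pow_dvd_iff)

variable {A : Type*} [CommRing A]

/-- A contraction of a power series ring has a fixed point. -/
lemma exists_fixed_point (Φ : PowerSeries A → PowerSeries A)
    (hΦ : ∀ n a b, (PowerSeries.X : PowerSeries A) ^ n ∣ a - b →
      (PowerSeries.X : PowerSeries A) ^ (n + 1) ∣ Φ a - Φ b) : ∃ Z, Φ Z = Z := by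
  let c : ℕ → PowerSeries A := fun n => Φ^[n] 0
  have hc : ∀ n, c (n + 1) = Φ (c n) := fun n => Function.iterate_succ_apply' Φ n 0
  have h1 : ∀ n, (PowerSeries.X : PowerSeries A) ^ n ∣ c (n + 1) - c n := by
    intro n
    induction n with
    | zero => simp
    | succ n ih => simpa only [← hc] using hΦ n _ _ ih
  have h2 : ∀ n k, (PowerSeries.X : PowerSeries A) ^ n ∣ c (n + k) - c n := by
    intro n k
    induction k with
    | zero => simp
    | succ k ih =>
      have := (pow_dvd_pow PowerSeries.X (Nat.le_add_right n k)).trans (h1 (n + k))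
      have := dvd_add this ih
      rwa [sub_add_sub_cancel] at this
  let Z : PowerSeries A := PowerSeries.mk fun n => PowerSeries.coeff n (c (n + 1))
  have hZ : ∀ n, (PowerSeries.X : PowerSeries A) ^ n ∣ Z - c n := by
    intro n
    rw [X_pow_dvd_iff]
    intro m hm
    obtain ⟨k, rfl⟩ := Nat.exists_eq_add_of_le (Nat.succ_le_of_lt hm)
    have := X_pow_dvd_iff.1 (h2 (m + 1) k) m (Nat.lt_succ_self m)
    rw [map_sub, sub_eq_zero] at this
    rw [map_sub, PowerSeries.coeff_mk, this, sub_self]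
  refine ⟨Z, ?_⟩
  ext n
  have h3 := dvd_sub (hΦ n _ _ (hZ n)) (hZ (n + 1))
  rw [hc, sub_sub_sub_cancel_right] at h3
  have := X_pow_dvd_iff.1 h3 n (Nat.lt_succ_self n)
  rwa [map_sub, sub_eq_zero] at this

/-- Newton's method for polynomials over a power series ring. -/
lemma exists_root_of_pow_dvd (h : Polynomial (PowerSeries A)) (z u : PowerSeries A)
    (hu : IsUnit u) {e N : ℕ} (hN : 2 * e + 1 ≤ N)
    (h0 : (PowerSeries.X : PowerSeries A) ^ N ∣ h.eval z)
    (h1 : h.derivative.eval z = (PowerSeries.X : PowerSeries A) ^ e * u) :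
    ∃ Z, h.eval Z = 0 ∧ (PowerSeries.X : PowerSeries A) ^ (N - e) ∣ Z - z := by
  obtain ⟨q, hq⟩ := h0
  obtain ⟨w, hw⟩ := hu.exists_right_inv
  obtain ⟨M, rfl⟩ := Nat.exists_eq_add_of_le hN
  let t : PowerSeries A := PowerSeries.X
  let y : Polynomial (PowerSeries A) := Polynomial.C (t ^ (M + e + 1)) * Polynomial.X
  obtain ⟨k, hk⟩ := (h.map Polynomial.C).binomExpansion (Polynomial.C z) y
  have key : ∀ V, h.eval (z + t ^ (M + e + 1) * V) =
      t ^ (2 * e + 1 + M) * (q + u * V + t ^ (M + 1) * (V ^ 2 * k.eval V)) := by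
    intro V
    have := congrArg (Polynomial.eval V) hk
    rw [Polynomial.derivative_map] at this
    have ev : ∀ (p : Polynomial (PowerSeries A)) (s : Polynomial (PowerSeries A)),
        Polynomial.eval V (Polynomial.eval s (p.map Polynomial.C)) = p.eval (s.eval V) := by
      intro p s
      rw [Polynomial.eval_map, ← Polynomial.comp, Polynomial.eval_comp]
    simp only [Polynomial.eval_add, Polynomial.eval_mul, Polynomial.eval_pow, ev, y,
      Polynomial.eval_C, Polynomial.eval_X] at this
    rw [this, hq, h1]
    change t ^ (2 * e + 1 + M) * q + t ^ e * u * _ + _ = _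
    ring
  obtain ⟨V, hV⟩ := exists_fixed_point
    (fun V => - w * (q + t ^ (M + 1) * (V ^ 2 * k.eval V))) (by
      intro n a b hab
      have e1 : - w * (q + t ^ (M + 1) * (a ^ 2 * k.eval a)) -
          - w * (q + t ^ (M + 1) * (b ^ 2 * k.eval b)) =
          t * (- w * t ^ M *
            (Polynomial.eval a (Polynomial.X ^ 2 * k) - Polynomial.eval b (Polynomial.X ^ 2 * k)))
          := by
        simp only [Polynomial.eval_mul, Polynomial.eval_pow, Polynomial.eval_X]
        ring
      rw [e1, pow_succ']
      exact mul_dvd_mul_left _ (dvd_mul_of_dvd_right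
        (hab.trans (Polynomial.sub_dvd_eval_sub _ _ _)) _))
  refine ⟨z + t ^ (M + e + 1) * V, ?_, ?_⟩
  · rw [key]
    have : q + u * V + t ^ (M + 1) * (V ^ 2 * k.eval V) = 0 := by
      linear_combination (-u) * hV - (q + t ^ (M + 1) * (V ^ 2 * k.eval V)) * hw
    rw [this, mul_zero]
  · rw [add_sub_cancel_left, show 2 * e + 1 + M - e = M + e + 1 by omega]
    exact dvd_mul_right _ _

/-- Newton's method for a multivariate polynomial over a power series ring. -/
lemma exists_point_of_pow_dvd {σ K : Type*} [CommRing K] [Algebra K A] (f : MvPolynomial σ K)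
    (z : σ → PowerSeries A) (i : σ) (u : PowerSeries A) (hu : IsUnit u) {e N : ℕ}
    (hN : 2 * e + 1 ≤ N) (h0 : (PowerSeries.X : PowerSeries A) ^ N ∣ aeval z f)
    (h1 : aeval z (pderiv i f) = (PowerSeries.X : PowerSeries A) ^ e * u) :
    ∃ Q : σ → PowerSeries A, aeval Q f = 0 ∧ (∀ j ≠ i, Q j = z j) ∧
      (PowerSeries.X : PowerSeries A) ^ (N - e) ∣ Q i - z i := by
  classical
  let θ : σ → Polynomial (PowerSeries A) := Function.update (fun j => Polynomial.C (z j)) i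
    Polynomial.X
  have ev : ∀ (Z : PowerSeries A) (p : MvPolynomial σ K),
      (aeval θ p).eval Z = aeval (Function.update z i Z) p := by
    intro Z p
    induction p using MvPolynomial.induction_on with
    | C a => simp [Polynomial.algebraMap_apply]
    | add p q hp hq => simp [hp, hq]
    | mul_X p j hp =>
      rw [map_mul, map_mul, Polynomial.eval_mul, hp, aeval_X, aeval_X]
      congr 1
      rcases eq_or_ne j i with rfl | hj
      · simp [θ]
      · simp [θ, hj]
  have der : ∀ p : MvPolynomial σ K,
      Polynomial.derivative (aeval θ p) = aeval θ (pderiv i p) := by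
    intro p
    induction p using MvPolynomial.induction_on with
    | C a => simp [Polynomial.algebraMap_apply]
    | add p q hp hq => simp [hp, hq]
    | mul_X p j hp =>
      rw [map_mul, Polynomial.derivative_mul, hp, pderiv_mul, map_add, map_mul, map_mul, aeval_X]
      congr 2
      rcases eq_or_ne j i with rfl | hj
      · simp [θ]
      · simp [θ, hj]
  have hz : Function.update z i (z i) = z := Function.update_eq_self i z
  obtain ⟨Z, hZ, hd⟩ := exists_root_of_pow_dvd (aeval θ f) (z i) u hu hN
    (by rwa [ev, hz]) (by rw [der, ev, hz, h1])
  exact ⟨Function.update z i Z, by rw [← ev, hZ], fun j hj => by simp [hj], by simpa using hd⟩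

end PowerSeriesRoot

section Large

variable {K : Type*} [Field K]

lemma exists_eval_of_powerSeries (hK : IsLargeField K) {n : ℕ} {f g : MvPolynomial (Fin n) K}
    {Q : Fin n → PowerSeries K} (hf : aeval Q f = 0) (hg : aeval Q g ≠ 0) :
    ∃ x, eval x f = 0 ∧ eval x g ≠ 0 := by
  let ι : PowerSeries K →ₐ[K] LaurentSeries K :=
    { HahnSeries.ofPowerSeries ℤ K with commutes' := fun _ => rfl }
  have hι : Function.Injective ι := HahnSeries.ofPowerSeries_injective
  have key : ∀ p : MvPolynomial (Fin n) K, aeval (fun i => ι (Q i)) p = ι (aeval Q p) :=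
    fun p => (comp_aeval_apply Q ι p).symm
  obtain ⟨x, h1, h2⟩ := hK n {f} {g} ⟨fun i => ι (Q i), by
    simp only [Finset.mem_singleton, forall_eq, key, hf, map_zero], by
    simp only [Finset.mem_singleton, forall_eq, key]
    exact fun h => hg (hι (h.trans (map_zero ι).symm))⟩
  exact ⟨x, h1 f (Finset.mem_singleton_self f), h2 g (Finset.mem_singleton_self g)⟩

lemma infinite_of_isLargeField (hK : IsLargeField K) : Infinite K := by
  by_contra hfin
  rw [not_infinite_iff_finite] at hfin
  have := Fintype.ofFinite K
  obtain ⟨x, -, hx⟩ := exists_eval_of_powerSeries hK (n := 1) (f := 0)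
    (g := ∏ c : K, (X 0 - C c)) (Q := fun _ => PowerSeries.X) (by simp) (by
      rw [map_prod, Finset.prod_ne_zero_iff]
      intro c _ h
      rw [map_sub, aeval_X, aeval_C, sub_eq_zero] at h
      have := congrArg (PowerSeries.coeff 1) h
      rw [PowerSeries.algebraMap_apply] at this
      simp at this)
  rw [map_prod, Finset.prod_ne_zero_iff] at hx
  exact hx (x 0) (Finset.mem_univ _) (by simp)

end Large

section Smooth

variable {K F Γ : Type*} [Field K] [Field F] [Algebra K F] [LinearOrderedCommGroupWithZero Γ]
  {v : Valuation F Γ}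

lemma IsRationalVal.val_aeval_le_one (hv : IsRationalVal K v) {σ : Type*} {P : σ → F}
    (hP : ∀ i, v (P i) ≤ 1) (p : MvPolynomial σ K) : v (aeval P p) ≤ 1 := by
  induction p using MvPolynomial.induction_on with
  | C a => simpa using hv.map_algebraMap_le a
  | add p q hp hq => rw [map_add]; exact v.map_add_le hp hq
  | mul_X p i hp => rw [map_mul, map_mul, aeval_X]; exact mul_le_one' hp (hP i)

lemma IsRationalVal.val_aeval_sub_coeff_lt (hv : IsRationalVal K v) {σ : Type*} {P : σ → F}
    (hP : ∀ i, v (P i) < 1) (p : MvPolynomial σ K) :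
    v (aeval P p - algebraMap K F (coeff 0 p)) < 1 := by
  induction p using MvPolynomial.induction_on with
  | C a => simp
  | add p q hp hq =>
    rw [map_add, coeff_add, map_add, add_sub_add_comm]
    exact v.map_add_lt hp hq
  | mul_X p i hp =>
    classical
    rw [coeff_mul_X', if_neg (by simp), map_zero, sub_zero, map_mul, map_mul, aeval_X]
    exact mul_lt_one_of_nonneg_of_lt_one_right (hv.val_aeval_le_one (fun i => (hP i).le) p)
      zero_le (hP i)

lemma IsRationalVal.val_aeval_eq_one (hv : IsRationalVal K v) {σ : Type*} {P : σ → F}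
    (hP : ∀ i, v (P i) < 1) {p : MvPolynomial σ K} (hp : coeff 0 p ≠ 0) :
    v (aeval P p) = 1 := by
  have h1 := hv.val_aeval_sub_coeff_lt hP p
  have h2 := hv.map_algebraMap _ hp
  rw [← h2] at h1
  have := v.map_add_eq_of_lt_left h1
  rwa [add_sub_cancel, h2] at this

lemma IsRationalVal.coeff_zero_of_aeval_eq_zero (hv : IsRationalVal K v) {σ : Type*} {P : σ → F}
    (hP : ∀ i, v (P i) < 1) {p : MvPolynomial σ K} (hp : aeval P p = 0) : coeff 0 p = 0 := by
  by_contra hne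
  simpa [hp] using hv.val_aeval_eq_one hP hne

/-- A first order Taylor expansion along one coordinate. -/
lemma IsRationalVal.exists_aeval_sub_eq (hv : IsRationalVal K v) {σ : Type*} {P P' : σ → F}
    (hP : ∀ i, v (P i) ≤ 1) (hP' : ∀ i, v (P' i) ≤ 1) {i : σ} (hne : ∀ j ≠ i, P j = P' j)
    (p : MvPolynomial σ K) : ∃ k, v k ≤ 1 ∧ aeval P p - aeval P' p =
      (P i - P' i) * (aeval P' (pderiv i p) + k * (P i - P' i)) := by
  classical
  induction p using MvPolynomial.induction_on with
  | C a => exact ⟨0, by simp, by simp⟩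
  | add p q hp hq =>
    obtain ⟨k, hk, h1⟩ := hp
    obtain ⟨l, hl, h2⟩ := hq
    refine ⟨k + l, v.map_add_le hk hl, ?_⟩
    simp only [map_add]
    linear_combination h1 + h2
  | mul_X p j hp =>
    obtain ⟨k, hk, h1⟩ := hp
    rw [pderiv_mul]
    rcases eq_or_ne j i with rfl | hj
    · refine ⟨aeval P' (pderiv j p) + k * P j, v.map_add_le (hv.val_aeval_le_one hP' _) ?_, ?_⟩
      · rw [map_mul]; exact mul_le_one' hk (hP j)
      · simp only [map_mul, map_add, aeval_X, pderiv_X_self, mul_one]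
        linear_combination P j * h1
    · refine ⟨k * P j, ?_, ?_⟩
      · rw [map_mul]; exact mul_le_one' hk (hP j)
      · simp only [map_mul, aeval_X, pderiv_X_of_ne hj, mul_zero, add_zero, ← hne j hj]
        linear_combination P j * h1

end Smooth

section SmoothPoint

lemma dvd_aeval_sub {σ K R : Type*} [CommRing K] [CommRing R] [Algebra K R] {a : R} {Q Q' : σ → R}
    (h : ∀ i, a ∣ Q i - Q' i) (p : MvPolynomial σ K) : a ∣ aeval Q p - aeval Q' p := by
  induction p using MvPolynomial.induction_on with
  | C a => simp
  | add p q hp hq => rw [map_add, map_add, add_sub_add_comm]; exact dvd_add hp hq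
  | mul_X p i hp =>
    rw [map_mul, map_mul, aeval_X, aeval_X, show aeval Q p * Q i - aeval Q' p * Q' i =
      (aeval Q p - aeval Q' p) * Q i + aeval Q' p * (Q i - Q' i) by ring]
    exact dvd_add (hp.mul_right _) ((h i).mul_left _)

lemma constantCoeff_aeval_powerSeries {σ K A : Type*} [CommRing K] [CommRing A] [Algebra K A]
    {Q : σ → PowerSeries A} (h : ∀ i, PowerSeries.constantCoeff (Q i) = 0)
    (p : MvPolynomial σ K) :
    PowerSeries.constantCoeff (aeval Q p) = algebraMap K A (coeff 0 p) := by
  induction p using MvPolynomial.induction_on with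
  | C a => simp [PowerSeries.algebraMap_apply]
  | add p q hp hq => simp only [map_add, hp, hq, coeff_add]
  | mul_X p i hp =>
    classical
    rw [coeff_mul_X', if_neg (by simp), map_mul, map_mul, aeval_X, h, mul_zero, map_zero]

variable {K F Γ : Type*} [Field K] [Field F] [Algebra K F] [LinearOrderedCommGroupWithZero Γ]
  {v : Valuation F Γ} {P : Fin 3 → F} {f g : MvPolynomial (Fin 3) K}

lemma IsRationalVal.val_polynomial_aeval_le_one (hv : IsRationalVal K v) {t : F} (ht : v t ≤ 1)
    (p : Polynomial K) : v (Polynomial.aeval t p) ≤ 1 := by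
  induction p using Polynomial.induction_on' with
  | add p q hp hq => rw [map_add]; exact v.map_add_le hp hq
  | monomial n a =>
    rw [Polynomial.aeval_monomial, map_mul, map_pow]
    exact mul_le_one' (hv.map_algebraMap_le a) (pow_le_one' ht n)

lemma IsGoodPoint.solvable_of_coeff_single_ne (hK : IsLargeField K) (hv : IsRationalVal K v)
    (harch : ∀ a b : F, v a < 1 → b ≠ 0 → ∃ n : ℕ, v a ^ n < v b)
    (h : IsGoodPoint v f g P) (hc : coeff (Finsupp.single 0 1) f ≠ 0) (hx : P 1 ≠ 0)
    (hle : v (P 2) ≤ v (P 1)) : Solvable f g := by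
  have hc' : coeff 0 (pderiv 0 f) ≠ 0 := by
    rw [MvPolynomial.coeff_pderiv]
    simpa using hc
  let z : Fin 3 → PowerSeries (Polynomial K) :=
    ![0, PowerSeries.X, PowerSeries.C Polynomial.X * PowerSeries.X]
  have hz : ∀ i, PowerSeries.constantCoeff (z i) = 0 := by
    intro i
    fin_cases i <;> simp [z]
  have hu : IsUnit (aeval z (pderiv 0 f)) := by
    rw [PowerSeries.isUnit_iff_constantCoeff, constantCoeff_aeval_powerSeries hz]
    exact (isUnit_iff_ne_zero.2 hc').map _
  obtain ⟨Q, hQ, hQz, hQ0⟩ := exists_point_of_pow_dvd f z 0 _ hu (e := 0) (N := 1) le_rfl (by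
      rw [pow_one, PowerSeries.X_dvd_iff, constantCoeff_aeval_powerSeries hz,
        hv.coeff_zero_of_aeval_eq_zero h.lt h.zero, map_zero]) (by
      rw [pow_zero, one_mul])
  have hQ0 : PowerSeries.X ∣ Q 0 := by simpa [z] using hQ0
  by_cases hg : aeval Q g = 0
  swap
  · have := infinite_of_isLargeField hK
    obtain ⟨d, hd⟩ := (PowerSeries.exists_coeff_ne_zero_iff_ne_zero).2 hg
    obtain ⟨c, hcd⟩ := not_forall.1 fun hall => hd (Polynomial.zero_of_eval_zero _ hall)
    let π : PowerSeries (Polynomial K) →ₐ[K] PowerSeries K :=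
      { PowerSeries.map (Polynomial.evalRingHom c) with
        commutes' := fun a => by simp [PowerSeries.algebraMap_apply] }
    have hπ : ∀ q, π q = PowerSeries.map (Polynomial.evalRingHom c) q := fun q => rfl
    refine exists_eval_of_powerSeries hK (Q := fun i => π (Q i)) ?_ ?_
    · rw [← comp_aeval_apply, hQ, map_zero]
    · rw [← comp_aeval_apply, hπ]
      intro h0
      have := congrArg (PowerSeries.coeff d) h0
      rw [PowerSeries.coeff_map, map_zero] at this
      exact hcd this
  exfalso
  obtain ⟨N, hN⟩ := harch _ _ (h.lt 1) h.ne
  let Q' : Fin 3 → Polynomial (Polynomial K) :=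
    ![PowerSeries.trunc N (Q 0), Polynomial.X, Polynomial.C Polynomial.X * Polynomial.X]
  let t : F := P 2 / P 1
  have ht : v t ≤ 1 := by rw [map_div₀]; exact div_le_one_of_le₀ hle zero_le
  let ψ : Polynomial (Polynomial K) →ₐ[K] F :=
    { Polynomial.eval₂RingHom (Polynomial.aeval t : Polynomial K →ₐ[K] F).toRingHom (P 1) with
      commutes' := fun a => by simp [Polynomial.algebraMap_apply] }
  have hψX : ψ Polynomial.X = P 1 := Polynomial.eval₂_X _ _
  have hψC : ∀ a, ψ (Polynomial.C a) = Polynomial.aeval t a := fun a => Polynomial.eval₂_C _ _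
  have hψ : ∀ q, v (ψ q) ≤ 1 := by
    intro q
    induction q using Polynomial.induction_on' with
    | add p q hp hq => rw [map_add]; exact v.map_add_le hp hq
    | monomial n a =>
      rw [← Polynomial.C_mul_X_pow_eq_monomial, map_mul, map_pow, hψX, hψC, map_mul, map_pow]
      exact mul_le_one' (hv.val_polynomial_aeval_le_one ht a) (pow_le_one' (h.lt 1).le n)
  let κ : Polynomial (Polynomial K) →ₐ[K] PowerSeries (Polynomial K) :=
    { Polynomial.coeToPowerSeries.ringHom with
      commutes' := fun a => by simp [Polynomial.algebraMap_apply, PowerSeries.algebraMap_apply] }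
  have hκ : ∀ q, κ q = (q : PowerSeries (Polynomial K)) := fun q => rfl
  have hdvd : ∀ i, (PowerSeries.X : PowerSeries (Polynomial K)) ^ N ∣ Q i - κ (Q' i) := by
    intro i
    fin_cases i
    · rw [PowerSeries.X_pow_dvd_iff]
      intro m hm
      simp [hκ, Q', PowerSeries.coeff_trunc, hm]
    · simp [hκ, Q', hQz, z]
    · have := hQz 2 (by decide)
      simp [hκ, Q', this, z]
  have small : ∀ p : MvPolynomial (Fin 3) K, aeval Q p = 0 →
      v (aeval (fun i => ψ (Q' i)) p) ≤ v (P 1) ^ N := by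
    intro p hp
    have h1 := dvd_aeval_sub hdvd p
    rw [hp, zero_sub, dvd_neg, ← comp_aeval_apply, PowerSeries.X_pow_dvd_iff] at h1
    have h2 : (Polynomial.X : Polynomial (Polynomial K)) ^ N ∣ aeval Q' p := by
      rw [Polynomial.X_pow_dvd_iff]
      intro m hm
      simpa [hκ] using h1 m hm
    obtain ⟨q, hq⟩ := h2
    rw [← comp_aeval_apply, hq, map_mul, map_mul, map_pow, map_pow, hψX]
    exact mul_le_of_le_one_right' (hψ q)
  have hP' : ∀ i, v (ψ (Q' i)) < 1 := by
    intro i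
    fin_cases i
    · have : Polynomial.X ∣ PowerSeries.trunc N (Q 0) := by
        rw [Polynomial.X_dvd_iff, PowerSeries.coeff_trunc]
        have := PowerSeries.X_dvd_iff.1 hQ0
        simp [this]
      obtain ⟨q, hq⟩ := this
      simp only [Fin.zero_eta, Q', Matrix.cons_val_zero, hq, map_mul, hψX]
      exact mul_lt_one_of_nonneg_of_lt_one_left zero_le (h.lt 1) (hψ q)
    · simpa [Q', hψX] using h.lt 1
    · simpa [Q', hψX, hψC, t, div_mul_cancel₀ _ hx] using h.lt 2
  have hne : ∀ j ≠ 0, P j = ψ (Q' j) := by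
    intro j hj
    fin_cases j
    · exact absurd rfl hj
    · simp [Q', hψX]
    · simp [Q', hψX, hψC, t, div_mul_cancel₀ _ hx]
  have hsub : v (P 0 - ψ (Q' 0)) < 1 := (v.map_sub _ _).trans_lt (max_lt (h.lt 0) (hP' 0))
  have hclose : v (P 0 - ψ (Q' 0)) ≤ v (P 1) ^ N := by
    obtain ⟨k, hk, hfk⟩ := hv.exists_aeval_sub_eq (fun i => (h.lt i).le)
      (fun i => (hP' i).le) hne f
    have h1 := small f hQ
    rw [h.zero, zero_sub] at hfk
    rw [← v.map_neg, hfk, map_mul] at h1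
    have h2 : v (aeval (fun i => ψ (Q' i)) (pderiv 0 f) + k * (P 0 - ψ (Q' 0))) = 1 := by
      have h3 := hv.val_aeval_eq_one hP' hc'
      rw [v.map_add_eq_of_lt_left, h3]
      rw [h3, map_mul]
      exact mul_lt_one_of_nonneg_of_lt_one_right hk zero_le hsub
    rwa [h2, mul_one] at h1
  obtain ⟨k, hk, hgk⟩ := hv.exists_aeval_sub_eq (fun i => (h.lt i).le)
    (fun i => (hP' i).le) hne g
  refine absurd hN (not_lt.2 ?_)
  rw [← sub_add_cancel (aeval P g) (aeval (fun i => ψ (Q' i)) g)]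
  refine v.map_add_le ?_ (small g hg)
  rw [hgk, map_mul]
  refine (mul_le_of_le_one_right' ?_).trans hclose
  refine v.map_add_le (hv.val_aeval_le_one (fun i => (hP' i).le) _) ?_
  rw [map_mul]
  exact mul_le_one' hk hsub.le

end SmoothPoint

section ArchimedeanRationalPlace

lemma aeval_pderiv_aeval {σ τ K A : Type*} [Fintype σ] [CommRing K] [CommRing A] [Algebra K A]
    (θ : σ → MvPolynomial τ K) (Q : τ → A) (i : τ) (f : MvPolynomial σ K) :
    aeval Q (pderiv i (aeval θ f)) =
      ∑ k, aeval Q (pderiv i (θ k)) * aeval (fun j => aeval Q (θ j)) (pderiv k f) := by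
  classical
  induction f using MvPolynomial.induction_on with
  | C a => simp [algebraMap_eq]
  | add p q hp hq => simp only [map_add, hp, hq, mul_add, Finset.sum_add_distrib]
  | mul_X p j hp =>
    simp only [map_mul, pderiv_mul, map_add, hp, aeval_X, mul_add, Finset.sum_add_distrib,
      Finset.sum_mul, comp_aeval_apply]
    congr 1
    · exact Finset.sum_congr rfl fun k _ => mul_assoc _ _ _
    · rw [Finset.sum_eq_single j]
      · simp [mul_comm]
      · intro k _ hk
        simp [pderiv_X_of_ne hk.symm]
      · simp

variable {K F Γ : Type*} [Field K] [Field F] [Algebra K F] [LinearOrderedCommGroupWithZero Γ]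
  {v : Valuation F Γ} {P : Fin 3 → F} {f g : MvPolynomial (Fin 3) K}

/-- The linear substitution sending the first basis vector to `c`. -/
def linSubst (c : Fin 3 → K) : Fin 3 → MvPolynomial (Fin 3) K :=
  ![C (c 0) * X 0, X 1 + C (c 1) * X 0, X 2 + C (c 2) * X 0]

lemma coeff_aeval_linSubst (c : Fin 3 → K) (r : ℕ) :
    coeff (Finsupp.single 0 r) (aeval (linSubst c) f) = eval c (homogeneousComponent r f) := by
  have h1 : ∀ q : MvPolynomial (Fin 3) K, coeff (Finsupp.single 0 r) q =
      (aeval ![(Polynomial.X : Polynomial K), 0, 0] q).coeff r := by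
    intro q
    induction q using MvPolynomial.induction_on' with
    | add p q hp hq => simp only [coeff_add, map_add, Polynomial.coeff_add, hp, hq]
    | monomial m a =>
      rw [coeff_monomial, aeval_monomial_fin_three]
      simp only [eq_single_zero_iff, Matrix.cons_val_zero, Matrix.cons_val_one, Matrix.cons_val,
        Polynomial.algebraMap_eq]
      by_cases c1 : m 1 = 0 <;> by_cases c2 : m 2 = 0 <;>
        simp [c1, c2, Polynomial.coeff_X_pow, eq_comm]
  have h2 : ∀ q : MvPolynomial (Fin 3) K, (aeval (fun i => Polynomial.C (c i) * Polynomial.X) q :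
      Polynomial K).coeff r = eval c (homogeneousComponent r q) := by
    intro q
    induction q using MvPolynomial.induction_on' with
    | add p q hp hq => simp only [map_add, Polynomial.coeff_add, hp, hq]
    | monomial m a =>
      rw [homogeneousComponent_of_mem (isHomogeneous_monomial (n := m.degree) a rfl),
        aeval_monomial_fin_three, Finsupp.degree_eq_sum, Fin.sum_univ_three,
        Polynomial.algebraMap_eq, mul_pow, mul_pow, mul_pow,
        show (Polynomial.C a * (Polynomial.C (c 0) ^ m 0 * Polynomial.X ^ m 0 *
          (Polynomial.C (c 1) ^ m 1 * Polynomial.X ^ m 1) *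
          (Polynomial.C (c 2) ^ m 2 * Polynomial.X ^ m 2)) : Polynomial K) =
          Polynomial.C (a * (c 0 ^ m 0 * c 1 ^ m 1 * c 2 ^ m 2)) *
            Polynomial.X ^ (m 0 + m 1 + m 2) by simp only [map_mul, map_pow]; ring,
        Polynomial.coeff_C_mul_X_pow]
      split_ifs with h
      · rw [eval_monomial, Finsupp.prod_fintype _ _ (by simp), Fin.prod_univ_three]
      · simp
  rw [h1, comp_aeval_apply, ← h2]
  congr 2
  congr 1
  funext i
  fin_cases i <;> simp [linSubst]

lemma homogeneousComponent_ne_zero {r : ℕ} (h1 : HasLowMonomial (r + 1) f)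
    (h2 : ¬ HasLowMonomial r f) : homogeneousComponent r f ≠ 0 := by
  obtain ⟨m, hm, hlt⟩ := h1
  have := degree_ge_of_not_hasLowMonomial h2 hm
  intro h0
  have h3 := congrArg (coeff m) h0
  rw [coeff_homogeneousComponent, if_pos, coeff_zero] at h3
  · exact hm h3
  · rw [Finsupp.degree_eq_sum, Fin.sum_univ_three]
    omega

lemma exists_eval_algebraMap_ne [Infinite K] {p : MvPolynomial (Fin 3) F} (hp : p ≠ 0) :
    ∃ c : Fin 3 → K, eval (fun i => algebraMap K F (c i)) p ≠ 0 := by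
  by_contra! hcon
  refine hp (funext_set (fun _ => Set.range (algebraMap K F))
    (fun _ => Set.infinite_range_of_injective (algebraMap K F).injective) fun x hx => ?_)
  choose c hc using fun i => hx i (Set.mem_univ i)
  simpa [hc] using hcon c

lemma exists_linSubst [Infinite K] {r : ℕ} (h1 : HasLowMonomial (r + 1) f)
    (h2 : ¬ HasLowMonomial r f) {a : Fin 3 → F} (ha : a 0 ≠ 0) :
    ∃ c : Fin 3 → K, c 0 ≠ 0 ∧ coeff (Finsupp.single 0 r) (aeval (linSubst c) f) ≠ 0 ∧
      ∑ k, algebraMap K F (c k) * a k ≠ 0 := by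
  have hlin : (∑ k, X k * C (a k) : MvPolynomial (Fin 3) F) ≠ 0 := by
    intro h0
    have := congrArg (eval ![1, 0, 0]) h0
    simp [Fin.sum_univ_three, ha] at this
  obtain ⟨c, hc⟩ := exists_eval_algebraMap_ne (K := K) (mul_ne_zero (mul_ne_zero
    (X_ne_zero (R := F) (0 : Fin 3)) hlin) ((map_ne_zero_iff _
      (map_injective _ (algebraMap K F).injective)).2 (homogeneousComponent_ne_zero h1 h2)))
  rw [map_mul, map_mul, mul_ne_zero_iff, mul_ne_zero_iff] at hc
  refine ⟨c, ?_, ?_, ?_⟩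
  · simpa using hc.1.1
  · rw [coeff_aeval_linSubst]
    intro h0
    refine hc.2 ?_
    rw [eval_map, ← aeval_def, ← Function.comp_def, aeval_algebraMap_apply, aeval_eq_eval, h0, map_zero]
  · simpa using hc.1.2

/-- The substitution exchanging the last two variables. -/
def swapSubst : Fin 3 → MvPolynomial (Fin 3) K := ![X 0, X 2, X 1]

lemma coeff_aeval_swapSubst (r : ℕ) (f : MvPolynomial (Fin 3) K) :
    coeff (Finsupp.single 0 r) (aeval swapSubst f) = coeff (Finsupp.single 0 r) f := by
  have h := coeff_rename_mapDomain _ (Equiv.swap (1 : Fin 3) 2).injective f (Finsupp.single 0 r)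
  have h0 : (Equiv.swap (1 : Fin 3) 2) 0 = 0 := by decide
  rw [Finsupp.mapDomain_single, h0, rename_eq_aeval] at h
  rw [← h]
  congr 2
  congr 1
  funext i
  fin_cases i
  · simp [swapSubst, h0]
  · simp [swapSubst]
  · simp [swapSubst]

lemma IsGoodPoint.swap (h : IsGoodPoint v f g P) :
    IsGoodPoint v (aeval (swapSubst (K := K)) f) (aeval (swapSubst (K := K)) g) ![P 0, P 2, P 1] := by
  have hP : (fun i => aeval ![P 0, P 2, P 1] (swapSubst (K := K) i)) = P := by
    funext i
    fin_cases i <;> simp [swapSubst]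
  refine ⟨fun i => ?_, ?_, ?_, ?_⟩
  · fin_cases i
    exacts [h.lt 0, h.lt 2, h.lt 1]
  · rw [aeval_aeval, hP, h.zero]
  · rw [aeval_pderiv_aeval, hP, Fin.sum_univ_three]
    simpa [swapSubst, pderiv_X] using h.der
  · rw [aeval_aeval, hP]
    exact h.ne

/-- A good point at a rational place of rank one yields a solution over a large field. -/
lemma IsGoodPoint.solvable (hK : IsLargeField K) (hv : IsRationalVal K v)
    (harch : ∀ a b : F, v a < 1 → b ≠ 0 → ∃ n : ℕ, v a ^ n < v b)
    (h : IsGoodPoint v f g P) : Solvable f g := by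
  have := infinite_of_isLargeField hK
  suffices H : ∀ r f g P, IsGoodPoint v f g P → HasLowMonomial (K := K) r f → Solvable f g by
    have hf : f ≠ 0 := by
      rintro rfl
      exact h.der (by simp)
    obtain ⟨m, hm⟩ := ne_zero_iff.1 hf
    exact H (m 0 + m 1 + m 2 + 1) f g P h ⟨m, hm, Nat.lt_succ_self _⟩
  intro r
  induction r with
  | zero => rintro f g P - ⟨m, -, hm⟩; exact absurd hm (Nat.not_lt_zero _)
  | succ r ih =>
    have key : ∀ f g P, IsGoodPoint v f g P → coeff (R := K) (Finsupp.single 0 r) f ≠ 0 →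
        v (P 2) ≤ v (P 1) → Solvable f g := by
      intro f g P h hc hle
      by_cases hlow : HasLowMonomial r f
      · exact ih _ _ _ h hlow
      by_cases hx : P 1 = 0
      · have hP0 : P = algebraMap K F ∘ (0 : Fin 3 → K) := by
          have hy : v (P 2) ≤ 0 := by simpa [hx] using hle
          have hz := h.val_le_of_not_hasLowMonomial hv hlow hc (γ := 0) (by simp [hx]) hy
          funext i
          fin_cases i
          · simpa using hz
          · simpa using hx
          · simpa using hy
        have ev : ∀ p : MvPolynomial (Fin 3) K, aeval P p = algebraMap K F (eval 0 p) := by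
          intro p
          rw [hP0, aeval_algebraMap_apply, aeval_eq_eval]
        refine ⟨0, ?_, fun h0 => h.ne ?_⟩
        · have := h.zero
          rwa [ev, map_eq_zero] at this
        · rw [ev, h0, map_zero]
      rcases Nat.lt_or_ge 1 r with hr | hr
      · exact h.solvable_of_coeff_ne hv hr harch ih hc hx hle
      · obtain rfl | rfl : r = 1 ∨ r = 0 := by omega
        · exact h.solvable_of_coeff_single_ne hK hv harch hc hx hle
        · rw [Finsupp.single_zero] at hc
          exact absurd (hv.coeff_zero_of_aeval_eq_zero h.lt h.zero) hc
    intro f g P h hlow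
    by_cases hlow' : HasLowMonomial r f
    · exact ih f g P h hlow'
    obtain ⟨c, hc0, hc, hder⟩ := exists_linSubst (K := K) (a := fun k => aeval P (pderiv k f))
      hlow hlow' h.der
    let P₁ : Fin 3 → F := ![P 0 / algebraMap K F (c 0),
      P 1 - algebraMap K F (c 1) * (P 0 / algebraMap K F (c 0)),
      P 2 - algebraMap K F (c 2) * (P 0 / algebraMap K F (c 0))]
    have hc0' : algebraMap K F (c 0) ≠ 0 := by simpa using hc0
    have hP : (fun i => aeval P₁ (linSubst c i)) = P := by
      funext i
      fin_cases i
      · simp [linSubst, P₁, mul_div_cancel₀ _ hc0']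
      · simp [linSubst, P₁]
      · simp [linSubst, P₁]
    have hq : v (P 0 / algebraMap K F (c 0)) < 1 := by
      rw [map_div₀, hv.map_algebraMap _ hc0, div_one]
      exact h.lt 0
    have hq' : ∀ d : K, v (algebraMap K F d * (P 0 / algebraMap K F (c 0))) < 1 := fun d => by
      rw [map_mul]
      exact mul_lt_one_of_nonneg_of_lt_one_right (hv.map_algebraMap_le d) zero_le hq
    have h₁ : IsGoodPoint v (aeval (linSubst c) f) (aeval (linSubst c) g) P₁ := by
      refine ⟨?_, ?_, ?_, ?_⟩
      · intro i
        fin_cases i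
        · exact hq
        · exact (v.map_sub _ _).trans_lt (max_lt (h.lt 1) (hq' _))
        · exact (v.map_sub _ _).trans_lt (max_lt (h.lt 2) (hq' _))
      · rw [aeval_aeval, hP, h.zero]
      · rw [aeval_pderiv_aeval, hP]
        convert hder using 2 with k
        fin_cases k <;> simp [linSubst, pderiv_X]
      · rw [aeval_aeval, hP]
        exact h.ne
    refine Solvable.of_aeval_one (θ := linSubst c) ?_
    generalize aeval (linSubst c) f = f at h₁ hc
    generalize aeval (linSubst c) g = g at h₁
    generalize P₁ = P at h₁
    rcases le_total (v (P 2)) (v (P 1)) with hle | hle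
    · exact key _ _ _ h₁ hc hle
    · exact Solvable.of_aeval_one (key _ _ _ h₁.swap (by rwa [coeff_aeval_swapSubst]) hle)

end ArchimedeanRationalPlace

end

section Separability

variable {K F Γ : Type*} [Field K] [Field F] [Algebra K F] [LinearOrderedCommGroupWithZero Γ]
  {v : Valuation F Γ}

lemma IsRationalVal.eq_zero_of_val_lt_one (hv : IsRationalVal K v) {c : K}
    (h : v (algebraMap K F c) < 1) : c = 0 := by
  by_contra hc
  exact h.ne (hv.map_algebraMap c hc)

/-- Linear independence over the `p`-th powers of `K` is preserved by adjoining `p`-th powers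
of elements of a field with a rational place. -/
lemma IsRationalVal.eq_zero_of_sum_mul_pow (hv : IsRationalVal K v) (p : ℕ) [Fact p.Prime]
    [CharP K p] [CharP F p] {ι : Type*} {T : Finset ι} {b : ι → K}
    (hb : ∀ r : ι → K, ∑ j ∈ T, b j * r j ^ p = 0 → ∀ j ∈ T, r j = 0) {e : ι → F}
    (h : ∑ j ∈ T, algebraMap K F (b j) * e j ^ p = 0) : ∀ j ∈ T, e j = 0 := by
  by_contra! hcon
  obtain ⟨j₁, hj₁, hne⟩ := hcon
  obtain ⟨j₀, hj₀, hmax⟩ := T.exists_max_image (fun j => v (e j)) ⟨j₁, hj₁⟩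
  have h0 : e j₀ ≠ 0 := by
    intro h0
    have := hmax j₁ hj₁
    simp [h0, hne] at this
  have hle : ∀ j ∈ T, v (e j / e j₀) ≤ 1 := fun j hj => by
    rw [map_div₀]
    exact div_le_one_of_le₀ (hmax j hj) zero_le
  have hex : ∀ j, ∃ r : K, j ∈ T → v (e j / e j₀ - algebraMap K F r) < 1 := fun j => by
    by_cases hj : j ∈ T
    · obtain ⟨r, hr⟩ := hv.exists_sub_lt _ (hle j hj)
      exact ⟨r, fun _ => hr⟩
    · exact ⟨0, fun h => absurd h hj⟩
  choose r hr using hex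
  have hsum : ∑ j ∈ T, b j * r j ^ p = 0 := by
    apply hv.eq_zero_of_val_lt_one
    have e1 : algebraMap K F (∑ j ∈ T, b j * r j ^ p) =
        -∑ j ∈ T, algebraMap K F (b j) * (e j / e j₀ - algebraMap K F (r j)) ^ p := by
      have h2 : ∑ j ∈ T, algebraMap K F (b j) * (e j / e j₀) ^ p = 0 := by
        rw [← mul_zero ((e j₀ ^ p)⁻¹), ← h, Finset.mul_sum]
        refine Finset.sum_congr rfl fun j _ => ?_
        rw [div_pow]
        ring
      simp only [sub_pow_char, mul_sub, Finset.sum_sub_distrib, h2, zero_sub, neg_neg, map_sum,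
        map_mul, map_pow]
    rw [e1, Valuation.map_neg]
    refine v.map_sum_lt one_ne_zero fun j hj => ?_
    rw [map_mul, map_pow]
    exact mul_lt_one_of_nonneg_of_lt_one_right (hv.map_algebraMap_le _) zero_le
      (pow_lt_one₀ zero_le (hr j hj) (NeZero.ne p))
  have h1 := hr j₀ hj₀
  rw [hb r hsum j₀ hj₀, div_self h0] at h1
  simp at h1

lemma IsRationalVal.linearIndepOn_pow (hv : IsRationalVal K v) (p : ℕ) [Fact p.Prime]
    [CharP K p] {s : Finset F} (hs : LinearIndepOn K id (s : Set F)) :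
    LinearIndepOn K (fun x : F => x ^ p) (s : Set F) := by
  have : CharP F p := charP_of_injective_algebraMap (algebraMap K F).injective p
  rw [linearIndepOn_finset_iff] at hs ⊢
  classical
  intro c hc
  let k := (frobenius K p).fieldRange
  let b := Module.Basis.ofVectorSpace k K
  choose d hd using fun a j => (b.repr (c a) j).2
  have hd' : ∀ a j, d a j ^ p = b.repr (c a) j := fun a j => hd a j
  let T := s.biUnion fun a => (b.repr (c a)).support
  have hcT : ∀ a ∈ s, c a = ∑ j ∈ T, b j * d a j ^ p := by
    intro a ha
    conv_lhs => rw [← b.linearCombination_repr (c a)]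
    rw [Finsupp.linearCombination_apply, Finsupp.sum_of_support_subset _
      (Finset.subset_biUnion_of_mem (fun a => (b.repr (c a)).support) ha) _ (by simp)]
    refine Finset.sum_congr rfl fun j _ => ?_
    rw [Subfield.smul_def, smul_eq_mul, mul_comm, hd']
  have hb : ∀ r : _ → K, ∑ j ∈ T, b j * r j ^ p = 0 → ∀ j ∈ T, r j = 0 := by
    intro r hr j hj
    have h1 := linearIndependent_iff'.1 b.linearIndependent T
      (fun j => ⟨r j ^ p, r j, rfl⟩) (by
        rw [← hr]
        refine Finset.sum_congr rfl fun j _ => ?_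
        rw [Subfield.smul_def, smul_eq_mul, mul_comm]) j hj
    exact pow_eq_zero_iff (NeZero.ne p) |>.1 (congrArg Subtype.val h1)
  have key := hv.eq_zero_of_sum_mul_pow p hb
    (e := fun j => ∑ a ∈ s, algebraMap K F (d a j) * a) (by
      rw [← hc]
      simp only [sum_pow_char, mul_pow, Finset.mul_sum]
      rw [Finset.sum_comm]
      refine Finset.sum_congr rfl fun a ha => ?_
      rw [hcT a ha, Algebra.smul_def, map_sum, Finset.sum_mul]
      refine Finset.sum_congr rfl fun j _ => ?_
      rw [map_mul, map_pow, mul_assoc])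
  intro a ha
  rw [hcT a ha]
  refine Finset.sum_eq_zero fun j hj => ?_
  rw [hs (fun a => d a j) (by simpa only [Algebra.smul_def, id] using key j hj) a ha,
    zero_pow (NeZero.ne p), mul_zero]

lemma IsRationalVal.exists_separating_transcendenceBasis (hv : IsRationalVal K v)
    [Algebra.EssFiniteType K F] : ∃ s : Finset F, IsTranscendenceBasis K ((↑) : s → F) ∧
      Algebra.IsSeparable (IntermediateField.adjoin K (s : Set F)) F := by
  obtain ⟨p, hp⟩ := ExpChar.exists K
  cases hp with
  | zero => exact exists_isTranscendenceBasis_and_isSeparable_of_perfectField K F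
  | prime hp =>
    have := Fact.mk hp
    exact exists_isTranscendenceBasis_and_isSeparable_of_linearIndepOn_pow_of_essFiniteType p hp
      fun s hs => hv.linearIndepOn_pow p hs

lemma IsRationalVal.formallySmooth (hv : IsRationalVal K v) [Algebra.EssFiniteType K F] :
    Algebra.FormallySmooth K F := by
  obtain ⟨s, hs, h⟩ := hv.exists_separating_transcendenceBasis
  have : Algebra.IsSeparable (IntermediateField.adjoin K (Set.range ((↑) : s → F))) F := by
    convert! h <;> simp
  exact .of_algebraicIndependent_of_isSeparable hs.1

end Separability

section Discrete

open IntermediateField Polynomial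

variable {k F : Type*} [Field k] [Field F] [Algebra k F] {c : F}

lemma exists_aeval_eq (a : Algebra.adjoin k {c}) : ∃ r : k[X], aeval c r = (a : F) :=
  (Algebra.adjoin_singleton_eq_range_aeval k c).le a.2

open scoped IntermediateField.algebraAdjoinAdjoin in
lemma exists_sum_aeval_mul_eq_zero [FiniteDimensional k⟮c⟯ F] (hc : c ≠ 0) {ι : Type*} [Fintype ι]
    (hι : Module.finrank k⟮c⟯ F < Fintype.card ι) (y : ι → F) :
    ∃ r : ι → k[X], (∃ i, (r i).coeff 0 ≠ 0) ∧ ∑ i, aeval c (r i) * y i = 0 := by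
  have hdep : ¬ LinearIndependent (Algebra.adjoin k {c}) y := by
    rw [LinearIndependent.iff_fractionRing (Algebra.adjoin k {c}) k⟮c⟯]
    intro h
    exact hι.not_ge h.fintype_card_le_finrank
  rw [Fintype.linearIndependent_iff] at hdep
  push Not at hdep
  obtain ⟨a, ha, i₀, hi₀⟩ := hdep
  have hex : ∀ i, ∃ r : k[X], aeval c r = (a i : F) := fun i => exists_aeval_eq (a i)
  choose r hr using hex
  have hr0 : r i₀ ≠ 0 := by
    intro h
    apply hi₀
    ext
    rw [← hr, h, map_zero]
    rfl
  have hsum : ∑ i, aeval c (r i) * y i = 0 := by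
    simp only [hr]
    exact ha
  clear ha hr hi₀
  induction hn : (r i₀).natDegree using Nat.strong_induction_on generalizing r with
  | _ n ih =>
    by_cases h : ∃ i, (r i).coeff 0 ≠ 0
    · exact ⟨r, h, hsum⟩
    push Not at h
    have hX : ∀ i, X * (r i).divX = r i := fun i => by
      conv_rhs => rw [← X_mul_divX_add (r i), h, C_0, add_zero]
    have h0 : (r i₀).divX ≠ 0 := by
      intro h0
      apply hr0
      rw [← hX, h0, mul_zero]
    refine ih _ ?_ (fun i => (r i).divX) h0 ?_ rfl
    · rw [← hn, ← hX i₀, natDegree_X_mul h0, hX]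
      exact Nat.lt_succ_self _
    · refine (mul_eq_zero.1 (?_ : c * _ = 0)).resolve_left hc
      rw [Finset.mul_sum, ← hsum]
      refine Finset.sum_congr rfl fun i _ => ?_
      conv_rhs => rw [← hX, map_mul, aeval_X, mul_assoc]

variable {O : ValuationSubring F} [Algebra k O] [IsScalarTower k O F]

lemma valuation_algebraMap_le (x : k) : O.valuation (algebraMap k F x) ≤ 1 := by
  rw [IsScalarTower.algebraMap_apply k O F]
  exact O.valuation_le_one _

lemma valuation_algebraMap {x : k} (hx : x ≠ 0) : O.valuation (algebraMap k F x) = 1 := by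
  refine le_antisymm (valuation_algebraMap_le x) ?_
  have := valuation_algebraMap_le (F := F) (O := O) x⁻¹
  rw [map_inv₀, map_inv₀] at this
  exact (inv_le_one₀ (by simpa [zero_lt_iff] using hx)).1 this

lemma valuation_aeval_le (hc : O.valuation c < 1) (r : k[X]) : O.valuation (aeval c r) ≤ 1 := by
  induction r using Polynomial.induction_on' with
  | add p q hp hq => rw [map_add]; exact O.valuation.map_add_le hp hq
  | monomial n a =>
    rw [aeval_monomial, map_mul, map_pow]
    exact mul_le_one' (valuation_algebraMap_le a) (pow_le_one' hc.le n)

lemma valuation_aeval_eq_one (hc : O.valuation c < 1) {r : k[X]} (hr : r.coeff 0 ≠ 0) :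
    O.valuation (aeval c r) = 1 := by
  rw [← X_mul_divX_add r, map_add, map_mul, aeval_X, aeval_C, Valuation.map_add_eq_of_lt_right]
  · exact valuation_algebraMap (O := O) hr
  · rw [valuation_algebraMap (O := O) hr, map_mul]
    exact mul_lt_one_of_nonneg_of_lt_one_left zero_le hc (valuation_aeval_le hc _)

lemma valuation_aeval_le_of_coeff_zero (hc : O.valuation c < 1) {r : k[X]} (hr : r.coeff 0 = 0) :
    O.valuation (aeval c r) ≤ O.valuation c := by
  rw [← X_mul_divX_add r, hr, C_0, add_zero, map_mul, aeval_X, map_mul]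
  exact mul_le_of_le_one_right' (valuation_aeval_le hc _)

lemma exists_pow_le_valuation_aeval (hc : O.valuation c < 1) {r : k[X]} (hr : r ≠ 0) :
    ∃ n, O.valuation (aeval c r) = O.valuation c ^ n := by
  obtain ⟨q, hq, hdvd⟩ := exists_eq_pow_rootMultiplicity_mul_and_not_dvd r hr 0
  rw [C_0, sub_zero] at hq hdvd
  refine ⟨r.rootMultiplicity 0, ?_⟩
  rw [X_dvd_iff] at hdvd
  conv_lhs => rw [hq]
  rw [map_mul, map_pow, aeval_X, map_mul, valuation_aeval_eq_one hc hdvd, mul_one, map_pow]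

open scoped IntermediateField.algebraAdjoinAdjoin in
lemma exists_pow_lt_valuation [FiniteDimensional k⟮c⟯ F] (hc : O.valuation c < 1) (hc0 : c ≠ 0)
    {b : F} (hb : b ≠ 0) : ∃ n, O.valuation c ^ n < O.valuation b := by
  have hvc : 0 < O.valuation c := by simpa [zero_lt_iff] using hc0
  rcases lt_or_ge 1 (O.valuation b) with h1 | h1
  · exact ⟨0, by simpa using h1⟩
  have halg : IsAlgebraic (Algebra.adjoin k {c}) b :=
    (IsFractionRing.isAlgebraic_iff (Algebra.adjoin k {c}) k⟮c⟯ F).2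
      (Algebra.IsAlgebraic.isAlgebraic b)
  obtain ⟨p, hp0, hp⟩ := halg.exists_nonzero_coeff_and_aeval_eq_zero
    (mem_nonZeroDivisors_of_ne_zero hb)
  obtain ⟨r, hr⟩ := exists_aeval_eq (p.coeff 0)
  have hr0 : r ≠ 0 := by
    rintro rfl
    apply hp0
    ext
    rw [← hr]
    simp
  obtain ⟨n, hn⟩ := exists_pow_le_valuation_aeval hc hr0
  refine ⟨n + 1, ?_⟩
  have hle : ∀ q : (Algebra.adjoin k {c})[X], O.valuation (aeval b q) ≤ 1 := by
    intro q
    induction q using Polynomial.induction_on' with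
    | add p q hp hq => rw [map_add]; exact O.valuation.map_add_le hp hq
    | monomial n a =>
      rw [aeval_monomial, map_mul, map_pow]
      refine mul_le_one' ?_ (pow_le_one' h1 n)
      obtain ⟨r, hr⟩ := exists_aeval_eq a
      change O.valuation (a : F) ≤ 1
      rw [← hr]
      exact valuation_aeval_le hc r
  have hpb : O.valuation (aeval c r) ≤ O.valuation b := by
    rw [← X_mul_divX_add p, map_add, map_mul, aeval_X, aeval_C] at hp
    have : aeval c r = -(b * aeval b p.divX) := by
      rw [eq_neg_iff_add_eq_zero, add_comm]
      rw [← hp]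
      exact congrArg _ hr
    rw [this, Valuation.map_neg, map_mul]
    exact mul_le_of_le_one_right' (hle _)
  rw [hn] at hpb
  exact (pow_lt_pow_right_of_lt_one₀ hvc hc (Nat.lt_succ_self n)).trans_le hpb

lemma not_injective_valuation [FiniteDimensional k⟮c⟯ F] (hc : O.valuation c < 1) (hc0 : c ≠ 0)
    {ι : Type*} [Fintype ι] (hι : Module.finrank k⟮c⟯ F < Fintype.card ι) {y : ι → F}
    (hy : ∀ i, O.valuation c < O.valuation (y i)) (hy1 : ∀ i, O.valuation (y i) ≤ 1) :
    ¬ Function.Injective fun i => O.valuation (y i) := by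
  intro hinj
  obtain ⟨r, hr, hsum⟩ := exists_sum_aeval_mul_eq_zero (k := k) hc0 hι y
  classical
  obtain ⟨i₀, hi₀, hmax⟩ := (Finset.univ.filter fun i => (r i).coeff 0 ≠ 0).exists_max_image
    (fun i => O.valuation (y i)) (by obtain ⟨i, hi⟩ := hr; exact ⟨i, by simpa using hi⟩)
  simp only [Finset.mem_filter, Finset.mem_univ, true_and] at hi₀ hmax
  have hlt : O.valuation (∑ i ∈ Finset.univ.erase i₀, aeval c (r i) * y i) <
      O.valuation (y i₀) := by
    refine Valuation.map_sum_lt _ (zero_le.trans_lt (hy i₀)).ne' fun i hi => ?_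
    rw [map_mul]
    by_cases h : (r i).coeff 0 = 0
    · refine (mul_le_of_le_one_right' (hy1 i)).trans_lt ?_
      exact (valuation_aeval_le_of_coeff_zero hc h).trans_lt (hy i₀)
    · rw [valuation_aeval_eq_one hc h, one_mul]
      exact lt_of_le_of_ne (hmax i h) fun h' => Finset.ne_of_mem_erase hi (hinj h')
  rw [← Finset.add_sum_erase _ _ (Finset.mem_univ i₀), add_eq_zero_iff_eq_neg'] at hsum
  rw [hsum, Valuation.map_neg, map_mul, valuation_aeval_eq_one hc hi₀, one_mul] at hlt
  exact hlt.ne rfl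

lemma exists_uniformizer [FiniteDimensional k⟮c⟯ F] (hc : O.valuation c < 1) (hc0 : c ≠ 0) :
    ∃ t, t ≠ 0 ∧ O.valuation t < 1 ∧ ∀ x, O.valuation x < 1 → O.valuation x ≤ O.valuation t := by
  by_contra! hcon
  let T := {t : F // t ≠ 0 ∧ O.valuation t < 1}
  have hnext : ∀ t : T, ∃ s : T, O.valuation t.1 < O.valuation s.1 := by
    rintro ⟨t, h0, h1⟩
    obtain ⟨x, hx, hlt⟩ := hcon t h0 h1
    refine ⟨⟨x, ?_, hx⟩, hlt⟩
    rintro rfl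
    simp at hlt
  choose next hnext using hnext
  let y : ℕ → T := fun n => next^[n] ⟨c, hc0, hc⟩
  have hmono : StrictMono fun n => O.valuation (y n).1 := by
    refine strictMono_nat_of_lt_succ fun n => ?_
    simp only [y, Function.iterate_succ_apply']
    exact hnext _
  refine not_injective_valuation (k := k) hc hc0 (ι := Fin (Module.finrank k⟮c⟯ F + 1)) (by simp)
    (y := fun i => (y (i + 1)).1) (fun i => hmono (Nat.succ_pos i)) (fun i => (y _).2.2.le) ?_
  intro i j hij
  exact Fin.ext (Nat.succ_injective (hmono.injective hij))

lemma exists_pow_lt_valuation_of_lt_one [FiniteDimensional k⟮c⟯ F] (hc : O.valuation c < 1)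
    (hc0 : c ≠ 0) {t : F} (ht0 : t ≠ 0) (ht : O.valuation t < 1) {b : F} (hb : b ≠ 0) :
    ∃ n, O.valuation t ^ n < O.valuation b := by
  have hvt : 0 < O.valuation t := by simpa [zero_lt_iff] using ht0
  obtain ⟨n, hn⟩ := exists_pow_lt_valuation (k := k) hc hc0 hb
  have hm : ∃ m : ℕ, O.valuation t ^ m ≤ O.valuation c := by
    by_contra! hcon
    refine not_injective_valuation (k := k) hc hc0 (ι := Fin (Module.finrank k⟮c⟯ F + 1)) (by simp)
      (y := fun i => t ^ (i : ℕ)) (fun i => by rw [map_pow]; exact hcon _)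
      (fun i => by rw [map_pow]; exact pow_le_one' ht.le _) ?_
    intro i j hij
    simp only [map_pow] at hij
    exact Fin.ext (pow_right_injective₀ hvt ht.ne hij)
  obtain ⟨m, hm⟩ := hm
  exact ⟨m * n, by rw [pow_mul]; exact (pow_le_pow_left' hm n).trans_lt hn⟩

lemma finiteDimensional_residueField [FiniteDimensional k⟮c⟯ F] (hc : O.valuation c < 1)
    (hc0 : c ≠ 0) : FiniteDimensional k (IsLocalRing.ResidueField O) := by
  have hrank : Module.rank k (IsLocalRing.ResidueField O) ≤ (Module.finrank k⟮c⟯ F : ℕ) := by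
    refine rank_le fun s hs => ?_
    by_contra! hlt
    choose y hy using IsLocalRing.residue_surjective (R := O)
    have hcO : c ∈ O := (O.valuation_le_one_iff c).1 hc.le
    obtain ⟨r, ⟨i₀, hi₀⟩, hsum⟩ := exists_sum_aeval_mul_eq_zero (k := k) hc0 (ι := s)
      (by simpa using hlt) (fun i => (y i : F))
    refine hi₀ (Fintype.linearIndependent_iff.1 hs (fun i => (r i).coeff 0) ?_ i₀)
    have h0 : ∑ i, aeval (⟨c, hcO⟩ : O) (r i) * y i = 0 := by
      apply Subtype.ext
      rw [← O.algebraMap_apply, map_sum]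
      refine Eq.trans (Finset.sum_congr rfl fun i _ => ?_) hsum
      rw [map_mul, ← aeval_algebraMap_apply]
      rfl
    have := congrArg (IsLocalRing.residue O) h0
    rw [map_sum, map_zero] at this
    rw [← this]
    refine Finset.sum_congr rfl fun i _ => ?_
    have hc' : IsLocalRing.residue O ⟨c, hcO⟩ = 0 := by
      rw [IsLocalRing.residue_eq_zero_iff]
      exact (O.valuation_lt_one_iff _).2 hc
    rw [map_mul, hy, Algebra.smul_def]
    congr 1
    change _ = algebraMap O (IsLocalRing.ResidueField O) _
    rw [← aeval_algebraMap_apply]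
    change _ = aeval (IsLocalRing.residue O ⟨c, hcO⟩) _
    rw [hc', ← coeff_zero_eq_aeval_zero']
  exact Module.rank_lt_aleph0_iff.1 (hrank.trans_lt (Cardinal.natCast_lt_aleph0))

end Discrete

section DiscreteApproximation

open Polynomial IsLocalRing

variable {K R : Type*} [Field K] [CommRing R] [IsDomain R] [IsLocalRing R] [Algebra K R] {t : R}

lemma exists_algHom_quotient [Algebra.FormallySmooth K (ResidueField R)]
    (ht : ∀ r : R, residue R r = 0 ↔ t ∣ r) (N : ℕ) :
    ∃ σ : ResidueField R →ₐ[K] R ⧸ Ideal.span {t ^ (N + 1)},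
      ∀ r : R, ∃ s : R, σ (residue R r) = Ideal.Quotient.mk _ (r + t * s) := by
  let g : (R ⧸ Ideal.span {t ^ (N + 1)}) →ₐ[K] ResidueField R :=
    Ideal.Quotient.liftₐ _ (IsScalarTower.toAlgHom K R (ResidueField R)) (by
      intro a ha
      rw [Ideal.mem_span_singleton] at ha
      exact (ht a).2 ((dvd_pow_self t N.succ_ne_zero).trans ha))
  have hg : ∀ r : R, g (Ideal.Quotient.mk _ r) = residue R r := fun r => rfl
  have hsurj : Function.Surjective g := fun x => by
    obtain ⟨r, rfl⟩ := residue_surjective x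
    exact ⟨_, hg r⟩
  have hker : RingHom.ker (g : (R ⧸ Ideal.span {t ^ (N + 1)}) →+* ResidueField R) ≤
      Ideal.span {Ideal.Quotient.mk _ t} := by
    intro x hx
    obtain ⟨r, rfl⟩ := Ideal.Quotient.mk_surjective x
    obtain ⟨s, rfl⟩ := (ht r).1 hx
    rw [map_mul]
    exact Ideal.mul_mem_right _ _ (Ideal.mem_span_singleton_self _)
  have hnil : IsNilpotent (RingHom.ker (g : (R ⧸ Ideal.span {t ^ (N + 1)}) →+* ResidueField R)) := by
    refine ⟨N + 1, le_bot_iff.1 ((Ideal.pow_right_mono hker _).trans ?_)⟩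
    rw [Ideal.span_singleton_pow, ← map_pow,
      Ideal.Quotient.eq_zero_iff_mem.2 (Ideal.mem_span_singleton_self _)]
    simp
  let σ := Algebra.FormallySmooth.liftOfSurjective (AlgHom.id K (ResidueField R)) g hsurj hnil
  have hσ : ∀ x, g (σ x) = x := fun x => Algebra.FormallySmooth.liftOfSurjective_apply _ g hsurj hnil x
  refine ⟨σ, fun r => ?_⟩
  obtain ⟨r', hr'⟩ := Ideal.Quotient.mk_surjective (σ (residue R r))
  have h1 : residue R r' = residue R r := by rw [← hg, hr', hσ]
  obtain ⟨s, hs⟩ := (ht (r' - r)).1 (by rw [map_sub, h1, sub_self])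
  exact ⟨s, by rw [← hs, add_sub_cancel, hr']⟩

lemma exists_polynomial_coeff [Algebra.FormallySmooth K (ResidueField R)] (ht0 : t ≠ 0)
    (ht : ∀ r : R, residue R r = 0 ↔ t ∣ r) {σ : Type*} (P : σ → R) (N : ℕ) :
    ∃ p : σ → (ResidueField R)[X], ∀ h : MvPolynomial σ K,
      (MvPolynomial.aeval P h = 0 → X ^ (N + 1) ∣ MvPolynomial.aeval p h) ∧
      ∀ e ≤ N, X ^ (e + 1) ∣ MvPolynomial.aeval p h → t ^ (e + 1) ∣ MvPolynomial.aeval P h := by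
  obtain ⟨s, hs⟩ := exists_algHom_quotient (K := K) ht N
  let π : R →ₐ[K] R ⧸ Ideal.span {t ^ (N + 1)} := Ideal.Quotient.mkₐ K _
  have hπ : ∀ r, Ideal.Quotient.mk _ r = π r := fun r => rfl
  have hπ0 : ∀ r, π r = 0 ↔ t ^ (N + 1) ∣ r := fun r => by
    rw [← hπ, Ideal.Quotient.eq_zero_iff_mem, Ideal.mem_span_singleton]
  have hπs : Function.Surjective π := Ideal.Quotient.mk_surjective
  simp only [hπ] at hs
  let ψ : (ResidueField R)[X] →ₐ[K] R ⧸ Ideal.span {t ^ (N + 1)} :=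
    Polynomial.eval₂AlgHom s (π t) fun _ => Commute.all _ _
  have hψX : ψ X = π t := by simp [ψ]
  have hψC : ∀ a, ψ (C a) = s a := by simp [ψ]
  have happrox : ∀ j : ℕ, ∀ r : R, ∃ p, ∃ r' : R, ψ p = π (r + t ^ j * r') := by
    intro j
    induction j with
    | zero => exact fun r => ⟨0, -r, by simp⟩
    | succ j ih =>
      intro r
      obtain ⟨p, r', hp⟩ := ih r
      obtain ⟨w, hw⟩ := hs r'
      refine ⟨p - C (residue R r') * X ^ j, -w, ?_⟩
      rw [map_sub, hp, map_mul, hψC, hw, map_pow, hψX, ← map_pow, ← map_mul, ← map_sub]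
      congr 1
      ring
  have hψ : Function.Surjective ψ := by
    intro x
    obtain ⟨r, rfl⟩ := hπs x
    obtain ⟨p, r', hp⟩ := happrox (N + 1) r
    refine ⟨p, ?_⟩
    rw [hp, map_add, (hπ0 _).2 (dvd_mul_right _ r'), add_zero]
  have hker : ∀ q, ψ q = 0 → X ^ (N + 1) ∣ q := by
    intro q hq
    by_contra hdvd
    have hq0 : q ≠ 0 := by
      rintro rfl
      exact hdvd (dvd_zero _)
    obtain ⟨q₁, h1, h2⟩ := exists_eq_pow_rootMultiplicity_mul_and_not_dvd q hq0 0
    rw [C_0, sub_zero] at h1 h2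
    generalize q.rootMultiplicity 0 = a at h1
    have haN : a < N + 1 := by
      by_contra! h
      exact hdvd ((pow_dvd_pow X h).trans (Dvd.intro _ h1.symm))
    rw [X_dvd_iff] at h2
    obtain ⟨r, hr⟩ := residue_surjective (q₁.coeff 0)
    obtain ⟨w, hw⟩ := hs r
    obtain ⟨r', hr'⟩ := hπs (ψ q₁.divX)
    have h3 : ψ q = π (t ^ a * (r + t * (w + r'))) := by
      rw [h1, ← X_mul_divX_add q₁]
      simp only [map_mul, map_add, map_pow, hψX, hψC, ← hr', ← hr, hw]
      ring
    rw [hq, eq_comm, hπ0] at h3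
    have h4 := (mul_dvd_mul_iff_left (pow_ne_zero a ht0)).1
      ((pow_succ t a ▸ pow_dvd_pow t haN : t ^ a * t ∣ _).trans h3)
    apply h2
    rw [← hr, ht]
    exact (dvd_add_left (dvd_mul_right t _)).1 h4
  choose p hp using fun i => hψ (π (P i))
  have hev : ∀ h : MvPolynomial σ K, ψ (MvPolynomial.aeval p h) = π (MvPolynomial.aeval P h) := by
    intro h
    rw [MvPolynomial.comp_aeval_apply, MvPolynomial.comp_aeval_apply]
    simp only [hp]
  refine ⟨p, fun h => ⟨fun h0 => hker _ (by rw [hev, h0, map_zero]), fun e he hdvd => ?_⟩⟩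
  obtain ⟨q, hq⟩ := hdvd
  obtain ⟨r, hr⟩ := hπs (ψ q)
  have h1 : π (MvPolynomial.aeval P h - t ^ (e + 1) * r) = 0 := by
    rw [map_sub, ← hev, hq, map_mul, map_mul, hr, map_pow, map_pow, hψX, sub_self]
  rw [hπ0] at h1
  exact (dvd_sub_left (dvd_mul_right _ _)).1 ((pow_dvd_pow t (by omega)).trans h1)

end DiscreteApproximation

section Specialize

open MvPolynomial

variable {K : Type*} [Field K]

/-- Every finitely generated subalgebra of `F` has a `K`-rational point. -/
def HasPoints (K F : Type*) [Field K] [Field F] [Algebra K F] : Prop :=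
  ∀ S : Finset F, Nonempty (Algebra.adjoin K (S : Set F) →ₐ[K] K)

lemma exists_coeff_ne_of_not_dvd {κ : Type*} [Field κ] {q : Polynomial κ} {e : ℕ}
    (h : ¬ Polynomial.X ^ (e + 1) ∣ q) :
    ∃ d ≤ e, q.coeff d ≠ 0 ∧ ∀ j < d, q.coeff j = 0 := by
  rw [Polynomial.X_pow_dvd_iff] at h
  push Not at h
  classical
  refine ⟨Nat.find h, ?_, (Nat.find_spec h).2, fun j hj => ?_⟩
  · obtain ⟨d, hd, hd'⟩ := h
    exact (Nat.find_min' _ ⟨hd, hd'⟩).trans (Nat.lt_succ_iff.1 hd)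
  · by_contra hne
    exact Nat.find_min h hj ⟨hj.trans (Nat.find_spec h).1, hne⟩

lemma exists_powerSeries_of_hasPoints {κ : Type*} [Field κ] [Algebra K κ] (hκ : HasPoints K κ)
    {σ : Type*} [Fintype σ] (p : σ → Polynomial κ) (T : Finset κ) (hT : ∀ x ∈ T, x ≠ 0) :
    ∃ Q : σ → PowerSeries K, ∀ (h : MvPolynomial σ K) (d : ℕ),
      ((aeval p h).coeff d = 0 → PowerSeries.coeff d (aeval Q h) = 0) ∧
      ((aeval p h).coeff d ∈ T → PowerSeries.coeff d (aeval Q h) ≠ 0) := by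
  classical
  let S : Finset κ := (Finset.univ.biUnion fun i => (p i).coeffs) ∪ T.image fun x => x⁻¹
  obtain ⟨φ⟩ := hκ S
  let A := Algebra.adjoin K (S : Set κ)
  have hmem : ∀ i, p i ∈ Polynomial.lifts (algebraMap A κ) := fun i => by
    rw [Polynomial.lifts_iff_coeff_lifts]
    intro d
    by_cases hd : (p i).coeff d = 0
    · exact ⟨0, by rw [hd, map_zero]⟩
    · refine ⟨⟨(p i).coeff d, Algebra.subset_adjoin ?_⟩, rfl⟩
      simp only [S, Finset.coe_union, Finset.coe_biUnion]
      left
      simp only [Set.mem_iUnion]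
      exact ⟨i, by simp, Polynomial.coeff_mem_coeffs hd⟩
  choose p' hp' using hmem
  let α : Polynomial A →ₐ[K] Polynomial κ := Polynomial.mapAlgHom (Algebra.algHom K A κ)
  let β : Polynomial A →ₐ[K] PowerSeries K :=
    (Polynomial.coeToPowerSeries.algHom K).comp (Polynomial.mapAlgHom φ)
  have hα : ∀ h : MvPolynomial σ K, α (aeval p' h) = aeval p h := fun h => by
    rw [comp_aeval_apply]
    congr 2
    funext i
    exact hp' i
  refine ⟨fun i => β (p' i), fun h d => ?_⟩
  have h1 : (aeval p h).coeff d = ((aeval p' h).coeff d : κ) := by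
    rw [← hα]
    simp [α]
    rfl
  have h2 : PowerSeries.coeff d (aeval (fun i => β (p' i)) h) = φ ((aeval p' h).coeff d) := by
    rw [← comp_aeval_apply]
    simp [β]
  rw [h1, h2]
  refine ⟨fun h0 => ?_, fun hmT h0 => ?_⟩
  · rw [ZeroMemClass.coe_eq_zero.1 h0, map_zero]
  · let b : A := ⟨((aeval p' h).coeff d : κ)⁻¹, Algebra.subset_adjoin (by
      simp only [S, Finset.coe_union]
      right
      exact Finset.mem_image_of_mem _ hmT)⟩
    have h3 : (aeval p' h).coeff d * b = 1 := Subtype.ext (mul_inv_cancel₀ (hT _ hmT))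
    have := congrArg φ h3
    rw [map_mul, h0, zero_mul, map_one] at this
    exact zero_ne_one this

lemma exists_eval_of_approximation (hK : IsLargeField K) {n : ℕ} {f g : MvPolynomial (Fin n) K}
    {Q : Fin n → PowerSeries K} {i : Fin n} {e m N : ℕ} (hN : 2 * e + m + 1 ≤ N)
    (hf : ∀ d < N, PowerSeries.coeff d (aeval Q f) = 0)
    (hi : PowerSeries.coeff e (aeval Q (pderiv i f)) ≠ 0)
    (hi' : ∀ d < e, PowerSeries.coeff d (aeval Q (pderiv i f)) = 0)
    (hg : PowerSeries.coeff m (aeval Q g) ≠ 0) :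
    ∃ x, eval x f = 0 ∧ eval x g ≠ 0 := by
  obtain ⟨u, hu⟩ := PowerSeries.X_pow_dvd_iff.2 hi'
  have hu1 : IsUnit u := by
    rw [PowerSeries.isUnit_iff_constantCoeff, isUnit_iff_ne_zero]
    rw [hu] at hi
    simpa [PowerSeries.coeff_X_pow_mul'] using hi
  obtain ⟨Q', h0, hne, hdvd⟩ := exists_point_of_pow_dvd f Q i u hu1 (e := e) (N := N) (by omega)
    (PowerSeries.X_pow_dvd_iff.2 hf) hu
  refine exists_eval_of_powerSeries hK h0 fun h => hg ?_
  have hd : PowerSeries.X ^ (N - e) ∣ aeval Q' g - aeval Q g := by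
    refine dvd_aeval_sub (fun j => ?_) g
    by_cases hj : j = i
    · rw [hj]
      exact hdvd
    · rw [hne j hj, sub_self]
      exact dvd_zero _
  have := PowerSeries.X_pow_dvd_iff.1 hd m (by omega)
  rwa [h, zero_sub, map_neg, neg_eq_zero] at this

lemma exists_eval_of_discrete (hK : IsLargeField K) {R : Type*} [CommRing R] [IsDomain R]
    [IsLocalRing R] [Algebra K R] [Algebra.FormallySmooth K (IsLocalRing.ResidueField R)]
    (hκ : HasPoints K (IsLocalRing.ResidueField R)) {t : R} (ht0 : t ≠ 0)
    (ht : ∀ r : R, IsLocalRing.residue R r = 0 ↔ t ∣ r)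
    (hpow : ∀ b : R, b ≠ 0 → ∃ n, ¬ t ^ (n + 1) ∣ b) {n : ℕ} {f g : MvPolynomial (Fin n) K}
    {P : Fin n → R} {i : Fin n} (hf : aeval P f = 0) (hi : aeval P (pderiv i f) ≠ 0)
    (hg : aeval P g ≠ 0) : ∃ x, eval x f = 0 ∧ eval x g ≠ 0 := by
  obtain ⟨e, he⟩ := hpow _ hi
  obtain ⟨m, hm⟩ := hpow _ hg
  obtain ⟨p, hp⟩ := exists_polynomial_coeff (K := K) ht0 ht P (2 * e + m)
  obtain ⟨e', hle, h1, h2⟩ := exists_coeff_ne_of_not_dvd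
    (fun h => he ((hp _).2 e (by omega) h))
  obtain ⟨m', hlm, h3, -⟩ := exists_coeff_ne_of_not_dvd
    (fun h => hm ((hp _).2 m (by omega) h))
  classical
  obtain ⟨Q, hQ⟩ := exists_powerSeries_of_hasPoints hκ p
    {(aeval p (pderiv i f)).coeff e', (aeval p g).coeff m'} (by
      intro x hx
      simp only [Finset.mem_insert, Finset.mem_singleton] at hx
      rcases hx with rfl | rfl <;> assumption)
  exact exists_eval_of_approximation hK (N := 2 * e + m + 1) (Q := Q) (e := e') (m := m') (i := i)
    (by omega) (fun d hd => (hQ _ _).1 (Polynomial.X_pow_dvd_iff.1 ((hp _).1 hf) d hd))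
    ((hQ _ _).2 (by simp)) (fun d hd => (hQ _ _).1 (h2 d hd)) ((hQ _ _).2 (by simp))

end Specialize

section Presentation

open MvPolynomial

variable {K F : Type*} [Field K] [Field F] [Algebra K F]

lemma nonempty_algHom_adjoin {σ : Type*} {P : σ → F} {Q : σ → K}
    (hker : ∀ h : MvPolynomial σ K, aeval P h = 0 → eval Q h = 0) {S : Set F}
    (hS : ∀ s ∈ S, ∃ a b : MvPolynomial σ K, eval Q b ≠ 0 ∧ s * aeval P b = aeval P a) :
    Nonempty (Algebra.adjoin K S →ₐ[K] K) := by
  let B : Subalgebra K F :=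
    { carrier := {x | ∃ a b : MvPolynomial σ K, eval Q b ≠ 0 ∧ x * aeval P b = aeval P a}
      mul_mem' := by
        rintro x y ⟨a, b, hb, h⟩ ⟨a', b', hb', h'⟩
        refine ⟨a * a', b * b', by rw [map_mul]; exact mul_ne_zero hb hb', ?_⟩
        rw [map_mul, map_mul, ← h, ← h']
        ring
      add_mem' := by
        rintro x y ⟨a, b, hb, h⟩ ⟨a', b', hb', h'⟩
        refine ⟨a * b' + a' * b, b * b', by rw [map_mul]; exact mul_ne_zero hb hb', ?_⟩
        rw [map_add, map_mul, map_mul, map_mul, ← h, ← h']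
        ring
      algebraMap_mem' := fun r => ⟨C r, 1, by simp, by simp⟩ }
  choose a b hb hab using fun x : B => x.2
  let φ : B → K := fun x => eval Q (a x) / eval Q (b x)
  have key : ∀ (x : B) (a' b' : MvPolynomial σ K), (x : F) * aeval P b' = aeval P a' →
      φ x * eval Q b' = eval Q a' := by
    intro x a' b' h
    have := hker (a x * b' - a' * b x) (by
      rw [map_sub, map_mul, map_mul, ← hab, ← h]
      ring)
    rw [map_sub, map_mul, map_mul, sub_eq_zero] at this
    simp only [φ]
    rw [div_mul_eq_mul_div, div_eq_iff (hb x), this]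
  have hφ : ∀ r : K, φ (algebraMap K B r) = r := fun r => by
    have := key (algebraMap K B r) (C r) 1 (by simp)
    simpa using this
  let Φ : B →ₐ[K] K :=
    { toFun := φ
      map_one' := by simpa using hφ 1
      map_zero' := by simpa using hφ 0
      map_mul' := fun x y => by
        have := key (x * y) (a x * a y) (b x * b y) (by
          rw [map_mul, map_mul, ← hab, ← hab, Subalgebra.coe_mul]
          ring)
        rw [map_mul, map_mul] at this
        simp only [φ] at this ⊢
        rw [div_mul_div_comm, eq_div_iff (mul_ne_zero (hb x) (hb y))]
        exact this
      map_add' := fun x y => by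
        have := key (x + y) (a x * b y + a y * b x) (b x * b y) (by
          rw [map_add, map_mul, map_mul, map_mul, ← hab, ← hab, Subalgebra.coe_add]
          ring)
        rw [map_add, map_mul, map_mul, map_mul] at this
        simp only [φ] at this ⊢
        rw [div_add_div _ _ (hb x) (hb y), eq_div_iff (mul_ne_zero (hb x) (hb y)), this]
        ring
      commutes' := hφ }
  exact ⟨Φ.comp (Subalgebra.inclusion (Algebra.adjoin_le hS : Algebra.adjoin K S ≤ B))⟩

end Presentation

section Division

open Polynomial

variable {R L F : Type*} [CommRing R] [IsDomain R] [Field L] [Field F] [Algebra R L]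
  [IsFractionRing R L] [Algebra R F] [Algebra L F] [IsScalarTower R L F]

lemma exists_aeval_eq_zero_and_dvd {z : F} (hz : IsSeparable L z) :
    ∃ (f : R[X]) (c : R), c ≠ 0 ∧ aeval z f = 0 ∧ aeval z (derivative f) ≠ 0 ∧
      ∀ h : R[X], aeval z h = 0 → ∃ N, f ∣ C c ^ N * h := by
  obtain ⟨b, hbR, hb⟩ := IsLocalization.integerNormalization_spec (nonZeroDivisors R) (minpoly L z)
  set f := IsLocalization.integerNormalization (nonZeroDivisors R) (minpoly L z)
  have hb0 : algebraMap R L b ≠ 0 := IsFractionRing.to_map_ne_zero_of_mem_nonZeroDivisors hbR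
  have hmap : f.map (algebraMap R L) = C (algebraMap R L b) * minpoly L z := by
    rw [hb, ← algebraMap_smul L, smul_eq_C_mul]
  have hdeg : f.natDegree = (minpoly L z).natDegree := by
    rw [← natDegree_map_eq_of_injective (IsFractionRing.injective R L), hmap, natDegree_C_mul hb0]
  have hpos : 0 < f.natDegree := hdeg ▸ minpoly.natDegree_pos hz.isIntegral
  have hf0 : f ≠ 0 := by
    intro h
    simp [h] at hpos
  refine ⟨f, f.leadingCoeff, leadingCoeff_ne_zero.2 hf0, ?_, ?_, ?_⟩
  · rw [← aeval_map_algebraMap L, hmap, map_mul, minpoly.aeval, mul_zero]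
  · rw [← aeval_map_algebraMap L, ← derivative_map, hmap, derivative_C_mul, map_mul, aeval_C]
    exact mul_ne_zero (by simp [hb0]) (hz.aeval_derivative_ne_zero (minpoly.aeval L z))
  · intro h hh
    induction hn : h.natDegree using Nat.strong_induction_on generalizing h with
    | _ n ih =>
      by_cases hlt : h.natDegree < f.natDegree
      · refine ⟨0, ?_⟩
        rw [(?_ : h = 0)]
        · simp
        by_contra hne
        have h1 : h.map (algebraMap R L) ≠ 0 :=
          (Polynomial.map_ne_zero_iff (IsFractionRing.injective R L)).2 hne
        have := natDegree_le_natDegree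
          (minpoly.degree_le_of_ne_zero L z h1 (by rwa [aeval_map_algebraMap]))
        rw [natDegree_map_eq_of_injective (IsFractionRing.injective R L), ← hdeg] at this
        omega
      · push Not at hlt
        let h' := C f.leadingCoeff * h - C h.leadingCoeff * X ^ (h.natDegree - f.natDegree) * f
        have hfz : aeval z f = 0 := by
          rw [← aeval_map_algebraMap L, hmap, map_mul, minpoly.aeval, mul_zero]
        have h'z : aeval z h' = 0 := by
          simp only [h', map_sub, map_mul, hh, hfz, mul_zero, sub_self]
        have hle : h'.natDegree ≤ n - 1 := by
          rw [natDegree_le_iff_coeff_eq_zero]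
          intro N hN
          rcases eq_or_lt_of_le (show n ≤ N by omega) with rfl | hlt'
          · simp only [h', coeff_sub, coeff_C_mul, mul_assoc]
            rw [coeff_X_pow_mul', if_pos (by omega),
              show n - (h.natDegree - f.natDegree) = f.natDegree by omega, ← hn,
              coeff_natDegree, coeff_natDegree]
            ring
          · simp only [h', coeff_sub, coeff_C_mul, mul_assoc]
            rw [coeff_X_pow_mul', if_pos (by omega), coeff_eq_zero_of_natDegree_lt (by omega),
              coeff_eq_zero_of_natDegree_lt (by omega), mul_zero, mul_zero, sub_zero]
        obtain ⟨N, hN⟩ := ih h'.natDegree (by omega) h' h'z rfl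
        refine ⟨N + 1, ?_⟩
        have : C f.leadingCoeff ^ (N + 1) * h = C f.leadingCoeff ^ N * h' +
            C f.leadingCoeff ^ N * (C h.leadingCoeff * X ^ (h.natDegree - f.natDegree)) * f := by
          simp only [h']
          ring
        rw [this]
        exact dvd_add hN (dvd_mul_left _ _)

end Division

section PrimitivePresentation

open MvPolynomial

variable {K F : Type*} [Field K] [Field F] [Algebra K F]

lemma aeval_cons_eq {R : Type*} [CommRing R] [Algebra K R] [Algebra R F] [IsScalarTower K R F]
    {d : ℕ} (e : MvPolynomial (Fin d) K ≃ₐ[K] R) {Y : Fin d → F}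
    (he : ∀ p, algebraMap R F (e p) = aeval Y p) (z : F) :
    ∃ θ : MvPolynomial (Fin (d + 1)) K ≃ₐ[K] Polynomial R,
      (∀ p, aeval (Fin.cons z Y : Fin (d + 1) → F) p = Polynomial.aeval z (θ p)) ∧
      ∀ p, θ (pderiv 0 p) = Polynomial.derivative (θ p) := by
  let θ := (finSuccEquiv K d).trans (Polynomial.mapAlgEquiv e)
  have hθ0 : θ (X 0) = Polynomial.X := by
    simp [θ, finSuccEquiv_X_zero]
  have hθs : ∀ i : Fin d, θ (X i.succ) = Polynomial.C (e (X i)) := fun i => by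
    simp [θ, finSuccEquiv_X_succ]
  have hθC : ∀ a, θ (C a) = Polynomial.C (algebraMap K R a) := fun a => by
    rw [← algebraMap_eq, AlgEquiv.commutes]
    rfl
  clear_value θ
  refine ⟨θ, fun p => ?_, fun p => ?_⟩
  · induction p using MvPolynomial.induction_on with
    | C a => rw [hθC, Polynomial.aeval_C, aeval_C, ← IsScalarTower.algebraMap_apply]
    | add p q hp hq => simp only [map_add, hp, hq]
    | mul_X p i hp =>
      rw [map_mul, map_mul, map_mul, hp, aeval_X]
      congr 1
      refine Fin.cases ?_ (fun j => ?_) i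
      · rw [hθ0, Polynomial.aeval_X, Fin.cons_zero]
      · rw [hθs, Polynomial.aeval_C, he, aeval_X, Fin.cons_succ]
  · induction p using MvPolynomial.induction_on with
    | C a => rw [pderiv_C, map_zero, hθC, Polynomial.derivative_C]
    | add p q hp hq => simp only [map_add, hp, hq]
    | mul_X p i hp =>
      rw [pderiv_mul, map_add, map_mul, map_mul, hp, map_mul θ p, Polynomial.derivative_mul]
      congr 2
      refine Fin.cases ?_ (fun j => ?_) i
      · rw [hθ0, pderiv_X_self, Polynomial.derivative_X, map_one]
      · rw [hθs, pderiv_X_of_ne (Fin.succ_ne_zero j), Polynomial.derivative_C, map_zero]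

open scoped IntermediateField.algebraAdjoinAdjoin in
lemma exists_equation {d : ℕ} {Y : Fin d → F} (hY : AlgebraicIndependent K Y) {z : F}
    (hz : IsSeparable (IntermediateField.adjoin K (Set.range Y)) z) :
    ∃ f c : MvPolynomial (Fin (d + 1)) K, aeval (Fin.cons z Y : Fin (d + 1) → F) f = 0 ∧
      aeval (Fin.cons z Y : Fin (d + 1) → F) (pderiv 0 f) ≠ 0 ∧
      aeval (Fin.cons z Y : Fin (d + 1) → F) c ≠ 0 ∧
      ∀ h, aeval (Fin.cons z Y : Fin (d + 1) → F) h = 0 → ∃ N, f ∣ c ^ N * h := by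
  obtain ⟨f, c, hc, h0, h1, hdvd⟩ :=
    exists_aeval_eq_zero_and_dvd (R := Algebra.adjoin K (Set.range Y)) hz
  obtain ⟨θ, hθ, hθd⟩ := aeval_cons_eq hY.aevalEquiv hY.algebraMap_aevalEquiv z
  refine ⟨θ.symm f, θ.symm (Polynomial.C c), ?_, ?_, ?_, fun h hh => ?_⟩
  · rw [hθ, θ.apply_symm_apply, h0]
  · rwa [hθ, hθd, θ.apply_symm_apply]
  · rw [hθ, θ.apply_symm_apply, Polynomial.aeval_C]
    simpa using hc
  · obtain ⟨N, hN⟩ := hdvd (θ h) (by rw [← hθ, hh])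
    refine ⟨N, ?_⟩
    have := map_dvd θ.symm hN
    rwa [map_mul, map_pow, θ.symm_apply_apply] at this

variable {Γ : Type*} [LinearOrderedCommGroupWithZero Γ] {v : Valuation F Γ}

lemma IsRationalVal.exists_val_lt_one (hv : IsRationalVal K v) (y : F) :
    ∃ y', v y' < 1 ∧ ∀ L : IntermediateField K F, y' ∈ L → y ∈ L := by
  rcases le_or_gt (v y) 1 with h | h
  · obtain ⟨c, hc⟩ := hv.exists_sub_lt y h
    exact ⟨_, hc, fun L hL => by simpa using L.add_mem hL (L.algebraMap_mem c)⟩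
  · exact ⟨y⁻¹, by rw [map_inv₀]; exact inv_lt_one_of_one_lt₀ h,
      fun L hL => by simpa using L.inv_mem hL⟩

lemma IsRationalVal.exists_basis_and_primitive (hv : IsRationalVal K v)
    [Algebra.EssFiniteType K F] {d : ℕ} (hd : Algebra.trdeg K F = d) :
    ∃ (Y : Fin d → F) (z : F), AlgebraicIndependent K Y ∧
      IsSeparable (IntermediateField.adjoin K (Set.range Y)) z ∧ (∀ i, v (Y i) < 1) ∧ v z < 1 ∧
      IntermediateField.adjoin K (Set.range (Fin.cons z Y : Fin (d + 1) → F)) = ⊤ := by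
  obtain ⟨s, hs, hsep⟩ := hv.exists_separating_transcendenceBasis
  have hcard : s.card = d := by
    have := hs.lift_cardinalMk_eq_trdeg
    rw [hd] at this
    simpa using this
  let eqv := s.equivFinOfCardEq hcard
  choose n hn hnL using hv.exists_val_lt_one
  let Y : Fin d → F := fun i => n (eqv.symm i)
  let L := IntermediateField.adjoin K (Set.range Y)
  have hle : IntermediateField.adjoin K (s : Set F) ≤ L := by
    rw [IntermediateField.adjoin_le_iff]
    intro y hy
    refine hnL y L (IntermediateField.subset_adjoin _ _ ⟨eqv ⟨y, hy⟩, ?_⟩)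
    simp [Y]
  have hLsep : Algebra.IsSeparable L F := by
    algebraize [(IntermediateField.inclusion hle).toRingHom]
    have : IsScalarTower (IntermediateField.adjoin K (s : Set F)) L F := .of_algebraMap_eq fun _ => rfl
    exact Algebra.isSeparable_tower_top_of_isSeparable (IntermediateField.adjoin K (s : Set F)) L F
  have hess : Algebra.EssFiniteType L F := .of_comp K L F
  have hfin : FiniteDimensional L F := Algebra.finite_of_essFiniteType_of_isAlgebraic
  obtain ⟨z₀, hz₀⟩ := Field.exists_primitive_element L F
  have htop : IntermediateField.adjoin K (Set.range (Fin.cons (n z₀) Y : Fin (d + 1) → F)) = ⊤ := by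
    have h1 : L ≤ IntermediateField.adjoin K (Set.range (Fin.cons (n z₀) Y : Fin (d + 1) → F)) := by
      apply IntermediateField.adjoin.mono
      rw [Fin.range_cons]
      exact Set.subset_insert _ _
    have h2 : z₀ ∈ IntermediateField.adjoin K (Set.range (Fin.cons (n z₀) Y : Fin (d + 1) → F)) := by
      refine hnL z₀ _ (IntermediateField.subset_adjoin _ _ ?_)
      rw [Fin.range_cons]
      exact Set.mem_insert _ _
    have h3 := IntermediateField.adjoin_adjoin_left K (Set.range Y) {z₀}
    rw [hz₀, IntermediateField.restrictScalars_top] at h3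
    rw [eq_top_iff, h3, IntermediateField.adjoin_le_iff, Set.union_subset_iff]
    exact ⟨fun y hy => h1 (IntermediateField.subset_adjoin _ _ hy), by simpa using h2⟩
  refine ⟨Y, n z₀, ?_, Algebra.IsSeparable.isSeparable L _, fun i => hn _, hn _, htop⟩
  have halg : Algebra.IsAlgebraic (Algebra.adjoin K (Set.range Y)) F := by
    open scoped IntermediateField.algebraAdjoinAdjoin in
    exact (IsFractionRing.comap_isAlgebraic_iff (K := L)).2 inferInstance
  exact (Algebra.IsAlgebraic.isTranscendenceBasis_of_lift_le_trdeg_of_finite K Y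
    (by rw [hd]; simp)).1

lemma hasPoints_of_solvable (hv : IsRationalVal K v) [Algebra.EssFiniteType K F] {d : ℕ}
    (hd : Algebra.trdeg K F = d)
    (H : ∀ (P : Fin (d + 1) → F) (f g : MvPolynomial (Fin (d + 1)) K), (∀ i, v (P i) < 1) →
      aeval P f = 0 → aeval P (pderiv 0 f) ≠ 0 → aeval P g ≠ 0 →
      ∃ Q, eval Q f = 0 ∧ eval Q g ≠ 0) : HasPoints K F := by
  obtain ⟨Y, z, hY, hz, hvY, hvz, htop⟩ := hv.exists_basis_and_primitive hd
  obtain ⟨f, c, hf, hf', hc, hdvd⟩ := exists_equation hY hz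
  set P : Fin (d + 1) → F := Fin.cons z Y
  intro S
  have hex : ∀ s : F, ∃ a b : MvPolynomial (Fin (d + 1)) K, aeval P b ≠ 0 ∧
      s * aeval P b = aeval P a := by
    intro s
    obtain ⟨a, b, h⟩ := (IntermediateField.mem_adjoin_range_iff K P s).1 (htop ▸ trivial)
    by_cases hb : aeval P b = 0
    · exact ⟨0, 1, by simp, by simp [h, hb]⟩
    · exact ⟨a, b, hb, by rw [h, div_mul_cancel₀ _ hb]⟩
  choose a b hb hab using hex
  obtain ⟨Q, hQf, hQg⟩ := H P f (c * ∏ s ∈ S, b s)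
    (Fin.cases (by simpa [P] using hvz) (by simpa [P] using hvY)) hf hf' (by
      rw [map_mul, map_prod]
      exact mul_ne_zero hc (Finset.prod_ne_zero_iff.2 fun s _ => hb s))
  rw [map_mul, map_prod, mul_ne_zero_iff, Finset.prod_ne_zero_iff] at hQg
  refine nonempty_algHom_adjoin (P := P) (Q := Q) (fun h hh => ?_)
    fun s hs => ⟨a s, b s, hQg.2 s hs, hab s⟩
  obtain ⟨N, q, hq⟩ := hdvd h hh
  have := congrArg (eval Q) hq
  rw [map_mul, map_mul, map_pow, hQf, zero_mul, mul_eq_zero] at this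
  exact this.resolve_left (pow_ne_zero N hQg.1)

end PrimitivePresentation

section ResiduePlace

open IsLocalRing

variable {K F : Type*} [Field K] [Field F] [Algebra K F] {O O₁ : ValuationSubring F}

lemma valuation_lt_one_of_le (hO : O ≤ O₁) {x : F} (hx : O₁.valuation x < 1) :
    O.valuation x < 1 := by
  by_contra! h
  have hx0 : x ≠ 0 := by
    rintro rfl
    simp at h
  have h1 : x⁻¹ ∈ O := by
    rw [← O.valuation_le_one_iff, map_inv₀]
    exact inv_le_one_of_one_le₀ h
  have h2 := (O₁.valuation_le_one_iff _).2 (hO h1)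
  rw [map_inv₀] at h2
  have h3 : 0 < O₁.valuation x := by simpa [zero_lt_iff] using hx0
  exact ((inv_le_one₀ h3).1 h2).not_gt hx

/-- The valuation ring induced on the residue field of a coarser valuation ring. -/
def residueValuationSubring (hO : O ≤ O₁) : ValuationSubring (ResidueField O₁) :=
  { (O.toSubring.comap O₁.subtype).map (residue O₁) with
    mem_or_inv_mem' := by
      intro x
      obtain ⟨y, rfl⟩ := residue_surjective x
      by_cases hy : (y : F) ∈ O
      · exact Or.inl ⟨y, hy, rfl⟩
      · have hy' : (y : F)⁻¹ ∈ O := (O.mem_or_inv_mem _).resolve_left hy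
        have hy0 : (y : F) ≠ 0 := by
          intro h
          exact hy (h ▸ O.zero_mem)
        refine Or.inr ⟨⟨_, hO hy'⟩, hy', ?_⟩
        rw [eq_comm]
        refine inv_eq_of_mul_eq_one_right ?_
        rw [← map_mul, ← map_one (residue O₁)]
        exact congrArg _ (Subtype.ext (mul_inv_cancel₀ hy0)) }

lemma mem_residueValuationSubring (hO : O ≤ O₁) {x : ResidueField O₁} :
    x ∈ residueValuationSubring hO ↔ ∃ y : O₁, (y : F) ∈ O ∧ residue O₁ y = x := Iff.rfl

lemma isRationalVal_residueValuationSubring (hO : O ≤ O₁) [Algebra K O₁] [IsScalarTower K O₁ F]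
    (hv : IsRationalVal K O.valuation) :
    IsRationalVal K (residueValuationSubring hO).valuation := by
  have hmem : ∀ c : K, algebraMap K (ResidueField O₁) c ∈ residueValuationSubring hO := fun c => by
    refine (mem_residueValuationSubring hO).2 ⟨algebraMap K O₁ c, ?_, rfl⟩
    rw [← O₁.algebraMap_apply, ← IsScalarTower.algebraMap_apply K O₁ F, ← O.valuation_le_one_iff]
    exact hv.map_algebraMap_le c
  refine ⟨fun c hc => le_antisymm ((ValuationSubring.valuation_le_one_iff _ _).2 (hmem c)) ?_,
    fun x hx => ?_⟩
  · have := (ValuationSubring.valuation_le_one_iff _ _).2 (hmem c⁻¹)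
    rw [map_inv₀, map_inv₀] at this
    exact (inv_le_one₀ (by simpa [zero_lt_iff] using hc)).1 this
  · rw [ValuationSubring.valuation_le_one_iff] at hx
    obtain ⟨y, hy, rfl⟩ := (mem_residueValuationSubring hO).1 hx
    obtain ⟨c, hc⟩ := hv.exists_sub_lt y ((O.valuation_le_one_iff _).2 hy)
    refine ⟨c, ?_⟩
    have e : residue O₁ y - algebraMap K (ResidueField O₁) c =
        residue O₁ (y - algebraMap K O₁ c) := (map_sub (residue O₁) _ _).symm
    have e' : ((y - algebraMap K O₁ c : O₁) : F) = y - algebraMap K F c := by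
      rw [IsScalarTower.algebraMap_apply K O₁ F]
      rfl
    rw [← e'] at hc
    rw [e]
    generalize y - algebraMap K O₁ c = z at hc
    by_contra! h
    have hz0 : residue O₁ z ≠ 0 := by
      intro h0
      rw [h0] at h
      simp at h
    have hinv : (residue O₁ z)⁻¹ ∈ residueValuationSubring hO := by
      rw [← ValuationSubring.valuation_le_one_iff, map_inv₀]
      exact inv_le_one_of_one_le₀ h
    obtain ⟨w, hw, hwz⟩ := (mem_residueValuationSubring hO).1 hinv
    have h1 : residue O₁ (z * w - 1) = 0 := by
      rw [map_sub, map_mul, hwz, mul_inv_cancel₀ hz0, map_one, sub_self]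
    rw [residue_eq_zero_iff, ValuationSubring.valuation_lt_one_iff] at h1
    have h2 := valuation_lt_one_of_le hO h1
    have h3 : O.valuation (z * w) < 1 := by
      rw [map_mul]
      exact mul_lt_one_of_nonneg_of_lt_one_left zero_le hc ((O.valuation_le_one_iff _).2 hw)
    have h4 := O.valuation.map_sub_lt h3 h2
    have e4 : (z * w : F) - ((z * w - 1 : O₁) : F) = 1 := by
      push_cast
      ring
    rw [e4] at h4
    simp at h4

end ResiduePlace

section Composite

open MvPolynomial IntermediateField

variable {K k F : Type*} [Field K] [Field k] [Field F] [Algebra K F] [Algebra K k] [Algebra k F]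
  {O O₁ : ValuationSubring F}

lemma hasPoints_of_composite (hK : IsLargeField K) (hO : O ≤ O₁) [Algebra K O₁] [Algebra k O₁]
    [IsScalarTower K O₁ F] [IsScalarTower k O₁ F] [IsScalarTower K k O₁]
    (hv : IsRationalVal K O.valuation) [Algebra.EssFiniteType K F] [Algebra.EssFiniteType K k]
    {c : F} (hc : O₁.valuation c < 1) (hc0 : c ≠ 0) [FiniteDimensional k⟮c⟯ F]
    {d : ℕ} (hd : Algebra.trdeg K F = d)
    (hκ : HasPoints K (IsLocalRing.ResidueField O₁)) : HasPoints K F := by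
  have hfin : FiniteDimensional k (IsLocalRing.ResidueField O₁) :=
    finiteDimensional_residueField hc hc0
  have : IsScalarTower K k (IsLocalRing.ResidueField O₁) := .of_algebraMap_eq fun x => by
    rw [IsScalarTower.algebraMap_apply k O₁ (IsLocalRing.ResidueField O₁),
      ← IsScalarTower.algebraMap_apply K k O₁,
      ← IsScalarTower.algebraMap_apply K O₁ (IsLocalRing.ResidueField O₁)]
  have : Algebra.EssFiniteType K (IsLocalRing.ResidueField O₁) := .comp K k _
  have := (isRationalVal_residueValuationSubring hO hv).formallySmooth
  obtain ⟨t, ht0, ht1, ht⟩ := exists_uniformizer (k := k) hc hc0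
  have htO : t ∈ O₁ := (O₁.valuation_le_one_iff t).1 ht1.le
  have hdvd : ∀ r s : O₁, O₁.valuation (r : F) ≤ O₁.valuation (s : F) ↔ s ∣ r := fun r s => by
    constructor
    · intro h
      by_cases hs : (s : F) = 0
      · rw [hs, map_zero, le_zero_iff, map_eq_zero] at h
        rw [(Subtype.ext h : r = 0)]
        exact dvd_zero _
      · have h0 : 0 < O₁.valuation (s : F) := by simpa [zero_lt_iff] using hs
        refine ⟨⟨r / s, ?_⟩, Subtype.ext (mul_div_cancel₀ (r : F) hs).symm⟩
        rw [← O₁.valuation_le_one_iff, map_div₀]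
        exact (div_le_one₀ h0).2 h
    · rintro ⟨w, rfl⟩
      change O₁.valuation (s * w : F) ≤ _
      rw [map_mul]
      exact mul_le_of_le_one_right' (O₁.valuation_le_one w)
  refine hasPoints_of_solvable hv hd fun P f g hP hf hf' hg => ?_
  have hPO : ∀ i, P i ∈ O₁ := fun i => hO ((O.valuation_le_one_iff _).1 (hP i).le)
  let P' : Fin (d + 1) → O₁ := fun i => ⟨P i, hPO i⟩
  have hev : ∀ p : MvPolynomial (Fin (d + 1)) K, aeval P p = (aeval P' p : F) := fun p => by
    rw [← O₁.algebraMap_apply, ← aeval_algebraMap_apply]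
    rfl
  rw [hev] at hf hf' hg
  refine exists_eval_of_discrete hK hκ (t := ⟨t, htO⟩) (fun h => ht0 (congrArg Subtype.val h))
    (fun r => ?_) (fun b hb => ?_) (P := P') (i := 0) (Subtype.ext hf)
    (fun h => hf' (congrArg Subtype.val h)) (fun h => hg (congrArg Subtype.val h))
  · rw [IsLocalRing.residue_eq_zero_iff, ValuationSubring.valuation_lt_one_iff, ← hdvd]
    exact ⟨ht r, fun h => h.trans_lt ht1⟩
  · obtain ⟨n, hn⟩ := exists_pow_lt_valuation_of_lt_one (k := k) hc hc0 ht0 ht1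
      (b := b) fun h => hb (Subtype.ext h)
    refine ⟨n, fun h => hn.not_ge (((hdvd _ _).2 h).trans ?_)⟩
    change O₁.valuation (t ^ (n + 1)) ≤ _
    rw [map_pow]
    exact pow_le_pow_right_of_le_one' ht1.le n.le_succ

end Composite

section LowDegree

open IntermediateField

section

variable {k F : Type*} [Field k] [Field F] [Algebra k F] {O : ValuationSubring F} {c : F}

lemma transcendental_of_valuation_lt_one [Algebra k O] [IsScalarTower k O F]
    (hc : O.valuation c < 1) (hc0 : c ≠ 0) : Transcendental k c := by
  rintro ⟨r, hr, h⟩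
  obtain ⟨n, hn⟩ := exists_pow_le_valuation_aeval hc hr
  rw [h, map_zero] at hn
  exact pow_ne_zero n ((map_ne_zero _).2 hc0) hn.symm

lemma finiteDimensional_of_trdeg_le_one [Algebra.EssFiniteType k F] (hc : Transcendental k c)
    (h : Algebra.trdeg k F ≤ 1) : FiniteDimensional k⟮c⟯ F := by
  have hi : AlgebraicIndependent k (fun _ : Unit => c) := algebraicIndependent_unique_type_iff.2 hc
  have hb := hi.isTranscendenceBasis_of_lift_trdeg_le_of_finite (by simpa using h)
  have halg : Algebra.IsAlgebraic k⟮c⟯ F := by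
    have := hb.isAlgebraic_field
    rwa [Set.range_const] at this
  have : Algebra.EssFiniteType k⟮c⟯ F := .of_comp k _ _
  exact Algebra.finite_of_essFiniteType_of_isAlgebraic

end

variable {K F : Type*} [Field K] [Field F] [Algebra K F]

lemma hasPoints_of_surjective (h : Function.Surjective (algebraMap K F)) : HasPoints K F := by
  intro S
  let e : K ≃ₐ[K] F := .ofBijective (Algebra.ofId K F) ⟨(algebraMap K F).injective, h⟩
  exact ⟨e.symm.toAlgHom.comp (Algebra.adjoin K (S : Set F)).val⟩

lemma IsRationalVal.surjective_or_exists {Γ : Type*} [LinearOrderedCommGroupWithZero Γ]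
    {v : Valuation F Γ} (hv : IsRationalVal K v) :
    Function.Surjective (algebraMap K F) ∨ ∃ c, c ≠ 0 ∧ v c < 1 := by
  by_contra! hcon
  obtain ⟨hs, hcon⟩ := hcon
  have hle : ∀ x, v x ≤ 1 → ∃ c : K, algebraMap K F c = x := fun x hx => by
    obtain ⟨c, hc⟩ := hv.exists_sub_lt x hx
    refine ⟨c, ?_⟩
    by_contra hne
    exact (hcon _ (sub_ne_zero.2 (Ne.symm hne))).not_gt hc
  refine hs fun x => ?_
  rcases le_total (v x) 1 with h | h
  · exact hle x h
  · obtain ⟨c, hc⟩ := hle x⁻¹ (by rw [map_inv₀]; exact inv_le_one_of_one_le₀ h)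
    exact ⟨c⁻¹, by rw [map_inv₀, hc, inv_inv]⟩

variable {O : ValuationSubring F}

lemma IsRationalVal.algebraMap_mem (hv : IsRationalVal K O.valuation) (c : K) :
    algebraMap K F c ∈ O :=
  (O.valuation_le_one_iff _).1 (hv.map_algebraMap_le c)

lemma hasPoints_of_trdeg_le_one (hK : IsLargeField K) (hv : IsRationalVal K O.valuation)
    [Algebra.EssFiniteType K F] (h : Algebra.trdeg K F ≤ 1) : HasPoints K F := by
  rcases hv.surjective_or_exists with hs | ⟨c, hc0, hc⟩
  · exact hasPoints_of_surjective hs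
  let : Algebra K O := ((algebraMap K F).codRestrict O hv.algebraMap_mem).toAlgebra
  have : IsScalarTower K O F := .of_algebraMap_eq fun _ => rfl
  have := finiteDimensional_of_trdeg_le_one (transcendental_of_valuation_lt_one (k := K) hc hc0) h
  obtain ⟨d, hd⟩ := Cardinal.lt_aleph0.1 (h.trans_lt Cardinal.one_lt_aleph0)
  refine hasPoints_of_composite (k := K) hK le_rfl hv hc hc0 hd (hasPoints_of_surjective fun x => ?_)
  obtain ⟨y, rfl⟩ := IsLocalRing.residue_surjective x
  obtain ⟨a, ha⟩ := hv.exists_sub_lt y (O.valuation_le_one y)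
  refine ⟨a, ?_⟩
  rw [eq_comm, ← sub_eq_zero]
  have e : IsLocalRing.residue O y - algebraMap K (IsLocalRing.ResidueField O) a =
      IsLocalRing.residue O (y - algebraMap K O a) := (map_sub (IsLocalRing.residue O) _ _).symm
  rw [e, IsLocalRing.residue_eq_zero_iff, ValuationSubring.valuation_lt_one_iff]
  exact ha

end LowDegree

section Coarsening

open IntermediateField

variable {K F : Type*} [Field K] [Field F] [Algebra K F] {O : ValuationSubring F} {a : F}

/-- The smallest valuation ring above `O` in which `a` is invertible, for `a` in `O`. -/
def coarsening (ha : O.valuation a ≤ 1) : ValuationSubring F where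
  carrier := {y | ∃ n : ℕ, O.valuation y * O.valuation a ^ n ≤ 1}
  mul_mem' := by
    rintro x y ⟨m, hm⟩ ⟨n, hn⟩
    refine ⟨m + n, ?_⟩
    rw [map_mul, pow_add, mul_mul_mul_comm]
    exact mul_le_one' hm hn
  one_mem' := ⟨0, by simp⟩
  add_mem' := by
    rintro x y ⟨m, hm⟩ ⟨n, hn⟩
    refine ⟨m + n, ?_⟩
    rw [← map_pow, ← map_mul] at hm hn ⊢
    have e : (x + y) * a ^ (m + n) = x * a ^ m * a ^ n + y * a ^ n * a ^ m := by ring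
    rw [e]
    refine O.valuation.map_add_le ?_ ?_
    · rw [map_mul, map_pow O.valuation a n]
      exact mul_le_one' hm (pow_le_one' ha n)
    · rw [map_mul, map_pow O.valuation a m]
      exact mul_le_one' hn (pow_le_one' ha m)
  zero_mem' := ⟨0, by simp⟩
  neg_mem' := by
    rintro x ⟨m, hm⟩
    exact ⟨m, by rwa [Valuation.map_neg]⟩
  mem_or_inv_mem' := fun x => by
    refine (O.mem_or_inv_mem x).imp (fun h => ⟨0, ?_⟩) (fun h => ⟨0, ?_⟩) <;>
    simpa using (O.valuation_le_one_iff _).2 h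

lemma mem_coarsening (ha : O.valuation a ≤ 1) {y : F} :
    y ∈ coarsening ha ↔ ∃ n : ℕ, O.valuation y * O.valuation a ^ n ≤ 1 := Iff.rfl

lemma le_coarsening (ha : O.valuation a ≤ 1) : O ≤ coarsening ha := fun x hx =>
  (mem_coarsening ha).2 ⟨0, by simpa using (O.valuation_le_one_iff _).2 hx⟩

lemma valuation_coarsening_lt_one (ha : O.valuation a < 1) {b : F} (hb : b ≠ 0)
    (h : ∀ n, O.valuation b ≤ O.valuation a ^ n) : (coarsening ha.le).valuation b < 1 := by
  by_contra! hcon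
  have h1 : b⁻¹ ∈ coarsening ha.le := by
    rw [← ValuationSubring.valuation_le_one_iff, map_inv₀]
    exact inv_le_one_of_one_le₀ hcon
  obtain ⟨n, hn⟩ := (mem_coarsening ha.le).1 h1
  have hvb : 0 < O.valuation b := by simpa [zero_lt_iff] using hb
  have hva : 0 < O.valuation a := hvb.trans_le (by simpa using h 1)
  rw [map_inv₀, inv_mul_le_one₀ hvb] at hn
  exact ((hn.trans (h (n + 1))).trans_lt
    (pow_lt_pow_right_of_lt_one₀ hva ha (Nat.lt_succ_self n))).ne rfl

lemma adjoin_le_coarsening [Algebra K O] [IsScalarTower K O F] (ha : O.valuation a < 1)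
    (ha0 : a ≠ 0) {y : F} (hy : y ∈ K⟮a⟯) : y ∈ coarsening ha.le := by
  obtain ⟨r, s, rfl⟩ := (mem_adjoin_simple_iff K y).1 hy
  by_cases hs : s = 0
  · rw [hs, map_zero, div_zero]
    exact zero_mem _
  obtain ⟨n, hn⟩ := exists_pow_le_valuation_aeval ha hs
  refine (mem_coarsening ha.le).2 ⟨n, ?_⟩
  rw [← hn, ← map_mul, div_mul_cancel₀]
  · exact valuation_aeval_le ha r
  · intro h
    rw [h, map_zero] at hn
    exact pow_ne_zero n ((map_ne_zero _).2 ha0) hn.symm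

lemma hasPoints_of_trdeg_le_two (hK : IsLargeField K) (hv : IsRationalVal K O.valuation)
    [Algebra.EssFiniteType K F] (h : Algebra.trdeg K F ≤ 2) : HasPoints K F := by
  by_cases h1 : Algebra.trdeg K F ≤ 1
  · exact hasPoints_of_trdeg_le_one hK hv h1
  obtain ⟨d, hd⟩ := Cardinal.lt_aleph0.1 (h.trans_lt (Cardinal.natCast_lt_aleph0 (n := 2)))
  by_cases harch : ∀ a b : F, O.valuation a < 1 → b ≠ 0 →
      ∃ n : ℕ, O.valuation a ^ n < O.valuation b
  · rw [hd] at h h1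
    norm_cast at h h1
    obtain rfl : d = 2 := by lia
    exact hasPoints_of_solvable hv hd fun P f g hP hf hf' hg =>
      IsGoodPoint.solvable hK hv harch ⟨hP, hf, hf', hg⟩
  push Not at harch
  obtain ⟨a, b, ha, hb, hab⟩ := harch
  have ha0 : a ≠ 0 := by
    rintro rfl
    simpa [hb] using hab 1
  let : Algebra K O := ((algebraMap K F).codRestrict O hv.algebraMap_mem).toAlgebra
  have : IsScalarTower K O F := .of_algebraMap_eq fun _ => rfl
  let O₁ := coarsening ha.le
  have hO : O ≤ O₁ := le_coarsening ha.le
  let k := K⟮a⟯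
  let : Algebra k O₁ := (k.val.toRingHom.codRestrict O₁
    fun x => adjoin_le_coarsening ha ha0 x.2).toAlgebra
  have : IsScalarTower k O₁ F := .of_algebraMap_eq fun _ => rfl
  let : Algebra K O₁ := ((algebraMap K F).codRestrict O₁
    fun x => hO (hv.algebraMap_mem x)).toAlgebra
  have : IsScalarTower K O₁ F := .of_algebraMap_eq fun _ => rfl
  have : IsScalarTower K k O₁ := .of_algebraMap_eq fun _ => rfl
  have : Algebra.EssFiniteType K k := essFiniteType_iff.2 ⟨{a}, by simp [k]⟩
  have : Algebra.EssFiniteType k F := .of_comp K _ _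
  have hb1 : O₁.valuation b < 1 := valuation_coarsening_lt_one ha hb hab
  have htb : Transcendental k b := transcendental_of_valuation_lt_one hb1 hb
  have hta : Transcendental K a := transcendental_of_valuation_lt_one ha ha0
  have : Algebra.Transcendental k F := ⟨b, htb⟩
  have : Algebra.Transcendental K k := ⟨AdjoinSimple.gen K a, fun h => hta (by
    simpa using h.algebraMap (A := F))⟩
  have hadd := trdeg_add_eq K k (A := F)
  have hk : 1 ≤ Algebra.trdeg K k := Cardinal.one_le_iff_pos.2 (trdeg_pos _ _)
  have hF : 1 ≤ Algebra.trdeg k F := Cardinal.one_le_iff_pos.2 (trdeg_pos _ _)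
  obtain ⟨m, hm⟩ := Cardinal.lt_aleph0.1 ((le_self_add.trans hadd.le).trans_lt
    (hd ▸ Cardinal.natCast_lt_aleph0))
  obtain ⟨n, hn⟩ := Cardinal.lt_aleph0.1 ((le_add_self.trans hadd.le).trans_lt
    (hd ▸ Cardinal.natCast_lt_aleph0))
  rw [← hadd, hm, hn] at h
  rw [hm] at hk
  rw [hn] at hF
  norm_cast at h hk hF
  have : FiniteDimensional k⟮b⟯ F := finiteDimensional_of_trdeg_le_one htb (by
    rw [hn]
    norm_cast
    lia)
  refine hasPoints_of_composite (k := k) hK hO hv hb1 hb hd ?_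
  have : FiniteDimensional k (IsLocalRing.ResidueField O₁) := finiteDimensional_residueField hb1 hb
  have : IsScalarTower K k (IsLocalRing.ResidueField O₁) := .of_algebraMap_eq fun _ => rfl
  have : Algebra.EssFiniteType K (IsLocalRing.ResidueField O₁) := .comp K k _
  refine hasPoints_of_trdeg_le_one hK (isRationalVal_residueValuationSubring hO hv) ?_
  rw [← trdeg_add_eq K k, trdeg_eq_zero (R := k), add_zero, hm]
  norm_cast
  lia

end Coarsening

section Descent

open MvPolynomial

variable {K F : Type*} [Field K] [Field F] [Algebra K F] {O : ValuationSubring F}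

lemma isRationalVal_of_isKRationalPlace (h : IsKRationalPlace K F O) :
    IsRationalVal K O.valuation := by
  obtain ⟨hmem, -, hsurj⟩ := h
  refine ⟨fun c hc => le_antisymm ((O.valuation_le_one_iff _).2 (hmem c)) ?_, fun x hx => ?_⟩
  · have := (O.valuation_le_one_iff _).2 (hmem c⁻¹)
    rw [map_inv₀, map_inv₀] at this
    exact (inv_le_one₀ (by simpa [zero_lt_iff] using hc)).1 this
  · obtain ⟨c, hc⟩ := hsurj (IsLocalRing.residue O ⟨x, (O.valuation_le_one_iff x).1 hx⟩)
    refine ⟨c, ?_⟩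
    rw [eq_comm, ← sub_eq_zero, ← map_sub, IsLocalRing.residue_eq_zero_iff,
      ValuationSubring.valuation_lt_one_iff] at hc
    exact hc

lemma IsRationalVal.comap_valuationSubring (hv : IsRationalVal K O.valuation)
    (L : IntermediateField K F) :
    IsRationalVal K (O.comap (algebraMap L F)).valuation := by
  have hle : ∀ x : L, (O.comap (algebraMap L F)).valuation x ≤ 1 ↔ O.valuation (x : F) ≤ 1 :=
    fun x => by
      rw [ValuationSubring.valuation_le_one_iff, ValuationSubring.valuation_le_one_iff]
      rfl
  have hlt : ∀ x : L, O.valuation (x : F) < 1 → (O.comap (algebraMap L F)).valuation x < 1 := by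
    intro x hx
    by_cases hx0 : x = 0
    · simp [hx0]
    by_contra! hcon
    have h1 : (O.comap (algebraMap L F)).valuation x⁻¹ ≤ 1 := by
      rw [map_inv₀]
      exact inv_le_one_of_one_le₀ hcon
    rw [hle] at h1
    push_cast at h1
    rw [map_inv₀] at h1
    have h0 : 0 < O.valuation (x : F) := by simpa [zero_lt_iff] using hx0
    exact ((inv_le_one₀ h0).1 h1).not_gt hx
  refine ⟨fun c hc => le_antisymm ((hle _).2 (hv.map_algebraMap_le c)) ?_, fun x hx => ?_⟩
  · have := (hle (algebraMap K L c⁻¹)).2 (hv.map_algebraMap_le c⁻¹)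
    rw [map_inv₀, map_inv₀] at this
    exact (inv_le_one₀ (by simpa [zero_lt_iff] using hc)).1 this
  · obtain ⟨c, hc⟩ := hv.exists_sub_lt x ((hle x).1 hx)
    exact ⟨c, hlt _ hc⟩

lemma HasPoints.exists_eval {n : ℕ} (h : HasPoints K F) {E N : Finset (MvPolynomial (Fin n) K)}
    {x : Fin n → F} (hE : ∀ f ∈ E, aeval x f = 0) (hN : ∀ g ∈ N, aeval x g ≠ 0) :
    ∃ q : Fin n → K, (∀ f ∈ E, eval q f = 0) ∧ ∀ g ∈ N, eval q g ≠ 0 := by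
  classical
  let S : Finset F := insert (aeval x (∏ g ∈ N, g))⁻¹ (Finset.univ.image x)
  obtain ⟨φ⟩ := h S
  have hx : ∀ i, x i ∈ Algebra.adjoin K (S : Set F) := fun i =>
    Algebra.subset_adjoin (by simp [S])
  let x' : Fin n → Algebra.adjoin K (S : Set F) := fun i => ⟨x i, hx i⟩
  have hval : ∀ p : MvPolynomial (Fin n) K, ((aeval x' p : Algebra.adjoin K (S : Set F)) : F) =
      aeval x p := fun p => (aeval_algebraMap_apply F x' p).symm
  have hφ : ∀ p : MvPolynomial (Fin n) K, eval (fun i => φ (x' i)) p = φ (aeval x' p) := fun p => by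
    rw [← coe_aeval_eq_eval]
    exact (comp_aeval_apply x' φ p).symm
  refine ⟨fun i => φ (x' i), fun f hf => ?_, fun g hg h0 => ?_⟩
  · rw [hφ, (Subtype.ext ((hval f).trans (hE f hf)) : aeval x' f = 0), map_zero]
  · let u : Algebra.adjoin K (S : Set F) :=
      ⟨(aeval x (∏ g ∈ N, g))⁻¹, Algebra.subset_adjoin (by simp [S])⟩
    have hu : aeval x' (∏ g ∈ N, g) * u = 1 := by
      apply Subtype.ext
      change ((aeval x' (∏ g ∈ N, g) : Algebra.adjoin K (S : Set F)) : F) * _ = 1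
      rw [hval]
      refine mul_inv_cancel₀ ?_
      rw [map_prod]
      exact Finset.prod_ne_zero_iff.2 hN
    have := congrArg φ hu
    rw [map_mul, ← hφ, map_prod, Finset.prod_eq_zero hg h0, zero_mul, map_one] at this
    exact zero_ne_one this

open scoped IntermediateField.algebraAdjoinAdjoin in
lemma trdeg_lt_of_not_algebraicIndependent {n : ℕ} {x : Fin n → F}
    (hx : ¬ AlgebraicIndependent K x) (htop : IntermediateField.adjoin K (Set.range x) = ⊤) :
    Algebra.trdeg K F < n := by
  by_contra! h
  have halg : Algebra.IsAlgebraic (IntermediateField.adjoin K (Set.range x)) F :=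
    ⟨fun y => isAlgebraic_algebraMap
      (⟨y, htop ▸ IntermediateField.mem_top⟩ : IntermediateField.adjoin K (Set.range x))⟩
  have : Algebra.IsAlgebraic (Algebra.adjoin K (Set.range x)) F :=
    (IsFractionRing.comap_isAlgebraic_iff (K := IntermediateField.adjoin K (Set.range x))).2 halg
  exact hx (Algebra.IsAlgebraic.isTranscendenceBasis_of_lift_le_trdeg_of_finite K x
    (by simpa using h)).1

lemma exists_eval_of_isRationalVal (hK : IsLargeField K) (hv : IsRationalVal K O.valuation)
    {n : ℕ} (hn : n ≤ 3) {E N : Finset (MvPolynomial (Fin n) K)}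
    {x : Fin n → F} (hE : ∀ f ∈ E, aeval x f = 0) (hN : ∀ g ∈ N, aeval x g ≠ 0) :
    ∃ q : Fin n → K, (∀ f ∈ E, eval q f = 0) ∧ ∀ g ∈ N, eval q g ≠ 0 := by
  have := infinite_of_isLargeField hK
  by_cases hx : AlgebraicIndependent K x
  · have h0 : (∏ g ∈ N, g) ≠ 0 := Finset.prod_ne_zero_iff.2 fun g hg h => hN g hg (by simp [h])
    obtain ⟨q, hq⟩ : ∃ q : Fin n → K, eval q (∏ g ∈ N, g) ≠ 0 := by
      by_contra! h
      exact h0 (MvPolynomial.funext (by simpa using h))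
    rw [map_prod, Finset.prod_ne_zero_iff] at hq
    refine ⟨q, fun f hf => ?_, hq⟩
    rw [(map_eq_zero_iff _ hx).1 (hE f hf), map_zero]
  · let L := IntermediateField.adjoin K (Set.range x)
    let x' : Fin n → L := fun i => ⟨x i, IntermediateField.subset_adjoin _ _ ⟨i, rfl⟩⟩
    have hval : ∀ p : MvPolynomial (Fin n) K, ((aeval x' p : L) : F) = aeval x p :=
      fun p => (aeval_algebraMap_apply F x' p).symm
    have hfin : Algebra.EssFiniteType K L := IntermediateField.essFiniteType_iff.2
      ⟨(Set.finite_range x).toFinset, by simp [L]⟩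
    have hL : Algebra.trdeg K L ≤ 2 := by
      have hx' : ¬ AlgebraicIndependent K x' := fun h => hx (h.map' (f := L.val) L.val.injective)
      have htop : IntermediateField.adjoin K (Set.range x') = ⊤ := by
        apply IntermediateField.map_injective L.val
        rw [IntermediateField.adjoin_map, ← Set.range_comp, ← AlgHom.fieldRange_eq_map,
          IntermediateField.fieldRange_val]
        rfl
      have hlt := trdeg_lt_of_not_algebraicIndependent hx' htop
      obtain ⟨d, hd⟩ := Cardinal.lt_aleph0.1 (hlt.trans Cardinal.natCast_lt_aleph0)
      rw [hd] at hlt ⊢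
      norm_cast at hlt ⊢
      lia
    refine (hasPoints_of_trdeg_le_two hK (hv.comap_valuationSubring L) hL).exists_eval (x := x')
      (fun f hf => Subtype.ext ((hval f).trans (hE f hf))) fun g hg h => hN g hg ?_
    rw [← hval, h]
    rfl

end Descent

end RationalPlace

end

/-- Let `K` be a large field and `F|K` an algebraic function field which admits a `K`-rational
place. Then every finite system of polynomial equations and inequations in at most three
variables over `K` having a solution in `F` has a solution in `K`; that is, `K` is
existentially closed in `F` with respect to all existential sentences with at most three
existential quantifiers. -/
theorem ec_up_to_three_variables_of_rational_place
    (K : Type*) [Field K] (F : Type*) [Field F] [Algebra K F]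
    (hlarge : IsLargeField K) (hFF : IsFunctionField K F)
    (hplace : ∃ O : ValuationSubring F, IsKRationalPlace K F O) :
    ∀ n : ℕ, n ≤ 3 → ∀ (E N : Finset (MvPolynomial (Fin n) K)),
      (∃ x : Fin n → F, (∀ f ∈ E, MvPolynomial.aeval x f = 0) ∧
        (∀ g ∈ N, MvPolynomial.aeval x g ≠ 0)) →
      ∃ x : Fin n → K, (∀ f ∈ E, MvPolynomial.eval x f = 0) ∧
        (∀ g ∈ N, MvPolynomial.eval x g ≠ 0) := by
  rintro n hn E N ⟨x, hE, hN⟩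
  obtain ⟨O, hO⟩ := hplace
  exact RationalPlace.exists_eval_of_isRationalVal hlarge
    (RationalPlace.isRationalVal_of_isKRationalPlace hO) hn hE hN
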